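/- arXiv:0810.1731 — 3 statements merged into one kernel-verified Lean document; each statement's English description precedes it below -/
import Mathlib

section
/- Let $d\ge 3$ and let $T$ be the $d$-regular tree (the connected acyclic simple graph all of whose vertices have degree $d$). Let $A=\mathrm{Aut}(T)$ carry the topology of pointwise convergence on vertices, and let $\mu$ be the Haar measure on $A$ normalized so that vertex stabilizers have measure $1$. Let $n\ge 0$. Then for $\mu^n$-almost every $(a_1,\dots,a_n)\in A^n$ (that is, almost surely for independent $\mu$-random elements $a_1,\dots,a_n$ of $A$), the subgroup $\Gamma=\langle a_1,\dots,a_n\rangle$ of $A$ is a free group of rank $n$ and acts almost freely on $T$, that is, every nontrivial element of $\Gamma$ fixes only finitely many vertices of $T$. -/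
open MeasureTheory

namespace SimpleGraph

variable {V : Type*}

/-- The topology of pointwise convergence on vertices on the automorphism group `G ≃g G`: it is
induced from the product topology on `V → V`, where `V` is discrete. -/
instance autTopologicalSpace (G : SimpleGraph V) : TopologicalSpace (G ≃g G) :=
  TopologicalSpace.induced (fun a v => a v) (@Pi.topologicalSpace V (fun _ => V) (fun _ => ⊥))

/-- The Borel σ-algebra of the topology of pointwise convergence. -/
instance autMeasurableSpace (G : SimpleGraph V) : MeasurableSpace (G ≃g G) :=
  borel (G ≃g G)

instance autBorelSpace (G : SimpleGraph V) : BorelSpace (G ≃g G) :=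
  ⟨rfl⟩

/-- A group of automorphisms acts almost freely if every nontrivial element fixes only finitely
many vertices. -/
def ActsAlmostFreely {G : SimpleGraph V} (Γ : Subgroup (G ≃g G)) : Prop :=
  ∀ γ ∈ Γ, γ ≠ 1 → {v : V | γ v = v}.Finite

end SimpleGraph

/-- `H` is a free group of rank `n`: it has a free basis indexed by an `n`-element set. -/
def IsFreeOfRank (H : Type*) [Group H] (n : ℕ) : Prop :=
  Nonempty (FreeGroupBasis (Fin n) H)

open scoped ENNReal

namespace SimpleGraph

variable {V : Type*} {T : SimpleGraph V}

/-- An automorphism preserves distances. -/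
theorem dist_aut_apply (g : T ≃g T) (x y : V) : T.dist (g x) (g y) = T.dist x y := by
  have key : ∀ (h : T ≃g T) (x y : V), T.Reachable x y → T.dist (h x) (h y) ≤ T.dist x y := by
    intro h x y hr
    obtain ⟨p, hp⟩ := hr.exists_walk_length_eq_dist
    rw [← hp, ← Walk.length_map h.toHom p]
    exact dist_le _
  by_cases hr : T.Reachable x y
  · refine le_antisymm (key g x y hr) ?_
    have := key g.symm (g x) (g y) (hr.map g.toHom)
    simpa using this
  · have hr' : ¬ T.Reachable (g x) (g y) := fun h => hr (by simpa using h.map g.symm.toHom)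
    rw [dist_eq_zero_of_not_reachable hr, dist_eq_zero_of_not_reachable hr']

open Classical in
/-- The neighbour of `c` that is closer to `o`; it is `c` itself when there is none. -/
noncomputable def parent (T : SimpleGraph V) (o c : V) : V :=
  if h : ∃ z, T.Adj c z ∧ T.dist o c = T.dist o z + 1 then h.choose else c

theorem IsTree.exists_closer (hT : T.IsTree) {o c : V} (h : c ≠ o) :
    ∃ z, T.Adj c z ∧ T.dist o c = T.dist o z + 1 := by
  obtain ⟨p, hp⟩ := hT.1.exists_walk_length_eq_dist c o
  cases p with
  | nil => exact absurd rfl h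
  | cons hadj q =>
    rename_i z
    refine ⟨z, hadj, ?_⟩
    have h1 : T.dist z o ≤ q.length := dist_le q
    have h2 := hT.dist_eq_dist_add_one_of_adj o hadj
    simp only [Walk.length_cons] at hp
    rw [dist_comm (u := o) (v := c), dist_comm (u := o) (v := z)] at *
    omega

theorem IsTree.closer_unique (hT : T.IsTree) {o c z z' : V} (hz : T.Adj c z)
    (hz' : T.Adj c z') (h : T.dist o c = T.dist o z + 1) (h' : T.dist o c = T.dist o z' + 1) :
    z = z' := by
  have key : ∀ {z : V}, T.Adj c z → T.dist o c = T.dist o z + 1 →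
      ∃ p : T.Walk c o, p.IsPath ∧ p.snd = z := by
    intro z hz h
    obtain ⟨p, hp⟩ := hT.1.exists_walk_length_eq_dist z o
    refine ⟨Walk.cons hz p, Walk.isPath_of_length_eq_dist _ ?_, by simp⟩
    rw [Walk.length_cons, hp, dist_comm, dist_comm (u := c), h]
  obtain ⟨p, hp, rfl⟩ := key hz h
  obtain ⟨q, hq, rfl⟩ := key hz' h'
  rw [(hT.existsUnique_path c o).unique hp hq]

theorem IsTree.parent_spec (hT : T.IsTree) {o c : V} (h : c ≠ o) :
    T.Adj c (T.parent o c) ∧ T.dist o c = T.dist o (T.parent o c) + 1 := by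
  have h' := hT.exists_closer h
  rw [parent, dif_pos h']
  exact h'.choose_spec

theorem IsTree.parent_eq (hT : T.IsTree) {o c z : V} (hz : T.Adj c z)
    (h : T.dist o c = T.dist o z + 1) : T.parent o c = z := by
  have hc : c ≠ o := by rintro rfl; simp at h
  exact hT.closer_unique (hT.parent_spec hc).1 hz (hT.parent_spec hc).2 h

theorem IsTree.parent_eq_of_adj (hT : T.IsTree) {x y c : V} (hxy : T.Adj x y) (hx : c ≠ x)
    (hy : c ≠ y) : T.parent x c = T.parent y c := by
  have key : ∀ {x y : V}, T.Adj x y → c ≠ x → T.dist y c = T.dist x c + 1 →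
      T.parent x c = T.parent y c := by
    intro x y hxy hx h
    obtain ⟨h1, h2⟩ := hT.parent_spec hx
    refine (hT.parent_eq h1 ?_).symm
    have h3 := hT.dist_eq_dist_add_one_of_adj y h1
    have h4 : T.dist y (T.parent x c) ≤ T.dist y x + T.dist x (T.parent x c) :=
      hT.1.dist_triangle
    rw [dist_eq_one_iff_adj.2 hxy.symm] at h4
    omega
  rcases hT.dist_eq_dist_add_one_of_adj c hxy with h | h
  · exact (key hxy.symm hy (by rw [dist_comm, h, dist_comm])).symm
  · exact key hxy hx (by rw [dist_comm, h, dist_comm])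

theorem IsTree.parent_congr (hT : T.IsTree) {x y c : V} (h : T.dist x y < T.dist x c) :
    T.parent x c = T.parent y c := by
  obtain ⟨p, hp⟩ := hT.1.exists_walk_length_eq_dist x y
  rw [← hp] at h
  clear hp
  induction p with
  | nil => rfl
  | @cons x z y hxz p ih =>
    simp only [Walk.length_cons] at h
    have h1 : T.dist x c ≤ T.dist x z + T.dist z c := hT.1.dist_triangle
    rw [dist_eq_one_iff_adj.2 hxz] at h1
    have hx : c ≠ x := by rintro rfl; simp at h
    have hz : c ≠ z := by
      rintro rfl
      rw [dist_self] at h1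
      omega
    rw [hT.parent_eq_of_adj hxz hx hz]
    exact ih (by omega)

theorem IsTree.aut_parent (hT : T.IsTree) (g : T ≃g T) {o c : V} (hc : c ≠ o) :
    T.parent (g o) (g c) = g (T.parent o c) := by
  obtain ⟨h1, h2⟩ := hT.parent_spec hc
  exact hT.parent_eq (g.map_adj_iff.2 h1) (by simpa only [dist_aut_apply] using h2)

/-- Far from the root, automorphisms that move the root little commute with taking parents. -/
theorem IsTree.parent_aut_of_lt (hT : T.IsTree) (g : T ≃g T) {o c : V}
    (h : T.dist o (g o) < T.dist o c) :
    g c ≠ o ∧ T.parent o (g c) = g (T.parent o c) ∧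
      T.dist o (g c) = T.dist o (g (T.parent o c)) + 1 := by
  have hc : c ≠ o := by rintro rfl; simp at h
  have hgc : g c ≠ o := by
    intro hgo
    have := dist_aut_apply g o c
    rw [hgo, dist_comm] at this
    omega
  have hp : T.parent o (g c) = g (T.parent o c) := by
    rw [← hT.aut_parent g hc]
    refine (hT.parent_congr ?_).symm
    rwa [dist_aut_apply, dist_comm]
  exact ⟨hgc, hp, hp ▸ (hT.parent_spec hgc).2⟩

theorem IsTree.adj_iff_parent (hT : T.IsTree) (o : V) {x y : V} :
    T.Adj x y ↔ (x ≠ o ∧ T.parent o x = y) ∨ (y ≠ o ∧ T.parent o y = x) := by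
  constructor
  · intro h
    rcases hT.dist_eq_dist_add_one_of_adj o h with h' | h'
    · exact Or.inl ⟨by rintro rfl; simp at h', hT.parent_eq h h'⟩
    · exact Or.inr ⟨by rintro rfl; simp at h', hT.parent_eq h.symm h'⟩
  · rintro (⟨h, rfl⟩ | ⟨h, rfl⟩)
    · exact (hT.parent_spec h).1
    · exact (hT.parent_spec h).1.symm

section LocallyFinite

variable [T.LocallyFinite]

/-- The neighbours of `z` that are farther from `o`. -/
noncomputable def children (T : SimpleGraph V) [T.LocallyFinite] (o z : V) : Finset V :=
  (T.neighborFinset z).filter fun y => T.dist o y = T.dist o z + 1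

theorem mem_children {o z y : V} :
    y ∈ T.children o z ↔ T.Adj z y ∧ T.dist o y = T.dist o z + 1 := by
  simp [children]

theorem IsTree.mem_children_iff (hT : T.IsTree) {o z y : V} :
    y ∈ T.children o z ↔ y ≠ o ∧ T.parent o y = z := by
  rw [mem_children]
  constructor
  · rintro ⟨h1, h2⟩
    exact ⟨by rintro rfl; simp at h2, hT.parent_eq h1.symm h2⟩
  · rintro ⟨h1, rfl⟩
    exact ⟨(hT.parent_spec h1).1.symm, (hT.parent_spec h1).2⟩

theorem IsTree.card_children (hT : T.IsTree) {d : ℕ} (hreg : T.IsRegularOfDegree d) {o z : V}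
    (hz : z ≠ o) : (T.children o z).card = d - 1 := by
  classical
  have h : T.children o z = (T.neighborFinset z).erase (T.parent o z) := by
    ext y
    rw [mem_children, Finset.mem_erase, mem_neighborFinset]
    constructor
    · rintro ⟨h1, h2⟩
      refine ⟨?_, h1⟩
      rintro rfl
      have := (hT.parent_spec hz).2
      omega
    · rintro ⟨h1, h2⟩
      refine ⟨h2, ?_⟩
      rcases hT.dist_eq_dist_add_one_of_adj o h2 with h | h
      · exact absurd (hT.parent_eq h2 h).symm h1
      · exact h
  rw [h, Finset.card_erase_of_mem (by simpa using (hT.parent_spec hz).1),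
    card_neighborFinset_eq_degree, hreg z]

theorem IsTree.finite_ball (hT : T.IsTree) (o : V) (N : ℕ) : {x | T.dist o x ≤ N}.Finite := by
  induction N with
  | zero =>
    refine (Set.finite_singleton o).subset fun x hx => ?_
    have : T.dist o x = 0 := by simpa using hx
    exact (hT.1.dist_eq_zero_iff.1 this).symm
  | succ N ih =>
    refine (ih.union (ih.biUnion fun x _ => (T.children o x).finite_toSet)).subset fun x hx => ?_
    by_cases h : T.dist o x ≤ N
    · exact Or.inl h
    · right
      have hx0 : x ≠ o := by rintro rfl; simp at h
      have h2 := (hT.parent_spec hx0).2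
      have hx' : T.dist o x ≤ N + 1 := hx
      simp only [Set.mem_iUnion]
      exact ⟨T.parent o x, by simp only [Set.mem_ofPred_eq]; omega,
        Finset.mem_coe.2 (hT.mem_children_iff.2 ⟨hx0, rfl⟩)⟩

theorem IsTree.countable (hT : T.IsTree) : Countable V := by
  obtain ⟨o⟩ := hT.1.nonempty
  have : (Set.univ : Set V) = ⋃ N, {x | T.dist o x ≤ N} := by
    ext x
    simp only [Set.mem_univ, Set.mem_iUnion, true_iff]
    exact ⟨T.dist o x, le_refl (T.dist o x)⟩
  rw [← Set.countable_univ_iff, this]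
  exact Set.countable_iUnion fun N => (hT.finite_ball o N).countable

/-- Coherent bijections between the sets of children of vertices of a regular tree. -/
theorem IsTree.exists_transport (hT : T.IsTree) {d : ℕ} (hreg : T.IsRegularOfDegree d) (o : V) :
    ∃ t : V → V → V → V, ∀ z z' y, z ≠ o → z' ≠ o → y ∈ T.children o z →
      t z z' y ∈ T.children o z' ∧ t z' z (t z z' y) = y := by
  classical
  have e : ∀ z : {z // z ≠ o}, T.children o z.1 ≃ Fin (d - 1) := fun z =>
    Fintype.equivFinOfCardEq (by rw [Fintype.card_coe, hT.card_children hreg z.2])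
  refine ⟨fun z z' y => if h : (z ≠ o ∧ z' ≠ o) ∧ y ∈ T.children o z then
    ((e ⟨z', h.1.2⟩).symm (e ⟨z, h.1.1⟩ ⟨y, h.2⟩)).1 else y, fun z z' y hz hz' hy => ?_⟩
  have h1 : (z ≠ o ∧ z' ≠ o) ∧ y ∈ T.children o z := ⟨⟨hz, hz'⟩, hy⟩
  have h2 : ((e ⟨z', hz'⟩).symm (e ⟨z, hz⟩ ⟨y, hy⟩)).1 ∈ T.children o z' := Subtype.coe_prop _
  simp only [dif_pos h1]
  refine ⟨h2, ?_⟩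
  rw [dif_pos ⟨⟨hz', hz⟩, h2⟩]
  simp

/-- Extends `f` from the ball of radius `N + 1` outwards, along the bijections `t` between sets of
children; the last natural number bounds the recursion. -/
noncomputable def extendOutward (T : SimpleGraph V) (o : V) (t : V → V → V → V) (f : V → V)
    (N : ℕ) : ℕ → V → V
  | 0, z => f z
  | m + 1, z => open Classical in if T.dist o z ≤ N + 1 then f z else
      t (T.parent o z) (extendOutward T o t f N m (T.parent o z)) z

/-- A permutation that preserves levels and parents and is trivial on a ball agrees on the ball of
radius one more with some automorphism. -/
theorem IsTree.exists_aut_extend (hT : T.IsTree) {d : ℕ} (hreg : T.IsRegularOfDegree d) (o : V)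
    (N : ℕ) (f : Equiv.Perm V) (hf : ∀ z, T.dist o z ≤ N → f z = z)
    (hlvl : ∀ z, T.dist o (f z) = T.dist o z) (hpar : ∀ z, T.parent o (f z) = T.parent o z) :
    ∃ k : T ≃g T, ∀ z, T.dist o z ≤ N + 1 → k z = f z := by
  obtain ⟨t, ht⟩ := hT.exists_transport hreg o
  let K : Equiv.Perm V → V → V := fun f z => extendOutward T o t f N (T.dist o z) z
  have Kin : ∀ f : Equiv.Perm V, ∀ z, T.dist o z ≤ N + 1 → K f z = f z := by
    intro f z hz
    simp only [K]
    cases h : T.dist o z with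
    | zero => rfl
    | succ m => rw [extendOutward, if_pos hz]
  have Kout : ∀ f : Equiv.Perm V, ∀ z, ¬ T.dist o z ≤ N + 1 →
      K f z = t (T.parent o z) (K f (T.parent o z)) z := by
    intro f z hz
    have hz0 : z ≠ o := by rintro rfl; simp at hz
    have h := (hT.parent_spec hz0).2
    simp only [K]
    rw [h, extendOutward, if_neg hz]
  let good : Equiv.Perm V → Prop := fun f => (∀ z, T.dist o z ≤ N → f z = z) ∧
    (∀ z, T.dist o (f z) = T.dist o z) ∧ ∀ z, T.parent o (f z) = T.parent o z
  have Kpar : ∀ f : Equiv.Perm V, good f → ∀ m z, T.dist o z = m →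
      T.dist o (K f z) = T.dist o z ∧ (z ≠ o → T.parent o (K f z) = K f (T.parent o z)) := by
    intro f hf m
    induction m with
    | zero =>
      intro z hz
      have : z = o := (hT.1.dist_eq_zero_iff.1 hz).symm
      subst this
      rw [Kin f z (by omega)]
      exact ⟨hf.2.1 z, fun h => absurd rfl h⟩
    | succ m ih =>
      intro z hz
      have hz0 : z ≠ o := by rintro rfl; simp at hz
      have hp := (hT.parent_spec hz0).2
      by_cases h : T.dist o z ≤ N + 1
      · rw [Kin f z h, Kin f _ (by omega), hf.2.2]
        exact ⟨hf.2.1 z, fun _ => (hf.1 _ (by omega)).symm⟩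
      · have h1 := (ih (T.parent o z) (by omega)).1
        have hne : ∀ x, T.dist o x = m → x ≠ o := by rintro x hx rfl; simp at hx; omega
        have h2 := (ht (T.parent o z) (K f (T.parent o z)) z (hne _ (by omega)) (hne _ (by omega))
          (hT.mem_children_iff.2 ⟨hz0, rfl⟩)).1
        rw [← Kout f z h] at h2
        exact ⟨by rw [(mem_children.1 h2).2, h1, hp], fun _ => (hT.mem_children_iff.1 h2).2⟩
  have Kinv : ∀ f : Equiv.Perm V, good f → ∀ m z, T.dist o z = m → K f⁻¹ (K f z) = z := by
    intro f hf m
    induction m with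
    | zero =>
      intro z hz
      rw [Kin f z (by omega), Kin _ _ (by rw [hf.2.1]; omega)]
      simp
    | succ m ih =>
      intro z hz
      have hz0 : z ≠ o := by rintro rfl; simp at hz
      have hp := (hT.parent_spec hz0).2
      by_cases h : T.dist o z ≤ N + 1
      · rw [Kin f z h, Kin _ _ (by rw [hf.2.1]; omega)]
        simp
      · have hne : ∀ x, T.dist o x = m → x ≠ o := by rintro x hx rfl; simp at hx; omega
        have h1 := Kpar f hf _ z rfl
        have h3 := (Kpar f hf _ (T.parent o z) rfl).1
        rw [Kout f⁻¹ _ (by rw [h1.1]; exact h), h1.2 hz0, ih _ (by omega), Kout f z h]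
        exact (ht (T.parent o z) (K f (T.parent o z)) z (hne _ (by omega)) (hne _ (by omega))
          (hT.mem_children_iff.2 ⟨hz0, rfl⟩)).2
  have hgood : good f := ⟨hf, hlvl, hpar⟩
  have hgood' : good f⁻¹ := by
    refine ⟨fun z hz => ?_, fun z => ?_, fun z => ?_⟩
    · rw [Equiv.Perm.inv_eq_iff_eq, hf z hz]
    · rw [← hlvl (f⁻¹ z)]; simp
    · rw [← hpar (f⁻¹ z)]; simp
  have Kadj : ∀ f : Equiv.Perm V, good f → ∀ x y, T.Adj x y → T.Adj (K f x) (K f y) := by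
    intro f hf x y h
    have key : ∀ x, x ≠ o → T.Adj (K f x) (K f (T.parent o x)) := by
      intro x hx
      obtain ⟨h1, h2⟩ := Kpar f hf _ x rfl
      have h3 : K f x ≠ o := by
        intro h0
        rw [h0, dist_self] at h1
        exact hx (hT.1.dist_eq_zero_iff.1 h1.symm).symm
      rw [← h2 hx]
      exact (hT.parent_spec h3).1
    rcases (hT.adj_iff_parent o).1 h with ⟨hx, rfl⟩ | ⟨hy, rfl⟩
    · exact key x hx
    · exact (key y hy).symm
  refine ⟨⟨⟨K f, K f⁻¹, fun z => Kinv f hgood _ z rfl, fun z => ?_⟩, ?_⟩, fun z hz => Kin f z hz⟩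
  · simpa using Kinv f⁻¹ hgood' _ z rfl
  · intro x y
    refine ⟨fun h => ?_, Kadj f hgood x y⟩
    have := Kadj f⁻¹ hgood' _ _ h
    simpa [Kinv f hgood _ _ rfl] using this

end LocallyFinite

end SimpleGraph

namespace SimpleGraph

variable {V : Type*} {T : SimpleGraph V}

theorem autMeasurableSpace_eq [Countable V] :
    autMeasurableSpace T = ⨆ v : V, MeasurableSpace.comap (fun a : T ≃g T => a v) ⊤ := by
  let : TopologicalSpace V := ⊥
  have : DiscreteTopology V := ⟨rfl⟩
  let : MeasurableSpace V := ⊤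
  have : BorelSpace V := ⟨(borel_eq_top_of_discrete).symm⟩
  have h1 : borel (V → V) = MeasurableSpace.pi := (Pi.borelSpace.measurable_eq).symm
  have h2 : autMeasurableSpace T =
      MeasurableSpace.comap (fun (a : T ≃g T) (v : V) => a v) MeasurableSpace.pi := by
    rw [← h1]
    exact borel_comap
  rw [h2, MeasurableSpace.pi, MeasurableSpace.comap_iSup]
  simp only [MeasurableSpace.comap_comp]
  rfl

theorem measurable_aut_iff [Countable V] {X : Type*} [MeasurableSpace X] {f : X → (T ≃g T)} :
    Measurable f ↔ ∀ v u, MeasurableSet {x | f x v = u} := by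
  rw [measurable_iff_comap_le, autMeasurableSpace_eq, MeasurableSpace.comap_iSup, iSup_le_iff]
  refine forall_congr' fun v => ?_
  rw [MeasurableSpace.comap_comp, ← measurable_iff_comap_le]
  constructor
  · intro h u
    exact h (t := {u}) trivial
  · intro h
    let : MeasurableSpace V := ⊤
    exact measurable_to_countable' fun u => h u

theorem measurableSet_aut_apply_eq [Countable V] (v u : V) :
    MeasurableSet {a : T ≃g T | a v = u} :=
  measurable_aut_iff.1 measurable_id v u

theorem measurable_aut_mul_left [Countable V] (g : T ≃g T) :
    Measurable fun a : T ≃g T => g * a := by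
  refine measurable_aut_iff.2 fun v u => ?_
  convert measurableSet_aut_apply_eq (T := T) v (g.symm u) using 1
  ext a
  exact (g.toEquiv.eq_symm_apply (x := u)).symm

theorem measurable_aut_mul_right [Countable V] (g : T ≃g T) :
    Measurable fun a : T ≃g T => a * g :=
  measurable_aut_iff.2 fun v u => measurableSet_aut_apply_eq (g v) u

theorem _root_.Measurable.aut_mul [Countable V] {X : Type*} [MeasurableSpace X]
    {f g : X → (T ≃g T)} (hf : Measurable f) (hg : Measurable g) :
    Measurable fun x => f x * g x := by
  refine measurable_aut_iff.2 fun v u => ?_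
  have : {x | (f x * g x) v = u} = ⋃ z, {x | g x v = z} ∩ {x | f x z = u} := by
    ext x; simp [RelIso.mul_apply]
  rw [this]
  exact MeasurableSet.iUnion fun z =>
    (measurable_aut_iff.1 hg v z).inter (measurable_aut_iff.1 hf z u)

theorem _root_.Measurable.aut_inv [Countable V] {X : Type*} [MeasurableSpace X]
    {f : X → (T ≃g T)} (hf : Measurable f) : Measurable fun x => (f x)⁻¹ := by
  refine measurable_aut_iff.2 fun v u => ?_
  have : {x | (f x)⁻¹ v = u} = {x | f x u = v} := by
    ext x
    exact ((f x).toEquiv.symm_apply_eq (x := v) (y := u)).trans eq_comm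
  rw [this]
  exact measurable_aut_iff.1 hf u v

section Haar

variable (μ : Measure (T ≃g T)) [μ.IsMulLeftInvariant]

theorem measurePreserving_aut_mul_left [Countable V] (g : T ≃g T) :
    MeasurePreserving (fun a : T ≃g T => g * a) μ μ :=
  ⟨measurable_aut_mul_left g, map_mul_left_eq_self μ g⟩

/-- The automorphisms that agree with `g` on the ball of radius `N` around `o`. -/
def cylinder (T : SimpleGraph V) (o : V) (N : ℕ) (g : T ≃g T) : Set (T ≃g T) :=
  {a | ∀ x, T.dist o x ≤ N → a x = g x}

theorem measurableSet_cylinder [Countable V] (o : V) (N : ℕ) (g : T ≃g T) :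
    MeasurableSet (cylinder T o N g) := by
  have : cylinder T o N g = ⋂ x : V, ⋂ _ : T.dist o x ≤ N, {a : T ≃g T | a x = g x} := by
    ext a; simp [cylinder]
  rw [this]
  exact MeasurableSet.iInter fun x => MeasurableSet.iInter fun _ => measurableSet_aut_apply_eq _ _

theorem measure_cylinder [Countable V] (o : V) (N : ℕ) (g : T ≃g T) :
    μ (cylinder T o N g) = μ (cylinder T o N 1) := by
  rw [← (measurePreserving_aut_mul_left μ g⁻¹).measure_preimage
    (measurableSet_cylinder o N 1).nullMeasurableSet]
  congr 1
  ext a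
  refine forall_congr' fun x => imp_congr_right fun _ => ?_
  exact (g.toEquiv.symm_apply_eq (x := a x) (y := x)).symm

theorem isPiSystem_cylinder (o : V) :
    IsPiSystem {s | ∃ (N : ℕ) (g : T ≃g T), s = cylinder T o N g} := by
  rintro _ ⟨N, g, rfl⟩ _ ⟨M, h, rfl⟩ ⟨b, hb1, hb2⟩
  refine ⟨max N M, b, ?_⟩
  ext a
  constructor
  · rintro ⟨h1, h2⟩ x hx
    rcases le_max_iff.1 hx with hx | hx
    · rw [h1 x hx, hb1 x hx]
    · rw [h2 x hx, hb2 x hx]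
  · intro ha
    exact ⟨fun x hx => by rw [ha x (hx.trans (le_max_left _ _)), hb1 x hx],
      fun x hx => by rw [ha x (hx.trans (le_max_right _ _)), hb2 x hx]⟩

theorem IsTree.generateFrom_cylinder [T.LocallyFinite] (hT : T.IsTree) (o : V) :
    autMeasurableSpace T =
      MeasurableSpace.generateFrom {s | ∃ (N : ℕ) (g : T ≃g T), s = cylinder T o N g} := by
  have := hT.countable
  refine le_antisymm ?_ ?_
  · rw [autMeasurableSpace_eq]
    refine iSup_le fun v => ?_
    rw [← measurable_iff_comap_le]
    let m := MeasurableSpace.generateFrom {s | ∃ (N : ℕ) (g : T ≃g T), s = cylinder T o N g}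
    let B := {x | T.dist o x ≤ T.dist o v}
    have : Finite B := hT.finite_ball o (T.dist o v)
    let : MeasurableSpace V := ⊤
    have h : @Measurable _ (B → V) m _ (fun (a : T ≃g T) (x : B) => a x) := by
      refine @measurable_to_countable _ _ _ _ m _ fun g => ?_
      refine MeasurableSpace.measurableSet_generateFrom ⟨T.dist o v, g, ?_⟩
      ext a
      constructor
      · intro h x hx
        exact congrFun h ⟨x, hx⟩
      · intro h
        ext x
        exact h x.1 x.2
    exact (measurable_pi_apply (⟨v, le_refl (T.dist o v)⟩ : B)).comp h
  · refine MeasurableSpace.generateFrom_le ?_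
    rintro _ ⟨N, g, rfl⟩
    exact measurableSet_cylinder o N g

variable {μ}

theorem measure_apply_eq_le_one [Countable V] {o : V} (hμ : μ {a : T ≃g T | a o = o} = 1) (u : V) :
    μ {a : T ≃g T | a o = u} ≤ 1 := by
  rcases Set.eq_empty_or_nonempty {a : T ≃g T | a o = u} with h | ⟨g, hg⟩
  · rw [h]; simp
  · rw [← (measurePreserving_aut_mul_left μ g).measure_preimage
      (measurableSet_aut_apply_eq o u).nullMeasurableSet, ← hμ]
    refine measure_mono fun a ha => ?_
    have h1 : g (a o) = u := ha
    have h2 : g o = u := hg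
    exact g.injective (h1.trans h2.symm)

theorem IsTree.sigmaFinite_aut [T.LocallyFinite] (hT : T.IsTree) {o : V}
    (hμ : μ {a : T ≃g T | a o = o} = 1) : SigmaFinite μ := by
  have := hT.countable
  refine Measure.sigmaFinite_of_countable
    (S := Set.range fun u : V => {a : T ≃g T | a o = u}) (Set.countable_range _) ?_ ?_
  · rintro _ ⟨u, rfl⟩
    exact (measure_apply_eq_le_one hμ u).trans_lt ENNReal.one_lt_top
  · refine Set.eq_univ_of_forall fun a => ⟨_, ⟨a o, rfl⟩, rfl⟩

theorem IsTree.measurePreserving_aut_mul_right [T.LocallyFinite] (hT : T.IsTree) {o : V}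
    (hμ : μ {a : T ≃g T | a o = o} = 1) {k : T ≃g T} (hk : k o = o) :
    MeasurePreserving (fun a : T ≃g T => a * k) μ μ := by
  have := hT.countable
  refine ⟨measurable_aut_mul_right k, ?_⟩
  symm
  have hpre : ∀ (N : ℕ) (g : T ≃g T),
      (fun a : T ≃g T => a * k) ⁻¹' cylinder T o N g = cylinder T o N (g * k⁻¹) := by
    intro N g
    ext a
    constructor
    · intro h x hx
      have := h (k.symm x) (by rw [← dist_aut_apply k, hk]; simpa using hx)
      rw [RelIso.mul_apply, RelIso.apply_symm_apply] at this
      exact this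
    · intro h x hx
      have := h (k x) (by rw [← hk, dist_aut_apply k]; exact hx)
      simpa [RelIso.mul_apply] using this
  have hone : μ (cylinder T o 0 1) = 1 := by
    rw [← hμ]
    congr 1
    ext a
    constructor
    · intro h
      exact h o (by simp)
    · intro h x hx
      have hx0 : o = x := hT.1.dist_eq_zero_iff.1 (by omega)
      subst hx0
      exact h
  have hcount : (Set.range fun g : T ≃g T => cylinder T o 0 g).Countable := by
    refine (Set.countable_range fun u : V => {a : T ≃g T | a o = u}).mono ?_
    rintro _ ⟨g, rfl⟩
    refine ⟨g o, ?_⟩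
    ext a
    constructor
    · intro h x hx
      have hx0 : o = x := hT.1.dist_eq_zero_iff.1 (by omega)
      subst hx0
      exact h
    · intro h
      exact h o (by simp)
  refine Measure.ext_of_generateFrom_of_cover_subset (hT.generateFrom_cylinder o)
    (isPiSystem_cylinder o) (T := Set.range fun g : T ≃g T => cylinder T o 0 g) ?_ hcount ?_ ?_ ?_
  · rintro _ ⟨g, rfl⟩
    exact ⟨0, g, rfl⟩
  · exact Set.eq_univ_of_forall fun a => ⟨_, ⟨a, rfl⟩, fun _ _ => rfl⟩
  · rintro _ ⟨g, rfl⟩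
    simp only [measure_cylinder μ o 0 g, hone]
    simp
  · rintro _ ⟨N, g, rfl⟩
    rw [Measure.map_apply (measurable_aut_mul_right k) (measurableSet_cylinder o N g), hpre,
      measure_cylinder, measure_cylinder μ o N (g * k⁻¹)]

end Haar

section Tuples

variable {n : ℕ}

/-- Replaces the generator of the letter `l` so that the letter itself gets multiplied by `k` on
the right. -/
def modify (l : Fin n × Bool) (k : T ≃g T) (a : Fin n → (T ≃g T)) : Fin n → (T ≃g T) :=
  fun i => if i = l.1 then (if l.2 then a i * k else k⁻¹ * a i) else a i

theorem IsTree.measurePreserving_modify [T.LocallyFinite] (hT : T.IsTree) {o : V}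
    {μ : Measure (T ≃g T)} [μ.IsMulLeftInvariant]
    (hμ : μ {a : T ≃g T | a o = o} = 1) {k : T ≃g T} (hk : k o = o) (l : Fin n × Bool) :
    MeasurePreserving (modify l k) (Measure.pi fun _ : Fin n => μ)
      (Measure.pi fun _ : Fin n => μ) := by
  have := hT.countable
  have := hT.sigmaFinite_aut hμ
  refine measurePreserving_pi (fun _ : Fin n => μ) (fun _ : Fin n => μ)
    (f := fun i a => if i = l.1 then (if l.2 then a * k else k⁻¹ * a) else a) fun i => ?_
  by_cases h : i = l.1
  · cases h2 : l.2
    · simpa [h, h2] using measurePreserving_aut_mul_left μ k⁻¹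
    · simpa [h, h2] using hT.measurePreserving_aut_mul_right hμ hk
  · simp only [h, if_false]
    exact MeasurePreserving.id μ

/-- The tuples `a` and `b` induce the same partial maps on the ball of radius `N` around `o`. -/
def AgreeOn (o : V) (N : ℕ) (a b : Fin n → (T ≃g T)) : Prop :=
  ∀ i x y, T.dist o x ≤ N → T.dist o y ≤ N → (a i x = y ↔ b i x = y)

theorem AgreeOn.symm {o : V} {N : ℕ} {a b : Fin n → (T ≃g T)} (h : AgreeOn o N a b) :
    AgreeOn o N b a := fun i x y hx hy => (h i x y hx hy).symm

theorem AgreeOn.trans {o : V} {N : ℕ} {a b c : Fin n → (T ≃g T)} (h : AgreeOn o N a b)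
    (h' : AgreeOn o N b c) : AgreeOn o N a c :=
  fun i x y hx hy => (h i x y hx hy).trans (h' i x y hx hy)

theorem AgreeOn.mono {o : V} {N M : ℕ} {a b : Fin n → (T ≃g T)} (h : AgreeOn o N a b)
    (hM : M ≤ N) : AgreeOn o M a b :=
  fun i x y hx hy => h i x y (hx.trans hM) (hy.trans hM)

/-- The partial maps induced by a tuple on a ball. -/
def ballAction (T : SimpleGraph V) (n : ℕ) (o : V) (N : ℕ) (a : Fin n → (T ≃g T)) :
    Fin n → {x | T.dist o x ≤ N} → {x | T.dist o x ≤ N} → Prop :=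
  fun i x y => a i x = y

theorem ballAction_eq_iff {o : V} {N : ℕ} {a b : Fin n → (T ≃g T)} :
    ballAction T n o N a = ballAction T n o N b ↔ AgreeOn o N a b := by
  constructor
  · intro h i x y hx hy
    exact iff_of_eq (congrFun (congrFun (congrFun h i) ⟨x, hx⟩) ⟨y, hy⟩)
  · intro h
    ext i x y
    exact h i x.1 y.1 x.2 y.2

/-- The σ-algebra generated by the partial maps induced on the ball of radius `N` around `o`. -/
@[reducible]
def ballAlgebra (T : SimpleGraph V) (n : ℕ) (o : V) (N : ℕ) :
    MeasurableSpace (Fin n → (T ≃g T)) :=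
  MeasurableSpace.comap (ballAction T n o N) ⊤

theorem measurableSet_ballAlgebra_iff {o : V} {N : ℕ} {E : Set (Fin n → (T ≃g T))} :
    MeasurableSet[ballAlgebra T n o N] E ↔ ∀ a b, AgreeOn o N a b → a ∈ E → b ∈ E := by
  constructor
  · rintro ⟨S, -, rfl⟩ a b h ha
    rw [Set.mem_preimage] at *
    rwa [← ballAction_eq_iff.2 h]
  · intro h
    refine ⟨ballAction T n o N '' E, trivial, ?_⟩
    ext b
    constructor
    · rintro ⟨a, ha, hab⟩
      exact h a b (ballAction_eq_iff.1 hab) ha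
    · exact fun hb => ⟨b, hb, rfl⟩

theorem ballAlgebra_mono (o : V) : Monotone (ballAlgebra T n o) := by
  intro N M h E hE
  rw [measurableSet_ballAlgebra_iff] at *
  exact fun a b hab => hE a b (hab.mono h)

theorem IsTree.measurable_ballAction [T.LocallyFinite] (hT : T.IsTree) (o : V) (N : ℕ) :
    @Measurable _ _ _ ⊤ (ballAction T n o N) := by
  have := hT.countable
  have : Finite {x | T.dist o x ≤ N} := hT.finite_ball o N
  let : MeasurableSpace (Fin n → {x | T.dist o x ≤ N} → {x | T.dist o x ≤ N} → Prop) := ⊤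
  refine measurable_to_countable fun a => ?_
  have : ballAction T n o N ⁻¹' {ballAction T n o N a} =
      ⋂ (i : Fin n) (x : V) (y : V) (_ : T.dist o x ≤ N) (_ : T.dist o y ≤ N),
        {b | b i x = y ↔ a i x = y} := by
    ext b
    simp only [Set.mem_preimage, Set.mem_singleton_iff, ballAction_eq_iff, Set.mem_iInter]
    rfl
  rw [this]
  refine MeasurableSet.iInter fun i => MeasurableSet.iInter fun x => MeasurableSet.iInter fun y =>
    MeasurableSet.iInter fun _ => MeasurableSet.iInter fun _ => ?_
  have h := (measurable_pi_apply (X := fun _ : Fin n => (T ≃g T)) i)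
    (measurableSet_aut_apply_eq (T := T) x y)
  by_cases hxy : a i x = y
  · simp only [hxy, iff_true]
    exact h
  · simp only [hxy, iff_false]
    exact h.compl

theorem IsTree.ballAlgebra_le [T.LocallyFinite] (hT : T.IsTree) (o : V) (N : ℕ) :
    ballAlgebra T n o N ≤ MeasurableSpace.pi :=
  measurable_iff_comap_le.1 (hT.measurable_ballAction o N)

/-- To compare measures of an event that depends on a ball, it suffices to compare them on the
atoms. -/
theorem IsTree.measure_le_of_atoms [T.LocallyFinite] (hT : T.IsTree) {o : V} {N : ℕ}
    {ν₁ ν₂ : Measure (Fin n → (T ≃g T))} {E : Set (Fin n → (T ≃g T))}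
    (hE : MeasurableSet[ballAlgebra T n o N] E)
    (h : ∀ a ∈ E, ν₁ {b | AgreeOn o N a b} ≤ ν₂ {b | AgreeOn o N a b}) : ν₁ E ≤ ν₂ E := by
  have := hT.countable
  have : Finite {x | T.dist o x ≤ N} := hT.finite_ball o N
  have hpre : E = ballAction T n o N ⁻¹' (ballAction T n o N '' E) := by
    ext b
    constructor
    · exact fun hb => ⟨b, hb, rfl⟩
    · rintro ⟨a, ha, hab⟩
      exact measurableSet_ballAlgebra_iff.1 hE a b (ballAction_eq_iff.1 hab) ha
  have hm : ∀ y, MeasurableSet (ballAction T n o N ⁻¹' {y}) := fun y =>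
    hT.measurable_ballAction o N (t := {y}) trivial
  rw [hpre, ← tsum_measure_preimage_singleton (Set.to_countable _) fun y _ => hm y,
    ← tsum_measure_preimage_singleton (Set.to_countable _) fun y _ => hm y]
  refine ENNReal.tsum_le_tsum fun y => ?_
  obtain ⟨_, a, ha, rfl⟩ := y
  convert h a ha using 2 <;>
  · ext b
    simp only [Set.mem_preimage, Set.mem_singleton_iff]
    rw [eq_comm, ballAction_eq_iff]
    rfl

end Tuples

end SimpleGraph

/-- Maximal inequality for a process with non-increasing means over the events of the past. -/
theorem mul_measure_exists_ge_le_lintegral {Ω : Type*} [mΩ : MeasurableSpace Ω] (P : Measure Ω)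
    (ℱ : ℕ → MeasurableSpace Ω) (hmono : Monotone ℱ) (hle : ∀ t, ℱ t ≤ mΩ) (Y : ℕ → Ω → ℕ)
    (hY : ∀ t, Measurable[ℱ t] (Y t))
    (hsuper : ∀ t E, MeasurableSet[ℱ t] E →
      ∫⁻ ω in E, (Y (t + 1) ω : ℝ≥0∞) ∂P ≤ ∫⁻ ω in E, (Y t ω : ℝ≥0∞) ∂P) (lam : ℕ) :
    (lam : ℝ≥0∞) * P {ω | ∃ t, lam ≤ Y t ω} ≤ ∫⁻ ω, (Y 0 ω : ℝ≥0∞) ∂P := by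
  have hge : ∀ t, MeasurableSet[ℱ t] {ω | lam ≤ Y t ω} := fun t =>
    hY t (measurableSet_Ici (a := lam))
  have hlt : ∀ t, MeasurableSet[ℱ t] {ω | ∀ s ≤ t, Y s ω < lam} := fun t => by
    have : {ω | ∀ s ≤ t, Y s ω < lam} = ⋂ s, ⋂ _ : s ≤ t, {ω | lam ≤ Y s ω}ᶜ := by
      ext ω; simp
    rw [this]
    exact MeasurableSet.iInter fun s => MeasurableSet.iInter fun hs =>
      (hmono hs _ (hge s)).compl
  have hmeasY : ∀ t, Measurable fun ω => (Y t ω : ℝ≥0∞) := fun t =>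
    (measurable_from_top (f := fun m : ℕ => (m : ℝ≥0∞))).comp ((hY t).mono (hle t) le_rfl)
  have hsplit : ∀ t (A : Set Ω), (lam : ℝ≥0∞) * P (A ∩ {ω | lam ≤ Y t ω}) +
      ∫⁻ ω in A ∩ {ω | Y t ω < lam}, (Y t ω : ℝ≥0∞) ∂P ≤ ∫⁻ ω in A, (Y t ω : ℝ≥0∞) ∂P := by
    intro t A
    rw [← lintegral_inter_add_sdiff (μ := P) (fun ω => (Y t ω : ℝ≥0∞)) A (hle t _ (hge t))]
    refine add_le_add ?_ (le_of_eq ?_)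
    · rw [← setLIntegral_const]
      refine setLIntegral_mono_ae (hmeasY t).aemeasurable (Filter.Eventually.of_forall ?_)
      intro ω hω
      exact_mod_cast hω.2
    · congr 2
      ext ω
      simp
  have key : ∀ t, (lam : ℝ≥0∞) * P {ω | ∃ s ≤ t, lam ≤ Y s ω} +
      ∫⁻ ω in {ω | ∀ s ≤ t, Y s ω < lam}, (Y t ω : ℝ≥0∞) ∂P ≤ ∫⁻ ω, (Y 0 ω : ℝ≥0∞) ∂P := by
    intro t
    induction t with
    | zero => simpa using hsplit 0 Set.univ
    | succ t ih =>
      have h1 : {ω | ∃ s ≤ t + 1, lam ≤ Y s ω} ⊆ {ω | ∃ s ≤ t, lam ≤ Y s ω} ∪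
          ({ω | ∀ s ≤ t, Y s ω < lam} ∩ {ω | lam ≤ Y (t + 1) ω}) := by
        rintro ω ⟨s, hs, hω⟩
        by_cases h : ∃ s ≤ t, lam ≤ Y s ω
        · exact Or.inl h
        · push Not at h
          right
          refine ⟨h, ?_⟩
          rcases Nat.le_succ_iff.1 hs with h' | rfl
          · exact absurd hω (not_le.2 (h s h'))
          · exact hω
      have h2 : {ω | ∀ s ≤ t + 1, Y s ω < lam} =
          {ω | ∀ s ≤ t, Y s ω < lam} ∩ {ω | Y (t + 1) ω < lam} := by
        ext ω
        simp only [Set.mem_ofPred_eq, Set.mem_inter_iff, Nat.le_succ_iff]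
        constructor
        · exact fun h => ⟨fun s hs => h s (Or.inl hs), h _ (Or.inr rfl)⟩
        · rintro ⟨h, h'⟩ s (hs | rfl)
          · exact h s hs
          · exact h'
      rw [h2]
      calc _ ≤ (lam : ℝ≥0∞) * (P {ω | ∃ s ≤ t, lam ≤ Y s ω} +
            P ({ω | ∀ s ≤ t, Y s ω < lam} ∩ {ω | lam ≤ Y (t + 1) ω})) +
            ∫⁻ ω in {ω | ∀ s ≤ t, Y s ω < lam} ∩ {ω | Y (t + 1) ω < lam},
              (Y (t + 1) ω : ℝ≥0∞) ∂P := by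
            gcongr
            exact (measure_mono h1).trans (measure_union_le _ _)
        _ = (lam : ℝ≥0∞) * P {ω | ∃ s ≤ t, lam ≤ Y s ω} +
            ((lam : ℝ≥0∞) * P ({ω | ∀ s ≤ t, Y s ω < lam} ∩ {ω | lam ≤ Y (t + 1) ω}) +
            ∫⁻ ω in {ω | ∀ s ≤ t, Y s ω < lam} ∩ {ω | Y (t + 1) ω < lam},
              (Y (t + 1) ω : ℝ≥0∞) ∂P) := by rw [mul_add, add_assoc]
        _ ≤ (lam : ℝ≥0∞) * P {ω | ∃ s ≤ t, lam ≤ Y s ω} +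
            ∫⁻ ω in {ω | ∀ s ≤ t, Y s ω < lam}, (Y t ω : ℝ≥0∞) ∂P := by
            gcongr
            exact (hsplit (t + 1) _).trans (hsuper t _ (hlt t))
        _ ≤ _ := ih
  have hU : {ω | ∃ t, lam ≤ Y t ω} = ⋃ t, {ω | ∃ s ≤ t, lam ≤ Y s ω} := by
    ext ω
    simp only [Set.mem_ofPred_eq, Set.mem_iUnion]
    exact ⟨fun ⟨t, h⟩ => ⟨t, t, le_rfl, h⟩, fun ⟨_, t, _, h⟩ => ⟨t, h⟩⟩
  have hmonoU : Monotone fun t => {ω | ∃ s ≤ t, lam ≤ Y s ω} :=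
    fun t t' htt ω ⟨s, hs, h⟩ => ⟨s, hs.trans htt, h⟩
  rw [hU, hmonoU.measure_iUnion, ENNReal.mul_iSup]
  exact iSup_le fun t => le_self_add.trans (key t)

/-- A process of natural numbers with non-increasing means, which from any positive value has a
chance bounded below to exceed any given bound after a bounded time, dies out. -/
theorem ae_exists_eq_zero_of_growth {Ω : Type*} [mΩ : MeasurableSpace Ω] (P : Measure Ω)
    (ℱ : ℕ → MeasurableSpace Ω) (hmono : Monotone ℱ) (hle : ∀ t, ℱ t ≤ mΩ) (Y : ℕ → Ω → ℕ)
    (hY : ∀ t, Measurable[ℱ t] (Y t)) (hint : ∫⁻ ω, (Y 0 ω : ℝ≥0∞) ∂P ≠ ∞)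
    (hsuper : ∀ t E, MeasurableSet[ℱ t] E →
      ∫⁻ ω in E, (Y (t + 1) ω : ℝ≥0∞) ∂P ≤ ∫⁻ ω in E, (Y t ω : ℝ≥0∞) ∂P)
    (hgrowth : ∀ lam : ℕ, ∃ (s : ℕ) (c : ℕ), ∀ t E, MeasurableSet[ℱ t] E →
      (∀ ω ∈ E, Y t ω ≠ 0) → P E ≤ c * P (E ∩ {ω | lam ≤ Y (t + s) ω})) :
    ∀ᵐ ω ∂P, ∃ t, Y t ω = 0 := by
  have hge : ∀ lam t, MeasurableSet[ℱ t] {ω | lam ≤ Y t ω} := fun lam t =>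
    hY t (measurableSet_Ici (a := lam))
  set S : Set Ω := {ω | ∀ t, Y t ω ≠ 0} with hS
  have hreach : ∀ lam : ℕ, P S ≤ P {ω | ∃ t, lam ≤ Y t ω} := by
    intro lam
    obtain ⟨s, c, hc⟩ := hgrowth lam
    let A : ℕ → Set Ω := fun m => {ω | ∀ t ≤ m * s, Y t ω ≠ 0 ∧ Y t ω < lam}
    have hA : ∀ m, MeasurableSet[ℱ (m * s)] (A m) := by
      intro m
      have : A m = ⋂ t, ⋂ _ : t ≤ m * s, ({ω | 1 ≤ Y t ω} ∩ {ω | lam ≤ Y t ω}ᶜ) := by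
        ext ω; simp [A, Nat.one_le_iff_ne_zero]
      rw [this]
      exact MeasurableSet.iInter fun t => MeasurableSet.iInter fun ht =>
        (hmono ht _ (hge 1 t)).inter (hmono ht _ (hge lam t)).compl
    have hsub : ∀ m, A (m + 1) ⊆ A m \ {ω | lam ≤ Y (m * s + s) ω} := by
      intro m ω hω
      refine ⟨fun t ht => hω t (ht.trans (Nat.mul_le_mul_right s m.le_succ)), ?_⟩
      exact not_le.2 (hω (m * s + s) (by rw [Nat.succ_mul])).2
    have hdec : ∀ m, P (A m) + (c : ℝ≥0∞) * P (A (m + 1)) ≤ (c : ℝ≥0∞) * P (A m) := by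
      intro m
      have h1 := hc (m * s) (A m) (hA m) fun ω hω => (hω _ le_rfl).1
      have h2 : P (A m ∩ {ω | lam ≤ Y (m * s + s) ω}) + P (A (m + 1)) ≤ P (A m) := by
        rw [← measure_inter_add_sdiff (A m) (hle _ _ (hge lam (m * s + s)))]
        gcongr
        exact hsub m
      calc _ ≤ (c : ℝ≥0∞) * P (A m ∩ {ω | lam ≤ Y (m * s + s) ω}) + c * P (A (m + 1)) := by
            gcongr
        _ ≤ _ := by rw [← mul_add]; gcongr
    have hbound : ∀ m : ℕ, (m : ℝ≥0∞) * P (⋂ m, A m) ≤ c * ∫⁻ ω, (Y 0 ω : ℝ≥0∞) ∂P := by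
      intro m
      have : (m : ℝ≥0∞) * P (⋂ m, A m) + (c : ℝ≥0∞) * P (A m) ≤ c * P (A 0) := by
        induction m with
        | zero => simp
        | succ m ih =>
          refine le_trans ?_ ih
          rw [Nat.cast_succ, add_mul, one_mul, add_assoc]
          gcongr
          refine le_trans ?_ (hdec m)
          gcongr
          exact Set.iInter_subset _ m
      refine le_self_add.trans (this.trans (mul_le_mul_right ?_ _))
      have h0 : ∫⁻ ω in A 0, 1 ∂P ≤ ∫⁻ ω in A 0, (Y 0 ω : ℝ≥0∞) ∂P := by
        refine setLIntegral_mono' (hle _ _ (hA 0)) fun ω hω => ?_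
        exact_mod_cast Nat.one_le_iff_ne_zero.2 (hω 0 (Nat.zero_le _)).1
      rw [setLIntegral_one] at h0
      exact h0.trans (setLIntegral_le_lintegral _ _)
    have hzero : P (⋂ m, A m) = 0 := by
      by_contra h0
      have hfin := ENNReal.mul_ne_top (ENNReal.natCast_ne_top c) hint
      obtain ⟨m, hm⟩ := ENNReal.exists_nat_mul_gt h0 hfin
      exact absurd (hbound m) (not_le.2 hm)
    have hsplit : S ⊆ (⋂ m, A m) ∪ {ω | ∃ t, lam ≤ Y t ω} := by
      intro ω hω
      by_cases h : ∃ t, lam ≤ Y t ω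
      · exact Or.inr h
      · push Not at h
        exact Or.inl (Set.mem_iInter.2 fun m t _ => ⟨hω t, h t⟩)
    calc P S ≤ P (⋂ m, A m) + P {ω | ∃ t, lam ≤ Y t ω} :=
          (measure_mono hsplit).trans (measure_union_le _ _)
      _ = _ := by rw [hzero, zero_add]
  have hPS : P S = 0 := by
    by_contra h0
    obtain ⟨lam, hlam⟩ := ENNReal.exists_nat_mul_gt h0 hint
    have := mul_measure_exists_ge_le_lintegral P ℱ hmono hle Y hY hsuper lam
    exact absurd ((mul_le_mul_right (hreach lam) _).trans this) (not_le.2 hlam)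
  rw [ae_iff]
  convert hPS using 2
  ext ω
  simp [hS]

namespace SimpleGraph

variable {V : Type*} {T : SimpleGraph V} {n : ℕ}

/-- The automorphism by which a letter acts, for a tuple of values of the generators. -/
def letter (a : Fin n → (T ≃g T)) (l : Fin n × Bool) : T ≃g T :=
  cond l.2 (a l.1) (a l.1)⁻¹

/-- The automorphism by which a word acts, for a tuple of values of the generators. -/
def word (a : Fin n → (T ≃g T)) (L : List (Fin n × Bool)) : T ≃g T :=
  (L.map (letter a)).prod

theorem word_nil_apply (a : Fin n → (T ≃g T)) (v : V) : word a [] v = v := rfl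

theorem word_cons_apply (a : Fin n → (T ≃g T)) (l : Fin n × Bool) (L : List (Fin n × Bool))
    (v : V) : word a (l :: L) v = letter a l (word a L v) := by
  simp [word, RelIso.mul_apply]

theorem word_append_apply (a : Fin n → (T ≃g T)) (L L' : List (Fin n × Bool)) (v : V) :
    word a (L ++ L') v = word a L (word a L' v) := by
  simp [word, RelIso.mul_apply]

theorem word_drop_apply (a : Fin n → (T ≃g T)) (L : List (Fin n × Bool)) {m : ℕ}
    (hm : m < L.length) (v : V) :
    word a (L.drop m) v = letter a L[m] (word a (L.drop (m + 1)) v) := by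
  rw [List.drop_eq_getElem_cons hm, word_cons_apply]

theorem word_drop_length_apply (a : Fin n → (T ≃g T)) (L : List (Fin n × Bool)) (v : V) :
    word a (L.drop L.length) v = v := by
  rw [List.drop_length, word_nil_apply]

theorem measurable_letter [Countable V] (l : Fin n × Bool) :
    Measurable fun a : Fin n → (T ≃g T) => letter a l := by
  have h := measurable_pi_apply (X := fun _ : Fin n => (T ≃g T)) l.1
  unfold letter
  cases l.2
  · exact h.aut_inv
  · exact h

theorem measurable_word [Countable V] (L : List (Fin n × Bool)) :
    Measurable fun a : Fin n → (T ≃g T) => word a L := by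
  induction L with
  | nil => exact measurable_const
  | cons l L ih =>
    simp only [word, List.map_cons, List.prod_cons]
    exact (measurable_letter l).aut_mul ih

theorem measurableSet_word_eq [Countable V] (L : List (Fin n × Bool)) (x y : V) :
    MeasurableSet {a : Fin n → (T ≃g T) | word a L x = y} :=
  measurable_aut_iff.1 (measurable_word L) x y

theorem inv_apply_eq_iff {g : T ≃g T} {x y : V} : g⁻¹ x = y ↔ x = g y :=
  g.toEquiv.symm_apply_eq

theorem letter_agreeOn {o : V} {N : ℕ} {a b : Fin n → (T ≃g T)} (h : AgreeOn o N a b)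
    (l : Fin n × Bool) {x y : V} (hx : T.dist o x ≤ N) (hy : T.dist o y ≤ N)
    (hxy : letter a l x = y) : letter b l x = y := by
  obtain ⟨i, e⟩ := l
  cases e
  · have h1 : (a i)⁻¹ x = y := hxy
    change (b i)⁻¹ x = y
    rw [inv_apply_eq_iff, eq_comm] at *
    exact (h i y x hy hx).1 h1
  · exact (h i x y hx hy).1 hxy

/-- If the path of `v` stays in the ball, it only depends on the partial maps on the ball. -/
theorem word_drop_agreeOn {o : V} {N : ℕ} {a b : Fin n → (T ≃g T)} (h : AgreeOn o N a b)
    (L : List (Fin n × Bool)) {v : V}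
    (hv : ∀ m ≤ L.length, T.dist o (word a (L.drop m) v) ≤ N) {m : ℕ} (hm : m ≤ L.length) :
    word b (L.drop m) v = word a (L.drop m) v := by
  induction hm using Nat.decreasingInduction with
  | self => rw [word_drop_length_apply, word_drop_length_apply]
  | of_succ m hm ih =>
    rw [word_drop_apply b L hm, ih]
    exact letter_agreeOn h _ (hv _ hm) (hv _ hm.le) (word_drop_apply a L hm v).symm

theorem modify_letter (l : Fin n × Bool) (k : T ≃g T) (a : Fin n → (T ≃g T)) (y : V) :
    letter (modify l k a) l y = letter a l (k y) := by
  obtain ⟨i, e⟩ := l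
  cases e <;> simp [letter, modify, RelIso.mul_apply]

theorem modify_letter_of_ne {l l' : Fin n × Bool} (k : T ≃g T) (a : Fin n → (T ≃g T)) {y : V}
    (h : l' ≠ l) (hk : l'.1 = l.1 → k (letter a l' y) = letter a l' y) :
    letter (modify l k a) l' y = letter a l' y := by
  obtain ⟨i, e⟩ := l
  obtain ⟨i', e'⟩ := l'
  by_cases hi : i' = i
  · subst hi
    replace hk := hk rfl
    cases e <;> cases e'
    · exact absurd rfl h
    · simp only [letter, modify, cond_true, if_true, Bool.false_eq_true, if_false,
        RelIso.mul_apply] at *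
      rw [inv_apply_eq_iff, hk]
    · simp only [letter, modify, cond_false, if_true, mul_inv_rev, RelIso.mul_apply] at *
      rw [inv_apply_eq_iff, hk]
    · exact absurd rfl h
  · cases e' <;> simp [letter, modify, hi]

theorem modify_agreeOn {o : V} {N : ℕ} (l : Fin n × Bool) {k : T ≃g T}
    (hk : ∀ y, T.dist o y ≤ N → k y = y) (a : Fin n → (T ≃g T)) :
    AgreeOn o N a (modify l k a) := by
  intro i x y hx hy
  by_cases hi : i = l.1
  · simp only [modify, hi, if_true]
    cases l.2
    · simp only [Bool.false_eq_true, if_false, RelIso.mul_apply]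
      rw [inv_apply_eq_iff, hk y hy]
    · simp only [if_true, RelIso.mul_apply, hk x hx]
  · simp [modify, hi]

theorem IsTree.dist_letter_le (hT : T.IsTree) {o : V} {M : ℕ} {a : Fin n → (T ≃g T)}
    (ha : ∀ i, T.dist o (a i o) ≤ M) (l : Fin n × Bool) (x : V) :
    T.dist o (letter a l x) ≤ M + T.dist o x := by
  have h1 : T.dist o (letter a l o) ≤ M := by
    obtain ⟨i, e⟩ := l
    cases e
    · change T.dist o ((a i)⁻¹ o) ≤ M
      have h2 : a i ((a i)⁻¹ o) = o := (a i).apply_symm_apply o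
      rw [← dist_aut_apply (a i), h2, dist_comm]
      exact ha i
    · exact ha i
  calc _ ≤ T.dist o (letter a l o) + T.dist (letter a l o) (letter a l x) := hT.1.dist_triangle
    _ ≤ _ := by rw [dist_aut_apply]; omega

theorem IsTree.dist_word_le (hT : T.IsTree) {o : V} {M : ℕ} {a : Fin n → (T ≃g T)}
    (ha : ∀ i, T.dist o (a i o) ≤ M) (L : List (Fin n × Bool)) (x : V) :
    T.dist o (word a L x) ≤ L.length * M + T.dist o x := by
  induction L with
  | nil => simp [word_nil_apply]
  | cons l L ih =>
    rw [word_cons_apply, List.length_cons, add_mul, one_mul]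
    have := hT.dist_letter_le ha l (word a L x)
    omega

/-- Parents commute with the suffixes of a word, far away from the root. -/
theorem IsTree.parent_word_drop (hT : T.IsTree) {o : V} {M : ℕ} {a : Fin n → (T ≃g T)}
    (ha : ∀ i, T.dist o (a i o) ≤ M) (L : List (Fin n × Bool)) (m : ℕ) {c : V}
    (hc : L.length * M < T.dist o c) :
    word a (L.drop m) c ≠ o ∧
      T.parent o (word a (L.drop m) c) = word a (L.drop m) (T.parent o c) ∧
      T.dist o (word a (L.drop m) c) = T.dist o (word a (L.drop m) (T.parent o c)) + 1 := by
  refine hT.parent_aut_of_lt _ (lt_of_le_of_lt (hT.dist_word_le ha _ o) ?_)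
  rw [dist_self, add_zero]
  refine lt_of_le_of_lt (Nat.mul_le_mul_right M ?_) hc
  simp

/-- The highest vertex of the path of `v` along the word `L` has level `N`. -/
def HasHeight (o : V) (L : List (Fin n × Bool)) (N : ℕ) (a : Fin n → (T ≃g T)) (v : V) : Prop :=
  (∀ m ≤ L.length, T.dist o (word a (L.drop m) v) ≤ N) ∧
    ∃ m ≤ L.length, T.dist o (word a (L.drop m) v) = N

theorem IsTree.hasHeight_succ_iff (hT : T.IsTree) {o : V} {M : ℕ} {a : Fin n → (T ≃g T)}
    (ha : ∀ i, T.dist o (a i o) ≤ M) (L : List (Fin n × Bool)) {N : ℕ} {c : V}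
    (hc : L.length * M < T.dist o c) :
    HasHeight o L (N + 1) a c ↔ HasHeight o L N a (T.parent o c) := by
  have h := fun m => (hT.parent_word_drop ha L m hc).2.2
  simp only [HasHeight, h, add_le_add_iff_right, add_left_inj]

/-- `v` is a fixed vertex of the word `L`, far from the root, whose path is a simple cycle with
highest level `N`. -/
structure IsSimplyFixed (o : V) (L : List (Fin n × Bool)) (M N : ℕ) (a : Fin n → (T ≃g T))
    (v : V) : Prop where
  dist_le : ∀ i, T.dist o (a i o) ≤ M
  far : L.length * M < T.dist o v
  fixed : word a L v = v
  inj : ∀ m m', 1 ≤ m → m ≤ L.length → 1 ≤ m' → m' ≤ L.length →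
    word a (L.drop m) v = word a (L.drop m') v → m = m'
  height : HasHeight o L N a v

theorem IsSimplyFixed.of_agreeOn {o : V} {L : List (Fin n × Bool)} {M N : ℕ}
    {a b : Fin n → (T ≃g T)} {v : V} (h : IsSimplyFixed o L M N a v) (hM : M ≤ N)
    (hab : AgreeOn o N a b) : IsSimplyFixed o L M N b v := by
  have hq := fun m (hm : m ≤ L.length) => word_drop_agreeOn hab L h.height.1 hm
  refine ⟨fun i => ?_, h.far, ?_, fun m m' h1 h2 h3 h4 h5 => ?_, fun m hm => ?_, ?_⟩
  · have h1 := h.dist_le i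
    rwa [(hab i o (a i o) (by simp) (h1.trans hM)).1 rfl]
  · have h1 := hq 0 (Nat.zero_le _)
    rw [List.drop_zero] at h1
    rw [h1, h.fixed]
  · rw [hq m h2, hq m' h4] at h5
    exact h.inj m m' h1 h2 h3 h4 h5
  · rw [hq m hm]
    exact h.height.1 m hm
  · obtain ⟨m, hm, h1⟩ := h.height.2
    exact ⟨m, hm, by rw [hq m hm, h1]⟩

theorem IsTree.isSimplyFixed_child (hT : T.IsTree) {o : V} {L : List (Fin n × Bool)} {M N : ℕ}
    {a : Fin n → (T ≃g T)} {c : V} (h : IsSimplyFixed o L M N a (T.parent o c)) (hc : c ≠ o)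
    (hfix : word a L c = c) : IsSimplyFixed o L M (N + 1) a c := by
  have hfar : L.length * M < T.dist o c := by
    have h1 := h.far
    have h2 := (hT.parent_spec hc).2
    omega
  refine ⟨h.dist_le, hfar, hfix, fun m m' h1 h2 h3 h4 h5 => h.inj m m' h1 h2 h3 h4 ?_,
    (hT.hasHeight_succ_iff h.dist_le L hfar).2 h.height⟩
  have h6 := congrArg (T.parent o) h5
  rwa [(hT.parent_word_drop h.dist_le L m hfar).2.1,
    (hT.parent_word_drop h.dist_le L m' hfar).2.1] at h6

/-- A finite set of simply fixed vertices with disjoint paths, all of which have a highest vertex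
right before the letter with index `J` acts. -/
structure IsIndependent (o : V) (L : List (Fin n × Bool)) (M N J : ℕ) (a : Fin n → (T ≃g T))
    (X : Finset V) : Prop where
  simplyFixed : ∀ x ∈ X, IsSimplyFixed o L M N a x
  lt_length : J < L.length
  top : ∀ x ∈ X, T.dist o (word a (L.drop (J + 1)) x) = N
  inj : ∀ x ∈ X, ∀ x' ∈ X, ∀ m m', 1 ≤ m → m ≤ L.length → 1 ≤ m' → m' ≤ L.length →
    word a (L.drop m) x = word a (L.drop m') x' → m = m' ∧ x = x'

theorem IsSimplyFixed.exists_isIndependent {o : V} {L : List (Fin n × Bool)} {M N : ℕ}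
    {a : Fin n → (T ≃g T)} {v : V} (h : IsSimplyFixed o L M N a v) (hL : L ≠ []) :
    ∃ J, IsIndependent o L M N J a {v} := by
  have hpos := List.length_pos_of_ne_nil hL
  have key : ∀ m, 1 ≤ m → m ≤ L.length → T.dist o (word a (L.drop m) v) = N →
      ∃ J, IsIndependent o L M N J a {v} := by
    intro m h1 h2 h3
    obtain ⟨J, rfl⟩ := Nat.exists_eq_add_of_le' h1
    refine ⟨J, ?_, h2, ?_, ?_⟩
    · simpa using h
    · simpa using h3
    · simp only [Finset.mem_singleton]
      rintro x rfl x' rfl m m' h4 h5 h6 h7 h8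
      exact ⟨h.inj m m' h4 h5 h6 h7 h8, rfl⟩
  obtain ⟨m, hm, h1⟩ := h.height.2
  rcases Nat.eq_zero_or_pos m with rfl | h0
  · rw [List.drop_zero, h.fixed] at h1
    exact key L.length hpos le_rfl (by rwa [word_drop_length_apply])
  · exact key m h0 hm h1

namespace IsIndependent

variable {o : V} {L : List (Fin n × Bool)} {M N J : ℕ} {a b : Fin n → (T ≃g T)} {X : Finset V}

theorem of_agreeOn (h : IsIndependent o L M N J a X) (hM : M ≤ N) (hab : AgreeOn o N a b) :
    IsIndependent o L M N J b X := by
  have hq := fun x (hx : x ∈ X) m (hm : m ≤ L.length) =>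
    word_drop_agreeOn hab L (h.simplyFixed x hx).height.1 hm
  refine ⟨fun x hx => (h.simplyFixed x hx).of_agreeOn hM hab, h.lt_length, fun x hx => ?_,
    fun x hx x' hx' m m' h1 h2 h3 h4 h5 => ?_⟩
  · rw [hq x hx _ h.lt_length, h.top x hx]
  · rw [hq x hx m h2, hq x' hx' m' h4] at h5
    exact h.inj x hx x' hx' m m' h1 h2 h3 h4 h5

variable [T.LocallyFinite]

theorem mem_children_drop (hT : T.IsTree) (h : IsIndependent o L M N J a X) {x c : V} (hx : x ∈ X)
    (hc : c ∈ T.children o x) (m : ℕ) :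
    word a (L.drop m) c ∈ T.children o (word a (L.drop m) x) := by
  have h1 := h.simplyFixed x hx
  have h2 := hT.parent_word_drop h1.dist_le L m (c := c) (by
    rw [(mem_children.1 hc).2]; exact Nat.lt_succ_of_lt h1.far)
  rw [(hT.mem_children_iff.1 hc).2] at h2
  exact hT.mem_children_iff.2 ⟨h2.1, h2.2.1⟩

theorem children [DecidableEq V] (hT : T.IsTree) (h : IsIndependent o L M N J a X)
    (hfix : ∀ x ∈ X, ∀ c ∈ T.children o x, word a L c = c) :
    IsIndependent o L M (N + 1) J a (X.biUnion (T.children o)) := by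
  simp only [IsTree.mem_children_iff hT] at hfix
  have hq : ∀ c, c ≠ o ∧ T.parent o c ∈ X → ∀ m,
      T.parent o (word a (L.drop m) c) = word a (L.drop m) (T.parent o c) ∧
      T.dist o (word a (L.drop m) c) = T.dist o (word a (L.drop m) (T.parent o c)) + 1 := by
    rintro c ⟨hc, hx⟩ m
    have h1 := h.simplyFixed _ hx
    have := (hT.parent_spec hc).2
    exact (hT.parent_word_drop h1.dist_le L m (by have := h1.far; omega)).2
  have hX : ∀ c, c ∈ X.biUnion (T.children o) ↔ c ≠ o ∧ T.parent o c ∈ X := by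
    intro c
    simp only [Finset.mem_biUnion, hT.mem_children_iff]
    exact ⟨fun ⟨x, hx, hc, hp⟩ => ⟨hc, hp ▸ hx⟩, fun ⟨hc, hx⟩ => ⟨_, hx, hc, rfl⟩⟩
  have hinj : ∀ c, c ≠ o ∧ T.parent o c ∈ X → ∀ c', c' ≠ o ∧ T.parent o c' ∈ X →
      ∀ m m', 1 ≤ m → m ≤ L.length → 1 ≤ m' → m' ≤ L.length →
      word a (L.drop m) c = word a (L.drop m') c' → m = m' ∧ c = c' := by
    intro c hc c' hc' m m' h1 h2 h3 h4 h5
    have h6 := congrArg (T.parent o) h5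
    rw [(hq c hc m).1, (hq c' hc' m').1] at h6
    obtain ⟨rfl, -⟩ := h.inj _ hc.2 _ hc'.2 m m' h1 h2 h3 h4 h6
    exact ⟨rfl, (word a (L.drop m)).injective h5⟩
  refine ⟨fun c hc => ?_, h.lt_length, fun c hc => ?_, ?_⟩
  · rw [hX] at hc
    exact hT.isSimplyFixed_child (h.simplyFixed _ hc.2) hc.1 (hfix _ hc.2 c ⟨hc.1, rfl⟩)
  · rw [hX] at hc
    rw [(hq c hc _).2, h.top _ hc.2]
  · simp only [hX]
    exact hinj

/-- Modifying the letter at the top of a simple cycle does not affect the other letters. -/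
theorem letter_modify (hT : T.IsTree) (hL : FreeGroup.IsReduced L)
    (h : IsIndependent o L M N J a X) {k : T ≃g T}
    (hk : ∀ y, T.dist o y ≤ N + 1 →
      (∀ x ∈ X, y ∉ T.children o (word a (L.drop (J + 1)) x)) → k y = y)
    {m : ℕ} (hm : m < L.length) (hmJ : m ≠ J) {x c : V} (hx : x ∈ X)
    (hc : c ∈ T.children o x) :
    letter (modify (L[J]'h.lt_length) k a) L[m] (word a (L.drop (m + 1)) c) =
      word a (L.drop m) c := by
  have hJ := h.lt_length
  have hch := fun m => h.mem_children_drop hT hx hc m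
  have hdist : ∀ m ≤ L.length, T.dist o (word a (L.drop m) c) ≤ N + 1 := by
    intro m hm
    rw [(mem_children.1 (hch m)).2]
    exact Nat.succ_le_succ ((h.simplyFixed x hx).height.1 m hm)
  have hkfix : ∀ m ≤ L.length, (∀ x' ∈ X, word a (L.drop m) x ≠ word a (L.drop (J + 1)) x') →
      k (word a (L.drop m) c) = word a (L.drop m) c := by
    intro m hm hne
    refine hk _ (hdist m hm) fun x' hx' hmem => hne x' hx' ?_
    rw [← (hT.mem_children_iff.1 (hch m)).2, (hT.mem_children_iff.1 hmem).2]
  rw [word_drop_apply a L hm]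
  by_cases hl : L[m] = L[J]
  · rw [hl, modify_letter, hkfix (m + 1) hm]
    intro x' hx' heq
    exact hmJ (Nat.succ_injective (h.inj x hx x' hx' _ _ (by omega) hm (by omega) hJ heq).1)
  · refine modify_letter_of_ne k a hl fun hl1 => ?_
    rw [← word_drop_apply a L hm]
    refine hkfix m hm.le fun x' hx' heq => ?_
    have hne : ∀ i j (hi : i < L.length) (hj : j < L.length), i + 1 = j →
        L[i].1 = L[j].1 → L[i].2 = L[j].2 := by
      rintro i _ hi hj rfl
      exact List.isChain_iff_getElem.1 hL i hj
    rcases Nat.eq_zero_or_pos m with rfl | hm0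
    · have hxf : word a (L.drop 0) x = x := (h.simplyFixed x hx).fixed
      have hxl : word a (L.drop L.length) x = x := word_drop_length_apply a L x
      have h1 := h.inj x hx x' hx' L.length (J + 1) hm le_rfl (by omega) hJ
        (by rw [hxl, ← heq, hxf])
      have h2 : L[0].2 = !L[J].2 := by
        rcases hb : L[0].2 <;> rcases hb' : L[J].2 <;> simp_all [Prod.ext_iff]
      have h3 : word a (L.drop 1) x = word a (L.drop J) x := by
        rw [word_drop_apply a L hJ, ← h1.1, hxl]
        have h4 := word_drop_apply a L hm x
        rw [hxf] at h4
        have h5 : letter a L[J] = (letter a L[0])⁻¹ := by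
          simp only [letter, h2, hl1]
          cases L[J].2 <;> simp
        rw [h5, eq_comm, inv_apply_eq_iff]
        exact h4
      have h4 := (h.inj x hx x hx 1 J le_rfl (by omega) (by omega) hJ.le h3).1
      have := hne 0 J hm hJ (by omega) hl1
      rw [this] at h2
      simp at h2
    · have h1 := (h.inj x hx x' hx' m (J + 1) hm0 hm.le (by omega) hJ heq).1
      have := hne J m hJ hm h1.symm hl1.symm
      exact hl (Prod.ext hl1 this.symm)

end IsIndependent

/-- The word `L` rotated so that it starts to act with its letter of index `J`. -/
def rotation (L : List (Fin n × Bool)) (J : ℕ) (a : Fin n → (T ≃g T)) : T ≃g T :=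
  word a (L.drop (J + 1)) * word a L * (word a (L.drop (J + 1)))⁻¹

theorem rotation_word_drop (L : List (Fin n × Bool)) (J : ℕ) (a : Fin n → (T ≃g T)) (c : V) :
    rotation L J a (word a (L.drop (J + 1)) c) = word a (L.drop (J + 1)) (word a L c) := by
  simp [rotation, RelIso.mul_apply]

theorem measurable_rotation [Countable V] (L : List (Fin n × Bool)) (J : ℕ) :
    Measurable fun a : Fin n → (T ≃g T) => rotation L J a :=
  ((measurable_word _).aut_mul (measurable_word _)).aut_mul (measurable_word _).aut_inv

namespace IsIndependent

variable {o : V} {L : List (Fin n × Bool)} {M N J : ℕ} {a b : Fin n → (T ≃g T)} {X : Finset V}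

variable [T.LocallyFinite]

theorem exists_child (hT : T.IsTree) (h : IsIndependent o L M N J a X) {x y : V} (hx : x ∈ X)
    (hy : y ∈ T.children o (word a (L.drop (J + 1)) x)) :
    ∃ c ∈ T.children o x, word a (L.drop (J + 1)) c = y := by
  have h1 := h.simplyFixed x hx
  have h2 := h.top x hx
  set g := word a (L.drop (J + 1)) with hg
  have hgo : T.dist o (g⁻¹ o) < T.dist o y := by
    have h3 : g (g⁻¹ o) = o := g.apply_symm_apply o
    rw [← dist_aut_apply g, h3, dist_comm, (mem_children.1 hy).2, h2]
    have h4 : T.dist o (g o) ≤ _ := hT.dist_word_le h1.dist_le (L.drop (J + 1)) o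
    have h5 := h1.height.1 L.length le_rfl
    rw [word_drop_length_apply] at h5
    have h6 : (L.drop (J + 1)).length * M ≤ L.length * M := Nat.mul_le_mul_right M (by simp)
    rw [dist_self] at h4
    have := h1.far
    omega
  obtain ⟨h3, h4, -⟩ := hT.parent_aut_of_lt g⁻¹ hgo
  refine ⟨g⁻¹ y, hT.mem_children_iff.2 ⟨h3, ?_⟩, g.apply_symm_apply y⟩
  rw [h4, (hT.mem_children_iff.1 hy).2]
  exact g.symm_apply_apply x

/-- The rotated word fixes the top vertices of the cycles and permutes their children. -/
theorem rotation_mem_children (hT : T.IsTree) (h : IsIndependent o L M N J a X) {x y : V}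
    (hx : x ∈ X) (hy : y ∈ T.children o (word a (L.drop (J + 1)) x)) :
    rotation L J a y ∈ T.children o (word a (L.drop (J + 1)) x) := by
  obtain ⟨c, hc, rfl⟩ := h.exists_child hT hx hy
  rw [rotation_word_drop]
  refine h.mem_children_drop hT hx ?_ _
  have := h.mem_children_drop hT hx hc 0
  rwa [List.drop_zero, (h.simplyFixed x hx).fixed] at this

/-- Modifying the letter of index `J` by `k` multiplies the rotated word by `k` at the children of
the top vertices. -/
theorem rotation_modify (hT : T.IsTree) (hL : FreeGroup.IsReduced L)
    (h : IsIndependent o L M N J a X) {k : T ≃g T}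
    (hk : ∀ y, T.dist o y ≤ N + 1 →
      (∀ x ∈ X, y ∉ T.children o (word a (L.drop (J + 1)) x)) → k y = y)
    {x y : V} (hx : x ∈ X) (hy : y ∈ T.children o (word a (L.drop (J + 1)) x)) :
    rotation L J (modify (L[J]'h.lt_length) k a) y = rotation L J a (k y) := by
  have hJ := h.lt_length
  set a' := modify (L[J]'h.lt_length) k a with ha'
  have hafter : ∀ m, m ≤ L.length → J + 1 ≤ m → ∀ c ∈ T.children o x,
      word a' (L.drop m) c = word a (L.drop m) c := by
    intro m hm
    induction hm using Nat.decreasingInduction with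
    | self => intro _ c _; rw [word_drop_length_apply, word_drop_length_apply]
    | of_succ m hm ih =>
      intro hmJ c hc
      rw [word_drop_apply a' L hm, ih (by omega) c hc]
      exact h.letter_modify hT hL hk hm (by omega) hx hc
  have hkN : ∀ y, T.dist o y ≤ N → k y = y := by
    intro y hy
    refine hk y (by omega) fun x' hx' hmem => ?_
    rw [mem_children, h.top x' hx'] at hmem
    omega
  have hko : k o = o := hkN o (by simp)
  have hky : k y ∈ T.children o (word a (L.drop (J + 1)) x) := by
    rw [mem_children] at hy ⊢
    refine ⟨?_, ?_⟩
    · have := k.map_adj_iff.2 hy.1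
      rwa [hkN _ (h.top x hx).le] at this
    · rw [← hy.2]
      conv_lhs => rw [← hko]
      exact dist_aut_apply k o y
  obtain ⟨c, hc, rfl⟩ := h.exists_child hT hx hy
  obtain ⟨c', hc', hcc'⟩ := h.exists_child hT hx hky
  have hbefore : ∀ m, m ≤ J → word a' (L.drop m) c = word a (L.drop m) c' := by
    intro m hm
    induction hm using Nat.decreasingInduction with
    | self =>
      rw [word_drop_apply a' L hJ, hafter _ hJ le_rfl c hc, ha', modify_letter, ← hcc',
        ← word_drop_apply a L hJ]
    | of_succ m hm ih =>
      rw [word_drop_apply a' L (hm.trans hJ), ih]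
      exact h.letter_modify hT hL hk (hm.trans hJ) hm.ne hx hc'
  have h0 : word a' L c = word a L c' := hbefore 0 (Nat.zero_le _)
  have hfc' : word a L c' ∈ T.children o x := by
    have := h.mem_children_drop hT hx hc' 0
    rwa [List.drop_zero, (h.simplyFixed x hx).fixed] at this
  rw [← hcc', rotation_word_drop, ← hafter _ hJ le_rfl c hc, rotation_word_drop, h0,
    hafter _ hJ le_rfl _ hfc']

end IsIndependent

end SimpleGraph

namespace SimpleGraph

variable {V : Type*} {T : SimpleGraph V} {n : ℕ} [T.LocallyFinite]

theorem IsTree.measurableSet_agreeOn (hT : T.IsTree) (o : V) (N : ℕ) (a : Fin n → (T ≃g T)) :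
    MeasurableSet {b | AgreeOn o N a b} :=
  hT.ballAlgebra_le o N _ (measurableSet_ballAlgebra_iff.2 fun _ _ h h' => AgreeOn.trans h' h)

namespace IsIndependent

variable {o : V} {L : List (Fin n × Bool)} {d M N J : ℕ} {a b : Fin n → (T ≃g T)} {X : Finset V}
  {μ : Measure (T ≃g T)} [μ.IsMulLeftInvariant]

/-- Given the partial maps on the ball, all values of the rotated word at children of the top
vertex are equally likely. -/
theorem measure_rotation_eq (hT : T.IsTree) (hreg : T.IsRegularOfDegree d)
    (hμ : μ {a : T ≃g T | a o = o} = 1) (hL : FreeGroup.IsReduced L) (hM : M ≤ N) {v : V}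
    (h : IsIndependent o L M N J a {v}) {y y' : V}
    (hy : y ∈ T.children o (word a (L.drop (J + 1)) v))
    (hy' : y' ∈ T.children o (word a (L.drop (J + 1)) v)) :
    Measure.pi (fun _ : Fin n => μ) ({b | AgreeOn o N a b} ∩ {b | rotation L J b y = y}) =
      Measure.pi (fun _ : Fin n => μ) ({b | AgreeOn o N a b} ∩ {b | rotation L J b y' = y}) := by
  classical
  have := hT.countable
  have htop := h.top v (by simp)
  have hne : ∀ z, T.dist o z ≤ N → z ≠ y ∧ z ≠ y' := by
    intro z hz
    rw [mem_children, htop] at hy hy'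
    constructor <;> rintro rfl <;> omega
  obtain ⟨k, hk⟩ := hT.exists_aut_extend hreg o N (Equiv.swap y y')
    (fun z hz => Equiv.swap_apply_of_ne_of_ne (hne z hz).1 (hne z hz).2)
    (fun z => by
      rw [mem_children] at hy hy'
      rcases eq_or_ne z y with rfl | h1
      · rw [Equiv.swap_apply_left, hy.2, hy'.2]
      rcases eq_or_ne z y' with rfl | h2
      · rw [Equiv.swap_apply_right, hy.2, hy'.2]
      rw [Equiv.swap_apply_of_ne_of_ne h1 h2])
    (fun z => by
      rw [hT.mem_children_iff] at hy hy'
      rcases eq_or_ne z y with rfl | h1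
      · rw [Equiv.swap_apply_left, hy.2, hy'.2]
      rcases eq_or_ne z y' with rfl | h2
      · rw [Equiv.swap_apply_right, hy.2, hy'.2]
      rw [Equiv.swap_apply_of_ne_of_ne h1 h2])
  have hkN : ∀ z, T.dist o z ≤ N → k z = z := fun z hz => by
    rw [hk z (by omega), Equiv.swap_apply_of_ne_of_ne (hne z hz).1 (hne z hz).2]
  have hky : k y = y' := by
    rw [hk y (by rw [(mem_children.1 hy).2, htop]), Equiv.swap_apply_left]
  have hmp := hT.measurePreserving_modify (n := n) hμ (hkN o (by simp)) (L[J]'h.lt_length)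
  rw [← hmp.measure_preimage ((hT.measurableSet_agreeOn o N a).inter
    (measurable_aut_iff.1 (measurable_rotation L J) y y)).nullMeasurableSet]
  congr 1
  ext b
  have hb := modify_agreeOn (L[J]'h.lt_length) hkN b
  refine ⟨fun ⟨h1, h2⟩ => ?_, fun ⟨h1, h2⟩ => ?_⟩
  all_goals
    have hab : AgreeOn o N a b := by first | exact h1 | exact AgreeOn.trans h1 hb.symm
    have hbi := h.of_agreeOn hM hab
    have htopb := word_drop_agreeOn hab L (h.simplyFixed v (by simp)).height.1 h.lt_length
    have hrot := hbi.rotation_modify hT hL (k := k) (x := v) (y := y) (by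
      intro z hz hmem
      have h3 := hmem v (by simp)
      rw [htopb] at h3
      rw [hk z hz, Equiv.swap_apply_of_ne_of_ne]
      · rintro rfl
        exact h3 hy
      · rintro rfl
        exact h3 hy') (by simp) (by rwa [htopb])
    rw [hky] at hrot
  · exact ⟨hab, hrot.symm.trans h2⟩
  · exact ⟨AgreeOn.trans hab hb, hrot.trans h2⟩

/-- Given the partial maps on the ball, the expected number of fixed children of a simply fixed
vertex is at most one. -/
theorem sum_measure_children_le (hT : T.IsTree) (hreg : T.IsRegularOfDegree d)
    (hμ : μ {a : T ≃g T | a o = o} = 1) (hL : FreeGroup.IsReduced L) (hM : M ≤ N) {v : V}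
    (h : IsIndependent o L M N J a {v}) :
    ∑ c ∈ T.children o v,
      Measure.pi (fun _ : Fin n => μ) ({b | AgreeOn o N a b} ∩ {b | word b L c = c}) ≤
      Measure.pi (fun _ : Fin n => μ) {b | AgreeOn o N a b} := by
  have := hT.countable
  set π := Measure.pi (fun _ : Fin n => μ)
  set Q : Set (Fin n → (T ≃g T)) := {b | AgreeOn o N a b} with hQ
  set u := word a (L.drop (J + 1)) v with hu
  have hQm : MeasurableSet Q := hT.measurableSet_agreeOn o N a
  have htopb : ∀ b ∈ Q, word b (L.drop (J + 1)) v = u := fun b hb =>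
    word_drop_agreeOn hb L (h.simplyFixed v (by simp)).height.1 h.lt_length
  let W : V → V → Set (Fin n → (T ≃g T)) := fun c y =>
    Q ∩ {b | word b L c = c} ∩ {b | word b (L.drop (J + 1)) c = y}
  have hWm : ∀ c y, MeasurableSet (W c y) := fun c y =>
    (hQm.inter (measurableSet_word_eq L c c)).inter (measurableSet_word_eq _ c y)
  have h1 : ∀ c ∈ T.children o v, π (Q ∩ {b | word b L c = c}) ≤
      ∑ y ∈ T.children o u, π (W c y) := by
    intro c hc
    refine le_trans (measure_mono ?_) (measure_biUnion_finset_le _ _)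
    intro b hb
    have h2 := (h.of_agreeOn hM hb.1).mem_children_drop hT (by simp) hc (J + 1)
    rw [htopb b hb.1] at h2
    exact Set.mem_biUnion h2 ⟨hb, rfl⟩
  have h2 : ∀ y, ∑ c ∈ T.children o v, π (W c y) ≤ π (Q ∩ {b | rotation L J b y = y}) := by
    intro y
    rw [← measure_biUnion_finset _ fun c _ => hWm c y]
    · refine measure_mono (Set.iUnion₂_subset ?_)
      rintro c _ b ⟨⟨hb, hb1⟩, hb2⟩
      refine ⟨hb, ?_⟩
      rw [Set.mem_ofPred_eq] at *
      rw [← hb2, rotation_word_drop, hb1]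
    · intro c _ c' _ hcc'
      refine Set.disjoint_left.2 ?_
      rintro b ⟨_, hb⟩ ⟨_, hb'⟩
      rw [Set.mem_ofPred_eq] at *
      exact hcc' ((word b (L.drop (J + 1))).injective (hb.trans hb'.symm))
  have h3 : ∀ y ∈ T.children o u, ((T.children o u).card : ℝ≥0∞) *
      π (Q ∩ {b | rotation L J b y = y}) ≤ π Q := by
    intro y hy
    rw [← nsmul_eq_mul, ← Finset.sum_const, Finset.sum_congr rfl fun y' hy' =>
      measure_rotation_eq hT hreg hμ hL hM h hy hy', ← measure_biUnion_finset]
    · exact measure_mono (Set.iUnion₂_subset fun y' _ => Set.inter_subset_left)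
    · intro c _ c' _ hcc'
      refine Set.disjoint_left.2 ?_
      rintro b ⟨_, hb⟩ ⟨_, hb'⟩
      rw [Set.mem_ofPred_eq] at *
      exact hcc' ((rotation L J b).injective (hb.trans hb'.symm))
    · exact fun y' _ => hQm.inter (measurable_aut_iff.1 (measurable_rotation L J) y' y)
  calc _ ≤ ∑ c ∈ T.children o v, ∑ y ∈ T.children o u, π (W c y) := Finset.sum_le_sum h1
    _ = ∑ y ∈ T.children o u, ∑ c ∈ T.children o v, π (W c y) := Finset.sum_comm
    _ ≤ ∑ y ∈ T.children o u, π (Q ∩ {b | rotation L J b y = y}) :=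
      Finset.sum_le_sum fun y _ => h2 y
    _ ≤ π Q := by
      rcases Nat.eq_zero_or_pos (T.children o u).card with h0 | h0
      · rw [Finset.card_eq_zero.1 h0]
        simp
      · have hc0 : ((T.children o u).card : ℝ≥0∞) ≠ 0 := by exact_mod_cast h0.ne'
        rw [← ENNReal.mul_le_mul_iff_right hc0 (ENNReal.natCast_ne_top _), Finset.mul_sum]
        refine (Finset.sum_le_sum h3).trans ?_
        rw [Finset.sum_const, nsmul_eq_mul]

/-- Given the partial maps on the ball, all children of independent vertices are fixed with a
probability that is bounded below. -/
theorem measure_le_children_fixed (hT : T.IsTree) (hreg : T.IsRegularOfDegree d)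
    (hμ : μ {a : T ≃g T | a o = o} = 1) (hL : FreeGroup.IsReduced L) (hM : M ≤ N)
    (h : IsIndependent o L M N J a X) :
    Measure.pi (fun _ : Fin n => μ) {b | AgreeOn o N a b} ≤
      ((X.card * (d - 1)).factorial : ℕ) * Measure.pi (fun _ : Fin n => μ)
        ({b | AgreeOn o N a b} ∩ {b | ∀ x ∈ X, ∀ c ∈ T.children o x, word b L c = c}) := by
  classical
  have := hT.countable
  set π := Measure.pi (fun _ : Fin n => μ)
  set Q : Set (Fin n → (T ≃g T)) := {b | AgreeOn o N a b} with hQ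
  set G : Set (Fin n → (T ≃g T)) := {b | ∀ x ∈ X, ∀ c ∈ T.children o x, word b L c = c} with hG
  have hQm : MeasurableSet Q := hT.measurableSet_agreeOn o N a
  have hGm : MeasurableSet G := by
    have : G = ⋂ x ∈ X, ⋂ c ∈ T.children o x, {b | word b L c = c} := by
      ext b; simp [hG]
    rw [this]
    exact Finset.measurableSet_biInter _ fun x _ => Finset.measurableSet_biInter _ fun c _ =>
      measurableSet_word_eq L c c
  set W : Finset V := X.biUnion fun x => T.children o (word a (L.drop (J + 1)) x) with hW
  have hWmem : ∀ z, z ∈ W ↔ ∃ x ∈ X, z ∈ T.children o (word a (L.drop (J + 1)) x) := by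
    intro z; rw [hW, Finset.mem_biUnion]
  have hWdist : ∀ z ∈ W, T.dist o z = N + 1 := by
    intro z hz
    obtain ⟨x, hx, hz⟩ := (hWmem z).1 hz
    rw [(mem_children.1 hz).2, h.top x hx]
  have hWcard : W.card ≤ X.card * (d - 1) := by
    refine Finset.card_biUnion_le_card_mul _ _ _ fun x hx => ?_
    refine (hT.card_children hreg fun h0 => ?_).le
    have h1 := h.top x hx
    rw [h0, dist_self] at h1
    have h2 := (h.simplyFixed x hx).height.1 L.length le_rfl
    rw [word_drop_length_apply] at h2
    have h3 := (h.simplyFixed x hx).far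
    omega
  let K : Equiv.Perm W → (T ≃g T) := fun τ =>
    if hk : ∃ k : T ≃g T, ∀ z, T.dist o z ≤ N + 1 → k z = Equiv.Perm.ofSubtype τ z
    then hk.choose else 1
  have hK : ∀ τ z, T.dist o z ≤ N + 1 → z ∉ W → K τ z = z := by
    intro τ z hz hzW
    by_cases hk : ∃ k : T ≃g T, ∀ z, T.dist o z ≤ N + 1 → k z = Equiv.Perm.ofSubtype τ z
    · simp only [K, dif_pos hk]
      rw [hk.choose_spec z hz, Equiv.Perm.ofSubtype_apply_of_not_mem _ hzW]
    · simp only [K, dif_neg hk]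
      rfl
  have hKN : ∀ τ z, T.dist o z ≤ N → K τ z = z := fun τ z hz =>
    hK τ z (by omega) fun hzW => by have := hWdist z hzW; omega
  have hcover : Q ⊆ ⋃ τ : Equiv.Perm W, modify (L[J]'h.lt_length) (K τ) ⁻¹' (Q ∩ G) := by
    intro b hb
    have hbi := h.of_agreeOn hM hb
    have htopb : ∀ x ∈ X, word b (L.drop (J + 1)) x = word a (L.drop (J + 1)) x := fun x hx =>
      word_drop_agreeOn hb L (h.simplyFixed x hx).height.1 h.lt_length
    have hrotx : ∀ x ∈ X, ∀ z ∈ T.children o (word a (L.drop (J + 1)) x),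
        rotation L J b z ∈ T.children o (word a (L.drop (J + 1)) x) := by
      intro x hx z hz
      rw [← htopb x hx] at hz ⊢
      exact hbi.rotation_mem_children hT hx hz
    let ρ : W → W := fun z => ⟨rotation L J b z, by
      obtain ⟨x, hx, hz⟩ := (hWmem z).1 z.2
      exact (hWmem _).2 ⟨x, hx, hrotx x hx z hz⟩⟩
    have hρ : Function.Bijective ρ := Finite.injective_iff_bijective.1 fun z z' hzz =>
      Subtype.ext ((rotation L J b).injective (congrArg Subtype.val hzz))
    let τ : Equiv.Perm W := (Equiv.ofBijective ρ hρ).symm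
    have hτ : ∀ z, rotation L J b (τ z) = z := fun z =>
      congrArg Subtype.val ((Equiv.ofBijective ρ hρ).apply_symm_apply z)
    have hτx : ∀ z : W, ∃ w, (τ z : V) ∈ T.children o w ∧ (z : V) ∈ T.children o w := by
      intro z
      obtain ⟨x, hx, hz⟩ := (hWmem _).1 (τ z).2
      exact ⟨_, hz, by have := hrotx x hx _ hz; rwa [hτ] at this⟩
    have hk : ∃ k : T ≃g T, ∀ z, T.dist o z ≤ N + 1 → k z = Equiv.Perm.ofSubtype τ z := by
      refine hT.exists_aut_extend hreg o N _ (fun z hz => ?_) (fun z => ?_) fun z => ?_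
      · exact Equiv.Perm.ofSubtype_apply_of_not_mem _ fun hzW => by
          have := hWdist z hzW
          omega
      · by_cases hz : z ∈ W
        · rw [Equiv.Perm.ofSubtype_apply_of_mem τ hz, hWdist _ (τ ⟨z, hz⟩).2, hWdist z hz]
        · rw [Equiv.Perm.ofSubtype_apply_of_not_mem _ hz]
      · by_cases hz : z ∈ W
        · obtain ⟨w, h1, h2⟩ := hτx ⟨z, hz⟩
          rw [Equiv.Perm.ofSubtype_apply_of_mem τ hz, (hT.mem_children_iff.1 h1).2]
          exact (hT.mem_children_iff.1 h2).2.symm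
        · rw [Equiv.Perm.ofSubtype_apply_of_not_mem _ hz]
    have hKτ : ∀ z : W, K τ z = τ z := by
      intro z
      simp only [K, dif_pos hk]
      rw [hk.choose_spec z (hWdist z z.2).le, Equiv.Perm.ofSubtype_apply_coe]
    refine Set.mem_iUnion.2 ⟨τ, ?_⟩
    have hagree := modify_agreeOn (L[J]'h.lt_length) (hKN τ) b
    refine ⟨AgreeOn.trans hb hagree, fun x hx c hc => ?_⟩
    have hmi := hbi.of_agreeOn hM hagree
    have hkb : ∀ y, T.dist o y ≤ N + 1 →
        (∀ x ∈ X, y ∉ T.children o (word b (L.drop (J + 1)) x)) → K τ y = y := by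
      intro y hy hy'
      refine hK τ y hy fun hyW => ?_
      obtain ⟨x, hx, hyx⟩ := (hWmem y).1 hyW
      rw [← htopb x hx] at hyx
      exact hy' x hx hyx
    have hch := hmi.mem_children_drop hT hx hc (J + 1)
    rw [word_drop_agreeOn hagree L (hbi.simplyFixed x hx).height.1 h.lt_length] at hch
    have hrot := hbi.rotation_modify hT hL hkb hx hch
    rw [rotation_word_drop] at hrot
    rw [htopb x hx] at hch
    have hyW := (hWmem _).2 ⟨x, hx, hch⟩
    rw [hKτ ⟨_, hyW⟩, hτ] at hrot
    exact (word _ (L.drop (J + 1))).injective hrot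
  calc π Q ≤ ∑ τ : Equiv.Perm W, π (modify (L[J]'h.lt_length) (K τ) ⁻¹' (Q ∩ G)) :=
        (measure_mono hcover).trans (measure_iUnion_fintype_le _ _)
    _ = ∑ τ : Equiv.Perm W, π (Q ∩ G) := Finset.sum_congr rfl fun τ _ =>
        (hT.measurePreserving_modify hμ (hKN τ o (by simp)) _).measure_preimage
          (hQm.inter hGm).nullMeasurableSet
    _ = (W.card.factorial : ℕ) * π (Q ∩ G) := by
        rw [Finset.sum_const, Finset.card_univ, Fintype.card_perm, Fintype.card_coe, nsmul_eq_mul]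
    _ ≤ _ := by
        gcongr

end IsIndependent

end SimpleGraph

namespace SimpleGraph

variable {V : Type*} {T : SimpleGraph V} {n : ℕ}

/-- The fixed vertices of the word `L` that are `t` generations below a simply fixed vertex of
height `R`. -/
def survivors (o : V) (L : List (Fin n × Bool)) (M R : ℕ) :
    ℕ → (Fin n → (T ≃g T)) → Set V
  | 0, a => {v | IsSimplyFixed o L M R a v}
  | t + 1, a => {z | z ≠ o ∧ T.parent o z ∈ survivors o L M R t a ∧ word a L z = z}

theorem IsTree.isSimplyFixed_of_mem_survivors (hT : T.IsTree) {o : V} {L : List (Fin n × Bool)}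
    {M R t : ℕ} {a : Fin n → (T ≃g T)} {z : V} (hz : z ∈ survivors o L M R t a) :
    IsSimplyFixed o L M (R + t) a z := by
  induction t generalizing z with
  | zero => exact hz
  | succ t ih => exact hT.isSimplyFixed_child (ih hz.2.1) hz.1 hz.2.2

theorem IsTree.survivors_of_agreeOn (hT : T.IsTree) {o : V} {L : List (Fin n × Bool)}
    {M R t : ℕ} (hM : M ≤ R) {a b : Fin n → (T ≃g T)} (hab : AgreeOn o (R + t) a b) {z : V}
    (hz : z ∈ survivors o L M R t a) : z ∈ survivors o L M R t b := by
  induction t generalizing z with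
  | zero => exact IsSimplyFixed.of_agreeOn hz hM hab
  | succ t ih =>
    exact ⟨hz.1, ih (hab.mono (by omega)) hz.2.1,
      ((hT.isSimplyFixed_of_mem_survivors hz).of_agreeOn (by omega) hab).fixed⟩

theorem IsTree.measurableSet_mem_survivors (hT : T.IsTree) {o : V}
    {L : List (Fin n × Bool)} {M R : ℕ} (hM : M ≤ R) (t : ℕ) (z : V) :
    MeasurableSet[ballAlgebra T n o (R + t)] {a | z ∈ survivors o L M R t a} :=
  measurableSet_ballAlgebra_iff.2 fun _ _ hab ha => hT.survivors_of_agreeOn hM hab ha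

variable [T.LocallyFinite]

open Classical in
/-- The descendants of generation `s` of the vertices in `X`. -/
noncomputable def descendants (T : SimpleGraph V) [T.LocallyFinite] (o : V) (X : Finset V) :
    ℕ → Finset V
  | 0 => X
  | s + 1 => (descendants T o X s).biUnion (T.children o)

theorem IsTree.ne_of_mem_descendants (hT : T.IsTree) {o : V} {X : Finset V} (hX : ∀ x ∈ X, x ≠ o)
    {s : ℕ} : ∀ x ∈ descendants T o X s, x ≠ o := by
  cases s with
  | zero => exact hX
  | succ s =>
    intro x hx
    simp only [descendants, Finset.mem_biUnion, hT.mem_children_iff] at hx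
    obtain ⟨_, _, h, _⟩ := hx
    exact h

theorem IsTree.card_descendants (hT : T.IsTree) {d : ℕ} (hreg : T.IsRegularOfDegree d) {o : V}
    {X : Finset V} (hX : ∀ x ∈ X, x ≠ o) (s : ℕ) :
    (descendants T o X s).card = X.card * (d - 1) ^ s := by
  classical
  induction s with
  | zero => simp [descendants]
  | succ s ih =>
    rw [descendants, Finset.card_biUnion, Finset.sum_congr rfl fun x hx =>
      hT.card_children hreg (hT.ne_of_mem_descendants hX x hx), Finset.sum_const, ih,
      smul_eq_mul, pow_succ, mul_assoc]
    intro x _ y _ hxy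
    refine Finset.disjoint_left.2 fun z hz hz' => hxy ?_
    rw [← (hT.mem_children_iff.1 hz).2, (hT.mem_children_iff.1 hz').2]

section Probability

variable {o : V} {L : List (Fin n × Bool)} {d M R : ℕ}
  {μ : Measure (T ≃g T)} [μ.IsMulLeftInvariant]

/-- Given the partial maps on the ball, all descendants of a survivor up to a given generation
survive with a probability that is bounded below. -/
theorem IsTree.measure_le_descendants_survive (hT : T.IsTree) (hreg : T.IsRegularOfDegree d)
    (hμ : μ {a : T ≃g T | a o = o} = 1) (hL : FreeGroup.IsReduced L) (hM : M ≤ R) (s : ℕ) :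
    ∃ c : ℕ, ∀ t J a v, v ∈ survivors o L M R t a → IsIndependent o L M (R + t) J a {v} →
      Measure.pi (fun _ : Fin n => μ) {b | AgreeOn o (R + t) a b} ≤
      c * Measure.pi (fun _ : Fin n => μ) ({b | AgreeOn o (R + t) a b} ∩
        {b | IsIndependent o L M (R + t + s) J b (descendants T o {v} s) ∧
          ∀ x ∈ descendants T o {v} s, x ∈ survivors o L M R (t + s) b}) := by
  classical
  have := hT.countable
  set π := Measure.pi (fun _ : Fin n => μ)
  induction s with
  | zero =>
    refine ⟨1, fun t J a v hv h => ?_⟩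
    rw [Nat.cast_one, one_mul]
    refine measure_mono fun b hb => ⟨hb, h.of_agreeOn (by omega) hb, ?_⟩
    simp only [descendants, Finset.mem_singleton]
    rintro x rfl
    exact hT.survivors_of_agreeOn hM hb hv
  | succ s ih =>
    obtain ⟨c, hc⟩ := ih
    refine ⟨c * ((d - 1) ^ s * (d - 1)).factorial, fun t J a v hv h => ?_⟩
    refine (hc t J a v hv h).trans ?_
    rw [Nat.cast_mul, mul_assoc]
    refine mul_le_mul_right ?_ _
    have hvo : ∀ x ∈ ({v} : Finset V), x ≠ o := by
      simp only [Finset.mem_singleton]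
      rintro x rfl rfl
      have := (hT.isSimplyFixed_of_mem_survivors hv).far
      simp at this
    have hcard := hT.card_descendants hreg hvo s
    rw [Finset.card_singleton, one_mul] at hcard
    set X := descendants T o {v} s with hX
    set E := {b | AgreeOn o (R + t) a b} ∩ {b | IsIndependent o L M (R + t + s) J b X ∧
          ∀ x ∈ X, x ∈ survivors o L M R (t + s) b} with hE
    set G : Set (Fin n → (T ≃g T)) := {b | ∀ x ∈ X, ∀ c ∈ T.children o x, word b L c = c} with hG
    have hEm : MeasurableSet[ballAlgebra T n o (R + t + s)] E := by
      refine measurableSet_ballAlgebra_iff.2 ?_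
      rintro b b' hbb' ⟨h1, h2, h3⟩
      exact ⟨AgreeOn.trans h1 (hbb'.mono (by omega)), h2.of_agreeOn (by omega) hbb', fun x hx =>
        hT.survivors_of_agreeOn hM (by rwa [← add_assoc]) (h3 x hx)⟩
    have hsub : E ∩ G ⊆ {b | AgreeOn o (R + t) a b} ∩
        {b | IsIndependent o L M (R + t + (s + 1)) J b (descendants T o {v} (s + 1)) ∧
          ∀ x ∈ descendants T o {v} (s + 1), x ∈ survivors o L M R (t + (s + 1)) b} := by
      rintro b ⟨⟨h1, h2, h3⟩, h4⟩
      refine ⟨h1, h2.children hT h4, ?_⟩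
      intro y hy
      rw [descendants, Finset.mem_biUnion] at hy
      obtain ⟨x, hx, hy⟩ := hy
      obtain ⟨hyo, hyx⟩ := hT.mem_children_iff.1 hy
      exact ⟨hyo, by rw [hyx]; exact h3 x hx, h4 x hx y hy⟩
    refine le_trans ?_ (mul_le_mul_right (measure_mono hsub) _)
    have hmain := hT.measure_le_of_atoms (ν₁ := π)
      (ν₂ := ((((d - 1) ^ s * (d - 1)).factorial : ℕ) : ℝ≥0∞) • π.restrict G) hEm fun b hb => by
        rw [Measure.smul_apply, Measure.restrict_apply (hT.measurableSet_agreeOn o _ b),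
          smul_eq_mul, ← hcard]
        exact hb.2.1.measure_le_children_fixed hT hreg hμ hL (by omega)
    rwa [Measure.smul_apply, Measure.restrict_apply (hT.ballAlgebra_le o _ _ hEm),
      smul_eq_mul] at hmain

open Classical in
/-- The number of survivors of generation `t`. -/
noncomputable def IsTree.numSurvivors (hT : T.IsTree) (o : V) (L : List (Fin n × Bool))
    (M R t : ℕ) (a : Fin n → (T ≃g T)) : ℕ :=
  ((hT.finite_ball o (R + t)).toFinset.filter fun z => z ∈ survivors o L M R t a).card

theorem IsTree.mem_ball_of_mem_survivors (hT : T.IsTree) {t : ℕ} {a : Fin n → (T ≃g T)} {z : V}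
    (hz : z ∈ survivors o L M R t a) : z ∈ (hT.finite_ball o (R + t)).toFinset := by
  have h := (hT.isSimplyFixed_of_mem_survivors hz).height.1 L.length le_rfl
  rw [word_drop_length_apply] at h
  simpa using h

theorem IsTree.numSurvivors_eq_zero_iff (hT : T.IsTree) {t : ℕ} {a : Fin n → (T ≃g T)} :
    hT.numSurvivors o L M R t a = 0 ↔ survivors o L M R t a = ∅ := by
  classical
  rw [numSurvivors, Finset.card_eq_zero, Finset.filter_eq_empty_iff, Set.eq_empty_iff_forall_notMem]
  exact ⟨fun h z hz => h (hT.mem_ball_of_mem_survivors hz) hz, fun h z _ => h z⟩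

theorem IsTree.numSurvivors_of_agreeOn (hT : T.IsTree) (hM : M ≤ R) {t : ℕ}
    {a b : Fin n → (T ≃g T)} (hab : AgreeOn o (R + t) a b) :
    hT.numSurvivors o L M R t a = hT.numSurvivors o L M R t b := by
  rw [numSurvivors, numSurvivors]
  congr 1
  ext z
  simp only [Finset.mem_filter]
  exact and_congr_right fun _ =>
    ⟨hT.survivors_of_agreeOn hM hab, hT.survivors_of_agreeOn hM hab.symm⟩

theorem IsTree.setLIntegral_numSurvivors (hT : T.IsTree) (hM : M ≤ R) (t : ℕ)
    (π : Measure (Fin n → (T ≃g T))) (E : Set (Fin n → (T ≃g T))) :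
    ∫⁻ a in E, (hT.numSurvivors o L M R t a : ℝ≥0∞) ∂π =
      ∑ z ∈ (hT.finite_ball o (R + t)).toFinset, π (E ∩ {a | z ∈ survivors o L M R t a}) := by
  classical
  have hm : ∀ z : V, MeasurableSet {a : Fin n → (T ≃g T) | z ∈ survivors o L M R t a} := fun z =>
    hT.ballAlgebra_le o _ _ (hT.measurableSet_mem_survivors hM t z)
  have h1 : ∀ a : Fin n → (T ≃g T), (hT.numSurvivors o L M R t a : ℝ≥0∞) =
      ∑ z ∈ (hT.finite_ball o (R + t)).toFinset,
        {a | z ∈ survivors o L M R t a}.indicator (fun _ => (1 : ℝ≥0∞)) a := by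
    intro a
    rw [numSurvivors, Finset.card_filter, Nat.cast_sum]
    refine Finset.sum_congr rfl fun z _ => ?_
    simp [Set.indicator_apply]
  simp only [h1]
  rw [lintegral_finsetSum _ fun z _ => measurable_const.indicator (hm z)]
  refine Finset.sum_congr rfl fun z _ => ?_
  rw [lintegral_indicator_const (hm z), one_mul, Measure.restrict_apply (hm z), Set.inter_comm]

theorem IsTree.lintegral_numSurvivors_succ_le (hT : T.IsTree) (hreg : T.IsRegularOfDegree d)
    (hμ : μ {a : T ≃g T | a o = o} = 1) (hL : FreeGroup.IsReduced L) (hL0 : L ≠ []) (hM : M ≤ R)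
    (t : ℕ) {E : Set (Fin n → (T ≃g T))} (hE : MeasurableSet[ballAlgebra T n o (R + t)] E) :
    ∫⁻ a in E, (hT.numSurvivors o L M R (t + 1) a : ℝ≥0∞) ∂(Measure.pi fun _ : Fin n => μ) ≤
      ∫⁻ a in E, (hT.numSurvivors o L M R t a : ℝ≥0∞) ∂(Measure.pi fun _ : Fin n => μ) := by
  classical
  have := hT.countable
  set π := Measure.pi (fun _ : Fin n => μ)
  rw [hT.setLIntegral_numSurvivors hM t π E]
  have h1 : ∀ v, ∑ c ∈ T.children o v,
      π (E ∩ {a | v ∈ survivors o L M R t a} ∩ {a | word a L c = c}) ≤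
        π (E ∩ {a | v ∈ survivors o L M R t a}) := by
    intro v
    have hE' := MeasurableSet.inter hE (hT.measurableSet_mem_survivors (L := L) hM t v)
    have hmain := hT.measure_le_of_atoms
      (ν₁ := ∑ c ∈ T.children o v, π.restrict {a | word a L c = c}) (ν₂ := π) hE'
      fun b hb => by
        obtain ⟨J, hJ⟩ := (hT.isSimplyFixed_of_mem_survivors hb.2).exists_isIndependent hL0
        rw [Measure.finsetSum_apply]
        simp only [Measure.restrict_apply (hT.measurableSet_agreeOn o _ b)]
        exact hJ.sum_measure_children_le hT hreg hμ hL (by omega)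
    rw [Measure.finsetSum_apply] at hmain
    simpa only [Measure.restrict_apply (hT.ballAlgebra_le o _ _ hE')] using hmain
  have h2 : ∀ a : Fin n → (T ≃g T), (hT.numSurvivors o L M R (t + 1) a : ℝ≥0∞) ≤
      ∑ v ∈ (hT.finite_ball o (R + t)).toFinset, ∑ c ∈ T.children o v,
        ({a | v ∈ survivors o L M R t a} ∩ {a | word a L c = c}).indicator
          (fun _ => (1 : ℝ≥0∞)) a := by
    intro a
    have h3 : hT.numSurvivors o L M R (t + 1) a ≤
        ∑ v ∈ (hT.finite_ball o (R + t)).toFinset, ((T.children o v).filter fun c =>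
          v ∈ survivors o L M R t a ∧ word a L c = c).card := by
      refine le_trans (Finset.card_le_card ?_) Finset.card_biUnion_le
      intro z hz
      obtain ⟨-, hz1, hz2, hz3⟩ := Finset.mem_filter.1 hz
      refine Finset.mem_biUnion.2 ⟨T.parent o z, hT.mem_ball_of_mem_survivors hz2, ?_⟩
      exact Finset.mem_filter.2 ⟨hT.mem_children_iff.2 ⟨hz1, rfl⟩, hz2, hz3⟩
    refine (Nat.cast_le.2 h3).trans (le_of_eq ?_)
    rw [Nat.cast_sum]
    refine Finset.sum_congr rfl fun v _ => ?_
    rw [Finset.card_filter, Nat.cast_sum]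
    refine Finset.sum_congr rfl fun c _ => ?_
    simp [Set.indicator_apply]
  have hm : ∀ v c, MeasurableSet
      ({a : Fin n → (T ≃g T) | v ∈ survivors o L M R t a} ∩ {a | word a L c = c}) := fun v c =>
    (hT.ballAlgebra_le o _ _ (hT.measurableSet_mem_survivors hM t v)).inter
      (measurableSet_word_eq L c c)
  refine (lintegral_mono h2).trans ?_
  rw [lintegral_finsetSum _ fun v _ => Finset.measurable_sum _ fun c _ =>
    measurable_const.indicator (hm v c)]
  refine Finset.sum_le_sum fun v _ => ?_
  rw [lintegral_finsetSum _ fun c _ => measurable_const.indicator (hm v c)]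
  refine le_trans (le_of_eq (Finset.sum_congr rfl fun c _ => ?_)) (h1 v)
  rw [lintegral_indicator_const (hm v c), one_mul, Measure.restrict_apply (hm v c),
    Set.inter_comm, Set.inter_assoc]

theorem IsTree.lintegral_numSurvivors_zero_ne_top (hT : T.IsTree)
    (hμ : μ {a : T ≃g T | a o = o} = 1) :
    ∫⁻ a, (hT.numSurvivors o L M R 0 a : ℝ≥0∞) ∂(Measure.pi fun _ : Fin n => μ) ≠ ∞ := by
  classical
  have := hT.countable
  have := hT.sigmaFinite_aut hμ
  let C : Set (Fin n → (T ≃g T)) := Set.univ.pi fun _ => {a | T.dist o (a o) ≤ M}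
  let B := (hT.finite_ball o (R + 0)).toFinset
  have h1 : ∀ a : Fin n → (T ≃g T), (hT.numSurvivors o L M R 0 a : ℝ≥0∞) ≤
      C.indicator (fun _ => (B.card : ℝ≥0∞)) a := by
    intro a
    by_cases ha : a ∈ C
    · rw [Set.indicator_of_mem ha]
      exact Nat.cast_le.2 (Finset.card_filter_le _ _)
    · rw [Set.indicator_of_notMem ha, nonpos_iff_eq_zero, Nat.cast_eq_zero,
        hT.numSurvivors_eq_zero_iff]
      refine Set.eq_empty_iff_forall_notMem.2 fun z hz => ha fun i _ => ?_
      exact IsSimplyFixed.dist_le hz i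
  have hfin : μ {a | T.dist o (a o) ≤ M} ≠ ∞ := by
    refine ne_of_lt (lt_of_le_of_lt (measure_mono (t := ⋃ u ∈ (hT.finite_ball o M).toFinset,
      {a : T ≃g T | a o = u}) fun a ha => ?_) ?_)
    · exact Set.mem_biUnion (x := a o) (by simpa using ha) rfl
    · refine lt_of_le_of_lt (measure_biUnion_finset_le _ _) ?_
      exact ENNReal.sum_lt_top.2 fun u _ =>
        (measure_apply_eq_le_one hμ u).trans_lt ENNReal.one_lt_top
  refine ne_of_lt (lt_of_le_of_lt (lintegral_mono h1) (lt_of_le_of_lt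
    (lintegral_indicator_const_le _ _) ?_))
  rw [Measure.pi_pi]
  exact ENNReal.mul_lt_top (ENNReal.natCast_lt_top _)
    (ENNReal.prod_lt_top fun i _ => hfin.lt_top)

/-- Almost surely the descendants of simply fixed vertices of any given height die out. -/
theorem IsTree.ae_exists_survivors_eq_empty (hT : T.IsTree) (hreg : T.IsRegularOfDegree d)
    (hd : 3 ≤ d) (hμ : μ {a : T ≃g T | a o = o} = 1) (hL : FreeGroup.IsReduced L) (hL0 : L ≠ [])
    (hM : M ≤ R) :
    ∀ᵐ a ∂(Measure.pi fun _ : Fin n => μ), ∃ t, survivors o L M R t a = ∅ := by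
  classical
  have := hT.countable
  have key := ae_exists_eq_zero_of_growth (Measure.pi fun _ : Fin n => μ)
    (fun t => ballAlgebra T n o (R + t))
    (fun t t' h => ballAlgebra_mono o (Nat.add_le_add_left h R)) (fun t => hT.ballAlgebra_le o _)
    (hT.numSurvivors o L M R) (fun t S _ => ?_) (hT.lintegral_numSurvivors_zero_ne_top hμ)
    (fun t E hE => hT.lintegral_numSurvivors_succ_le hreg hμ hL hL0 hM t hE) ?_
  · simpa only [hT.numSurvivors_eq_zero_iff] using key
  · refine measurableSet_ballAlgebra_iff.2 fun a b hab ha => ?_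
    rw [Set.mem_preimage] at *
    rwa [← hT.numSurvivors_of_agreeOn hM hab]
  · intro lam
    obtain ⟨c, hc⟩ := hT.measure_le_descendants_survive hreg hμ hL hM lam
    refine ⟨lam, c, fun t E hE hne => ?_⟩
    have hEm := hT.ballAlgebra_le o _ _ hE
    have hmain := hT.measure_le_of_atoms (ν₁ := Measure.pi fun _ : Fin n => μ)
      (ν₂ := (c : ℝ≥0∞) • (Measure.pi fun _ : Fin n => μ).restrict
        {b | lam ≤ hT.numSurvivors o L M R (t + lam) b}) hE fun a ha => by
        have h0 := hne a ha
        rw [Ne, hT.numSurvivors_eq_zero_iff, ← Ne, ← Set.nonempty_iff_ne_empty] at h0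
        obtain ⟨v, hv⟩ := h0
        obtain ⟨J, hJ⟩ := (hT.isSimplyFixed_of_mem_survivors hv).exists_isIndependent hL0
        rw [Measure.smul_apply, Measure.restrict_apply (hT.measurableSet_agreeOn o _ a),
          smul_eq_mul]
        refine (hc t J a v hv hJ).trans (mul_le_mul_right (measure_mono ?_) _)
        rintro b ⟨hb1, -, hb2⟩
        refine ⟨hb1, ?_⟩
        have hvo : ∀ x ∈ ({v} : Finset V), x ≠ o := by
          simp only [Finset.mem_singleton]
          rintro x rfl rfl
          have := (hT.isSimplyFixed_of_mem_survivors hv).far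
          simp at this
        have hcard := hT.card_descendants hreg hvo lam
        rw [Finset.card_singleton, one_mul] at hcard
        have h2 : lam ≤ (d - 1) ^ lam :=
          Nat.lt_two_pow_self.le.trans (Nat.pow_le_pow_left (by omega) lam)
        refine h2.trans (hcard ▸ Finset.card_le_card fun x hx => Finset.mem_filter.2 ?_)
        exact ⟨by simpa only [add_assoc] using hT.mem_ball_of_mem_survivors (hb2 x hx), hb2 x hx⟩
    rwa [Measure.smul_apply, Measure.restrict_apply hEm, smul_eq_mul] at hmain

end Probability

end SimpleGraph

namespace SimpleGraph

variable {V : Type*} {T : SimpleGraph V} {n : ℕ}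

theorem exists_hasHeight (o : V) (L : List (Fin n × Bool)) (a : Fin n → (T ≃g T)) (v : V) :
    ∃ N, HasHeight o L N a v := by
  obtain ⟨m, hm, h⟩ := Finset.exists_max_image (Finset.range (L.length + 1))
    (fun m => T.dist o (word a (L.drop m) v)) ⟨0, by simp⟩
  simp only [Finset.mem_range, Nat.lt_succ_iff] at hm h
  exact ⟨_, h, m, hm, rfl⟩

/-- If a word has infinitely many fixed vertices and almost all of them have simple paths, then
there are survivors of all generations. -/
theorem IsTree.survivors_nonempty [T.LocallyFinite] (hT : T.IsTree) {o : V}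
    {L : List (Fin n × Bool)} {M S : ℕ}
    {a : Fin n → (T ≃g T)} (ha : ∀ i, T.dist o (a i o) ≤ M)
    (hinf : {v | word a L v = v}.Infinite) (hS : L.length * M < S)
    (hinj : ∀ v, word a L v = v → S ≤ T.dist o v → ∀ m m', 1 ≤ m → m ≤ L.length → 1 ≤ m' →
      m' ≤ L.length → word a (L.drop m) v = word a (L.drop m') v → m = m') (t : ℕ) :
    (survivors o L M (S + L.length * M) t a).Nonempty := by
  set R := S + L.length * M with hR
  have hparent : ∀ z, word a L z = z → S ≤ T.dist o z → z ≠ o ∧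
      word a L (T.parent o z) = T.parent o z := by
    intro z hz hSz
    have h1 := hT.parent_word_drop ha L 0 (hS.trans_le hSz)
    rw [List.drop_zero, hz] at h1
    exact ⟨h1.1, h1.2.1.symm⟩
  have hfar : ∀ N z, HasHeight o L N a z → N ≤ L.length * M + T.dist o z := by
    rintro N z ⟨-, m, hm, rfl⟩
    refine (hT.dist_word_le ha _ z).trans (Nat.add_le_add_right (Nat.mul_le_mul_right M ?_) _)
    simp
  have hmem : ∀ t z, word a L z = z → HasHeight o L (R + t) a z →
      z ∈ survivors o L M R t a := by
    intro t
    induction t with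
    | zero =>
      intro z hz hh
      have h1 := hfar _ _ hh
      exact ⟨ha, by omega, hz, hinj z hz (by omega), hh⟩
    | succ t ih =>
      intro z hz hh
      have h1 := hfar _ _ hh
      obtain ⟨h2, h3⟩ := hparent z hz (by omega)
      refine ⟨h2, ih _ h3 ?_, hz⟩
      exact (hT.hasHeight_succ_iff ha L (by omega)).1 hh
  have hdesc : ∀ s z, word a L z = z → HasHeight o L (R + t + s) a z →
      ∃ z, word a L z = z ∧ HasHeight o L (R + t) a z := by
    intro s
    induction s with
    | zero => exact fun z hz hh => ⟨z, hz, hh⟩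
    | succ s ih =>
      intro z hz hh
      have h1 := hfar _ _ hh
      exact ih _ (hparent z hz (by omega)).2 ((hT.hasHeight_succ_iff ha L (by omega)).1 hh)
  obtain ⟨z, hz, hzd⟩ := hinf.exists_notMem_finite (hT.finite_ball o (R + t))
  rw [Set.mem_ofPred_eq] at hz hzd
  obtain ⟨N, hN⟩ := exists_hasHeight o L a z
  have h1 := hN.1 L.length le_rfl
  rw [word_drop_length_apply] at h1
  obtain ⟨s, rfl⟩ := Nat.exists_eq_add_of_le (show R + t ≤ N by omega)
  obtain ⟨z', hz', hh'⟩ := hdesc s z hz hN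
  exact ⟨z', hmem t z' hz' hh'⟩

/-- The fixed vertices of a word whose path is not simple are images of fixed vertices of shorter
words. -/
theorem finite_not_simple {a : Fin n → (T ≃g T)} {L : List (Fin n × Bool)}
    (h : ∀ L', L' ≠ [] → L' <:+: L → L'.length < L.length → {v | word a L' v = v}.Finite) :
    {v | ∃ m m', 1 ≤ m ∧ m < m' ∧ m' ≤ L.length ∧
      word a (L.drop m) v = word a (L.drop m') v}.Finite := by
  have hsub : {v | ∃ m m', 1 ≤ m ∧ m < m' ∧ m' ≤ L.length ∧
      word a (L.drop m) v = word a (L.drop m') v} ⊆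
      ⋃ p ∈ {p : ℕ × ℕ | 1 ≤ p.1 ∧ p.1 < p.2 ∧ p.2 ≤ L.length},
        word a (L.drop p.2) ⁻¹' {v | word a ((L.drop p.1).take (p.2 - p.1)) v = v} := by
    rintro v ⟨m, m', h1, h2, h3, h4⟩
    refine Set.mem_biUnion (x := (m, m')) ⟨h1, h2, h3⟩ ?_
    have h5 : L.drop m = (L.drop m).take (m' - m) ++ L.drop m' := by
      conv_lhs => rw [← List.take_append_drop (m' - m) (L.drop m)]
      rw [List.drop_drop, Nat.add_sub_cancel' h2.le]
    rw [h5, word_append_apply] at h4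
    exact h4
  refine Set.Finite.subset (Set.Finite.biUnion ?_ ?_) hsub
  · refine ((Set.finite_Iic L.length).prod (Set.finite_Iic L.length)).subset ?_
    rintro ⟨m, m'⟩ ⟨h1, h2, h3⟩
    exact ⟨h2.le.trans h3, h3⟩
  · rintro ⟨m, m'⟩ ⟨h1, h2, h3⟩
    simp only at h1 h2 h3
    have hlen : ((L.drop m).take (m' - m)).length = m' - m := by
      rw [List.length_take, List.length_drop]
      omega
    refine Set.Finite.preimage (word a (L.drop m')).injective.injOn (h _ ?_ ?_ ?_)
    · intro h0
      rw [h0, List.length_nil] at hlen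
      omega
    · exact (List.take_prefix _ _).isInfix.trans (List.drop_suffix _ _).isInfix
    · simp only [hlen]
      omega

/-- Almost surely a reduced word has only finitely many fixed vertices. -/
theorem IsTree.ae_finite_fixed [T.LocallyFinite] (hT : T.IsTree) {d : ℕ}
    (hreg : T.IsRegularOfDegree d) (hd : 3 ≤ d) {μ : Measure (T ≃g T)} [μ.IsMulLeftInvariant]
    {o : V} (hμ : μ {a : T ≃g T | a o = o} = 1) {L : List (Fin n × Bool)}
    (hL : FreeGroup.IsReduced L) (hL0 : L ≠ []) :
    ∀ᵐ a ∂(Measure.pi fun _ : Fin n => μ), {v | word a L v = v}.Finite := by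
  induction hlen : L.length using Nat.strong_induction_on generalizing L with
  | _ len ih =>
    have h1 : ∀ᵐ a ∂(Measure.pi fun _ : Fin n => μ), ∀ L', L' ≠ [] → L' <:+: L →
        L'.length < L.length → {v | word a L' v = v}.Finite := by
      refine ae_all_iff.2 fun L' => ?_
      by_cases h : L' ≠ [] ∧ L' <:+: L ∧ L'.length < L.length
      · filter_upwards [ih L'.length (hlen ▸ h.2.2) (hL.infix h.2.1) h.1 rfl] with a ha _ _ _
        exact ha
      · exact Filter.Eventually.of_forall fun a h2 h3 h4 => absurd ⟨h2, h3, h4⟩ h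
    have h2 : ∀ᵐ a ∂(Measure.pi fun _ : Fin n => μ), ∀ M R, M ≤ R →
        ∃ t, survivors o L M R t a = ∅ := by
      refine ae_all_iff.2 fun M => ae_all_iff.2 fun R => ?_
      by_cases h : M ≤ R
      · filter_upwards [hT.ae_exists_survivors_eq_empty hreg hd hμ hL hL0 h] with a ha _
        exact ha
      · exact Filter.Eventually.of_forall fun a h3 => absurd h3 h
    filter_upwards [h1, h2] with a ha1 ha2
    by_contra hinf
    obtain ⟨M, hM⟩ : ∃ M, ∀ i, T.dist o (a i o) ≤ M :=
      ⟨Finset.univ.sup fun i => T.dist o (a i o), fun i =>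
        Finset.le_sup (f := fun i => T.dist o (a i o)) (Finset.mem_univ i)⟩
    obtain ⟨K, hK⟩ := ((finite_not_simple ha1).image (T.dist o)).bddAbove
    have hinj : ∀ v, word a L v = v → max (K + 1) (L.length * M + 1) ≤ T.dist o v →
        ∀ m m', 1 ≤ m → m ≤ L.length → 1 ≤ m' → m' ≤ L.length →
          word a (L.drop m) v = word a (L.drop m') v → m = m' := by
      intro v _ hv m m' h3 h4 h5 h6 h7
      have hnot : ∀ m m', 1 ≤ m → m < m' → m' ≤ L.length →
          word a (L.drop m) v ≠ word a (L.drop m') v := fun m m' h3 h4 h5 h6 => by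
        have : T.dist o v ≤ K := hK ⟨v, ⟨m, m', h3, h4, h5, h6⟩, rfl⟩
        omega
      rcases lt_trichotomy m m' with h | h | h
      · exact absurd h7 (hnot m m' h3 h h6)
      · exact h
      · exact absurd h7.symm (hnot m' m h5 h h4)
    have hpos := List.length_pos_of_ne_nil hL0
    obtain ⟨t, ht⟩ := ha2 M (max (K + 1) (L.length * M + 1) + L.length * M)
      ((Nat.le_mul_of_pos_left M hpos).trans (Nat.le_add_left _ _))
    have hne := hT.survivors_nonempty hM hinf (by omega) hinj t
    rw [ht] at hne
    exact Set.not_nonempty_empty hne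

theorem IsTree.infinite_of_isRegularOfDegree [T.LocallyFinite] (hT : T.IsTree) {d : ℕ}
    (hreg : T.IsRegularOfDegree d) (hd : 3 ≤ d) : Infinite V := by
  obtain ⟨o⟩ := hT.1.nonempty
  have key : ∀ N, ∃ x, T.dist o x = N + 1 := by
    intro N
    induction N with
    | zero =>
      have h : 0 < (T.neighborFinset o).card := by
        rw [card_neighborFinset_eq_degree, hreg o]
        omega
      obtain ⟨x, hx⟩ := Finset.card_pos.1 h
      exact ⟨x, dist_eq_one_iff_adj.2 (by simpa using hx)⟩
    | succ N ih =>
      obtain ⟨x, hx⟩ := ih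
      have hxo : x ≠ o := by rintro rfl; simp at hx
      have h : 0 < (T.children o x).card := by
        rw [hT.card_children hreg hxo]
        omega
      obtain ⟨y, hy⟩ := Finset.card_pos.1 h
      exact ⟨y, by rw [(mem_children.1 hy).2, hx]⟩
  choose x hx using key
  exact Infinite.of_injective x fun N N' h => by
    have := hx N
    rw [h, hx N'] at this
    omega

end SimpleGraph

theorem random_subgroup_free_and_almost_free {V : Type*} (T : SimpleGraph V) [T.LocallyFinite]
    (d : ℕ) (hd : 3 ≤ d) (hT : T.IsTree) (hreg : T.IsRegularOfDegree d)
    (μ : Measure (T ≃g T)) [μ.IsHaarMeasure]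
    (hμ : ∀ v : V, μ {a : T ≃g T | a v = v} = 1) (n : ℕ) :
    ∀ᵐ a ∂(Measure.pi fun _ : Fin n => μ),
      IsFreeOfRank (Subgroup.closure (Set.range a)) n ∧
        SimpleGraph.ActsAlmostFreely (Subgroup.closure (Set.range a)) := by
  obtain ⟨o⟩ := hT.1.nonempty
  have hV := hT.infinite_of_isRegularOfDegree hreg hd
  have hfix : ∀ᵐ a ∂(Measure.pi fun _ : Fin n => μ), ∀ w : FreeGroup (Fin n), w ≠ 1 →
      {v | (FreeGroup.lift a w : T ≃g T) v = v}.Finite := by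
    have : Countable (FreeGroup (Fin n)) := FreeGroup.toWord_injective.countable
    refine ae_all_iff.2 fun w => ?_
    by_cases hw : w = 1
    · exact Filter.Eventually.of_forall fun a h => absurd hw h
    · filter_upwards [hT.ae_finite_fixed hreg hd (hμ o) (FreeGroup.isReduced_toWord (x := w))
        (by rwa [Ne, FreeGroup.toWord_eq_nil_iff])] with a ha _
      have h : FreeGroup.lift a w = SimpleGraph.word a w.toWord := by
        conv_lhs => rw [← FreeGroup.mk_toWord (x := w), FreeGroup.lift_mk]
        rfl
      rw [h]
      exact ha
  filter_upwards [hfix] with a ha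
  have hrange : (FreeGroup.lift a).range = Subgroup.closure (Set.range a) :=
    FreeGroup.range_lift_eq_closure
  refine ⟨?_, ?_⟩
  · have hinj : Function.Injective (FreeGroup.lift a) := by
      refine (injective_iff_map_eq_one _).2 fun w hw => ?_
      by_contra hne
      refine Set.infinite_univ (α := V) ((ha w hne).subset fun v _ => ?_)
      rw [Set.mem_ofPred_eq, hw]
      rfl
    rw [← hrange]
    exact ⟨⟨(MonoidHom.ofInjective hinj).symm⟩⟩
  · intro γ hγ hne
    rw [← hrange] at hγ
    obtain ⟨w, rfl⟩ := hγ
    exact ha w fun hw => hne (by rw [hw, map_one])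
end

section
/- Let $S$ be a locally finite rooted tree (every vertex has finitely many children) that is spherically homogeneous (any two vertices at the same distance from the root have the same number of children). Assume that $S$ is either finite or has infinitely many levels on which the vertices have at least two children each. Let $\mathrm{Aut}(S)$ be the group of root-preserving automorphisms of $S$, a compact group in the topology of pointwise convergence, with its Haar probability measure. Then a Haar-random element $a \in \mathrm{Aut}(S)$ almost surely has only finitely many fixed vertices in $S$. -/
namespace RootedTree

variable {V : Type*}

/-- The topology of pointwise convergence on the automorphism group of a graph: the coarsest
topology for which `a ↦ (v ↦ a v)` is continuous into `V → V`, where `V` is discrete. -/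
instance autTopology (S : SimpleGraph V) : TopologicalSpace (S ≃g S) :=
  TopologicalSpace.induced (fun a : S ≃g S => (a : V → V))
    (@Pi.topologicalSpace V (fun _ => V) (fun _ => ⊥))

/-- The Borel σ-algebra of the topology of pointwise convergence. -/
instance autMeasurableSpace (S : SimpleGraph V) : MeasurableSpace (S ≃g S) := borel _

instance autBorelSpace (S : SimpleGraph V) : BorelSpace (S ≃g S) := ⟨rfl⟩

/-- The group of root-preserving automorphisms of `S`. As a subgroup of the full automorphism
group it carries the topology of pointwise convergence and its Borel σ-algebra. -/
def rootedAut (S : SimpleGraph V) (root : V) : Subgroup (S ≃g S) where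
  carrier := {a | a root = root}
  one_mem' := rfl
  mul_mem' := by
    intro a b ha hb
    have ha' : a root = root := ha
    have hb' : b root = root := hb
    change a (b root) = root
    rw [hb', ha']
  inv_mem' := by
    intro a ha
    have ha' : a root = root := ha
    change a.symm root = root
    rw [RelIso.symm_apply_eq, ha']

/-- The children of a vertex `v` in the tree `S` rooted at `root`. -/
def children (S : SimpleGraph V) (root v : V) : Set V :=
  {w | S.Adj v w ∧ S.dist root w = S.dist root v + 1}

/-- Every vertex has finitely many children. -/
def IsLocallyFinite (S : SimpleGraph V) (root : V) : Prop :=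
  ∀ v, (children S root v).Finite

/-- Vertices at the same distance from the root have the same number of children. -/
def IsSphericallyHomogeneous (S : SimpleGraph V) (root : V) : Prop :=
  ∀ u v, S.dist root u = S.dist root v →
    (children S root u).ncard = (children S root v).ncard

/-- There are arbitrarily deep vertices with at least two children. -/
def BranchesInfinitelyOften (S : SimpleGraph V) (root : V) : Prop :=
  ∀ n : ℕ, ∃ v, n ≤ S.dist root v ∧ 2 ≤ (children S root v).ncard

theorem isOpen_eval (S : SimpleGraph V) (v w : V) : IsOpen {a : S ≃g S | a v = w} := by
  let _ : TopologicalSpace V := ⊥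
  have : DiscreteTopology V := ⟨rfl⟩
  have h : Continuous (fun a : S ≃g S => a v) :=
    (continuous_apply (A := fun _ : V => V) v).comp continuous_induced_dom
  exact (isOpen_discrete ({w} : Set V)).preimage h

theorem continuous_of_eval {X : Type*} [TopologicalSpace X] (S : SimpleGraph V)
    (f : X → (S ≃g S)) (hf : ∀ v x₀, ∀ᶠ x in nhds x₀, f x v = f x₀ v) : Continuous f := by
  let _ : TopologicalSpace V := ⊥
  have : DiscreteTopology V := ⟨rfl⟩
  rw [continuous_induced_rng, continuous_pi_iff]
  intro v
  rw [continuous_iff_continuousAt]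
  intro x₀
  have : Filter.Tendsto (fun x => f x v) (nhds x₀) (nhds (f x₀ v)) := by
    rw [nhds_discrete V, Filter.tendsto_pure]
    exact hf v x₀
  exact this

instance autTopologicalGroup (S : SimpleGraph V) : IsTopologicalGroup (S ≃g S) where
  continuous_mul := by
    apply continuous_of_eval
    rintro v ⟨a, b⟩
    have h1 := (isOpen_eval S (b v) (a (b v))).mem_nhds (show a ∈ _ from rfl)
    have h2 := (isOpen_eval S v (b v)).mem_nhds (show b ∈ _ from rfl)
    filter_upwards [prod_mem_nhds h1 h2]
    rintro ⟨a', b'⟩ ⟨ha, hb⟩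
    change a' (b' v) = a (b v)
    have hb' : b' v = b v := hb
    rw [hb']; exact ha
  continuous_inv := by
    apply continuous_of_eval
    intro v a
    have h1 := (isOpen_eval S (a.symm v) v).mem_nhds
      (show a ∈ {a : S ≃g S | a _ = v} from a.apply_symm_apply v)
    filter_upwards [h1] with b hb
    change b.symm v = a.symm v
    rw [RelIso.symm_apply_eq]; exact hb.symm

theorem dist_le_iso (S : SimpleGraph V) (hS : S.Connected) (a : S ≃g S) (u v : V) :
    S.dist (a u) (a v) ≤ S.dist u v := by
  obtain ⟨p, hp⟩ := hS.exists_walk_length_eq_dist u v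
  rw [← hp, ← SimpleGraph.Walk.length_map a.toHom p]
  exact SimpleGraph.dist_le _

theorem level_finite (S : SimpleGraph V) (root : V) (hS : S.Connected)
    (hl : IsLocallyFinite S root) (n : ℕ) : {v | S.dist root v = n}.Finite := by
  induction n with
  | zero =>
    refine (Set.finite_singleton root).subset fun v hv => ?_
    exact ((hS.dist_eq_zero_iff).1 hv).symm
  | succ n ih =>
    refine (ih.biUnion fun v _ => hl v).subset fun w hw => ?_
    have hw' : S.dist root w = n + 1 := hw
    obtain ⟨p, hp⟩ := hS.exists_walk_length_eq_dist w root
    rw [SimpleGraph.dist_comm, hw'] at hp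
    cases p with
    | nil => simp at hp
    | cons h p =>
      rename_i u
      have h1 : S.dist root u ≤ n := by
        rw [SimpleGraph.dist_comm]
        refine (SimpleGraph.dist_le p).trans ?_
        simp at hp; omega
      have h2 := hS.dist_triangle (u := root) (v := u) (w := w)
      have h3 : S.dist u w = 1 := SimpleGraph.dist_eq_one_iff_adj.2 h.symm
      have : S.dist root u = n := by omega
      simp only [Set.mem_iUnion]
      exact ⟨u, this, h.symm, by omega⟩

/-- The group of root-preserving automorphisms is compact. -/
theorem compactSpace_rootedAut (S : SimpleGraph V) (root : V) (hS : S.Connected)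
    (hl : IsLocallyFinite S root) : CompactSpace (rootedAut S root) := by
  let _ : TopologicalSpace V := ⊥
  have : DiscreteTopology V := ⟨rfl⟩
  let ι : rootedAut S root → V → V := fun a => ((a : S ≃g S) : V → V)
  have hι : Topology.IsInducing ι :=
    (Topology.IsInducing.mk rfl : Topology.IsInducing (fun a : S ≃g S => (a : V → V))).comp
      Topology.IsInducing.subtypeVal
  have hK : IsCompact (Set.univ.pi fun v => {w | S.dist root w = S.dist root v}) :=
    isCompact_univ_pi fun v => (level_finite S root hS hl _).isCompact
  have hr : Set.range ι = (Set.univ.pi fun v => {w | S.dist root w = S.dist root v}) ∩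
      ⋂ u, ⋂ v, {f | (f u = f v → u = v) ∧ (S.Adj (f u) (f v) ↔ S.Adj u v)} := by
    ext f
    simp only [Set.mem_inter_iff, Set.mem_iInter, Set.mem_pi, Set.mem_univ, true_imp_iff,
      Set.mem_ofPred_eq, Set.mem_range]
    constructor
    · rintro ⟨a, rfl⟩
      have hr : (a : S ≃g S) root = root := a.2
      refine ⟨fun v => le_antisymm ?_ ?_, fun u v =>
        ⟨fun h => (a : S ≃g S).injective h, (a : S ≃g S).map_rel_iff⟩⟩
      · simpa [hr] using dist_le_iso S hS (a : S ≃g S) root v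
      · have hr' : (a : S ≃g S).symm root = root := by
          rw [RelIso.symm_apply_eq, hr]
        have := dist_le_iso S hS (a : S ≃g S).symm root ((a : S ≃g S) v)
        rwa [hr', RelIso.symm_apply_apply] at this
    · rintro ⟨h1, h2⟩
      have hinj : Function.Injective f := fun u v h => (h2 u v).1 h
      have hsurj : Function.Surjective f := fun w => by
        have hfin := level_finite S root hS hl (S.dist root w)
        have := hfin.to_subtype
        let g : {v | S.dist root v = S.dist root w} → {v | S.dist root v = S.dist root w} :=
          fun v => ⟨f v.1, (h1 v.1).trans v.2⟩
        have hg : Function.Injective g := fun u v h => Subtype.ext (hinj (congrArg Subtype.val h))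
        obtain ⟨v, hv⟩ := (Finite.injective_iff_surjective.1 hg) ⟨w, rfl⟩
        exact ⟨v.1, congrArg Subtype.val hv⟩
      let a : S ≃g S := ⟨Equiv.ofBijective f ⟨hinj, hsurj⟩, fun {u v} => (h2 u v).2⟩
      have ha : a root = root := by
        have := h1 root
        rw [SimpleGraph.dist_self] at this
        exact ((hS.dist_eq_zero_iff).1 this).symm
      exact ⟨⟨a, ha⟩, rfl⟩
  rw [← isCompact_univ_iff, hι.isCompact_iff, Set.image_univ, hr]
  refine hK.inter_right (isClosed_iInter fun u => isClosed_iInter fun v => ?_)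
  exact (isClosed_discrete {p : V × V | (p.1 = p.2 → u = v) ∧ (S.Adj p.1 p.2 ↔ S.Adj u v)}).preimage
    (((continuous_apply u).prodMk (continuous_apply v)) : Continuous fun f : V → V => (f u, f v))

/-- Existence of the Haar probability measure. -/
theorem exists_haar (S : SimpleGraph V) (root : V) (hS : S.Connected)
    (hl : IsLocallyFinite S root) :
    ∃ ν : MeasureTheory.Measure (rootedAut S root), ν.IsHaarMeasure ∧
      MeasureTheory.IsProbabilityMeasure ν := by
  have := compactSpace_rootedAut S root hS hl
  refine ⟨MeasureTheory.Measure.haarMeasure ⊤, inferInstance, ⟨?_⟩⟩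
  simpa using MeasureTheory.Measure.haarMeasure_self (G := rootedAut S root) (K₀ := ⊤)
end RootedTree

open MeasureTheory Set

open scoped ENNReal

namespace RootedTree

variable {V : Type*} {S : SimpleGraph V} {root : V}

/-- In a tree every vertex has at most one parent. -/
theorem parent_unique (hS : S.IsTree) {u v w : V} (hu : w ∈ children S root u)
    (hv : w ∈ children S root v) : u = v := by
  obtain ⟨p, hp⟩ := hS.connected.exists_walk_length_eq_dist root u
  obtain ⟨q, hq⟩ := hS.connected.exists_walk_length_eq_dist root v
  have h1 : (p.concat hu.1).IsPath := by
    apply SimpleGraph.Walk.isPath_of_length_eq_dist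
    rw [SimpleGraph.Walk.length_concat, hp, hu.2]
  have h2 : (q.concat hv.1).IsPath := by
    apply SimpleGraph.Walk.isPath_of_length_eq_dist
    rw [SimpleGraph.Walk.length_concat, hq, hv.2]
  have h := congrArg (fun r : S.Path root w => (r : S.Walk root w).penultimate)
    ((hS.isAcyclic.subsingleton_path root w).elim ⟨_, h1⟩ ⟨_, h2⟩)
  simpa using h

/-- Every vertex other than the root has a parent. -/
theorem exists_parent (hS : S.Connected) {w : V} (hw : w ≠ root) :
    ∃ u, w ∈ children S root u := by
  obtain ⟨p, hp⟩ := hS.exists_walk_length_eq_dist w root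
  cases p with
  | nil => exact absurd rfl hw
  | cons h p =>
    rename_i u
    have h1 := SimpleGraph.dist_le p
    have h2 := hS.dist_triangle (u := w) (v := u) (w := root)
    have h3 : S.dist w u = 1 := SimpleGraph.dist_eq_one_iff_adj.2 h
    rw [SimpleGraph.Walk.length_cons] at hp
    refine ⟨u, h.symm, ?_⟩
    rw [SimpleGraph.dist_comm (u := root), SimpleGraph.dist_comm (u := root)]
    omega

theorem adj_iff_mem_children (hS : S.IsTree) (u v : V) :
    S.Adj u v ↔ v ∈ children S root u ∨ u ∈ children S root v := by
  constructor
  · intro h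
    rcases hS.dist_eq_dist_add_one_of_adj root h with h' | h'
    · exact Or.inr ⟨h.symm, h'⟩
    · exact Or.inl ⟨h, h'⟩
  · rintro (h | h)
    · exact h.1
    · exact h.1.symm

theorem ne_root_of_mem_children {u w : V} (h : w ∈ children S root u) : w ≠ root := by
  rintro rfl
  have := h.2
  simp at this

theorem dist_root_apply (hS : S.Connected) (a : rootedAut S root) (v : V) :
    S.dist root ((a : S ≃g S) v) = S.dist root v := by
  have hr : (a : S ≃g S) root = root := a.2
  apply le_antisymm
  · simpa [hr] using dist_le_iso S hS (a : S ≃g S) root v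
  · have hr' : (a : S ≃g S).symm root = root := by rw [RelIso.symm_apply_eq, hr]
    have := dist_le_iso S hS (a : S ≃g S).symm root ((a : S ≃g S) v)
    rwa [hr', RelIso.symm_apply_apply] at this

theorem apply_mem_children (hS : S.Connected) (a : rootedAut S root) {u w : V}
    (h : w ∈ children S root u) : (a : S ≃g S) w ∈ children S root ((a : S ≃g S) u) :=
  ⟨(a : S ≃g S).map_rel_iff.2 h.1, by rw [dist_root_apply hS, dist_root_apply hS, h.2]⟩

/-- Automorphisms fixing a vertex fix its parent. -/
theorem apply_parent_eq (hS : S.IsTree) (a : rootedAut S root) {u w : V}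
    (h : w ∈ children S root u) (hw : (a : S ≃g S) w = w) : (a : S ≃g S) u = u := by
  have := apply_mem_children hS.connected a h
  rw [hw] at this
  exact parent_unique hS this h

/-- A map that preserves the root and the parent relation and is injective on the children of
each vertex is an automorphism of a locally finite tree. -/
theorem exists_rootedAut_of_map (hS : S.IsTree) (hl : IsLocallyFinite S root) (f : V → V)
    (hroot : f root = root) (hf : ∀ v, MapsTo f (children S root v) (children S root (f v)))
    (hinj : ∀ v, InjOn f (children S root v)) :
    ∃ a : rootedAut S root, ∀ v, (a : S ≃g S) v = f v := by
  have hdist : ∀ n v, S.dist root v = n → S.dist root (f v) = n := by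
    intro n
    induction n with
    | zero =>
      intro v hv
      obtain rfl := hS.connected.dist_eq_zero_iff.1 hv
      rw [hroot, SimpleGraph.dist_self]
    | succ n ih =>
      intro v hv
      have hne : v ≠ root := by rintro rfl; simp at hv
      obtain ⟨u, hu⟩ := exists_parent hS.connected hne
      have := hu.2
      rw [(hf u hu).2, ih u (by omega)]
  have hinj' : ∀ n u v, S.dist root u = n → f u = f v → u = v := by
    intro n
    induction n with
    | zero =>
      intro u v hu h
      have hv : S.dist root v = 0 := by
        rw [← hdist _ v rfl, ← h, hdist _ u rfl, hu]
      rw [← hS.connected.dist_eq_zero_iff.1 hu, ← hS.connected.dist_eq_zero_iff.1 hv]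
    | succ n ih =>
      intro u v hu h
      have hv : S.dist root v = n + 1 := by
        rw [← hdist _ v rfl, ← h, hdist _ u rfl, hu]
      obtain ⟨u', hu'⟩ := exists_parent hS.connected (w := u) (root := root)
        (by rintro rfl; simp at hu)
      obtain ⟨v', hv'⟩ := exists_parent hS.connected (w := v) (root := root)
        (by rintro rfl; simp at hv)
      have h1 := hf u' hu'
      rw [h] at h1
      have h2 := hu'.2
      have h3 := ih u' v' (by omega) (parent_unique hS h1 (hf v' hv'))
      subst h3
      exact hinj u' hu' hv' h
  have hi : Function.Injective f := fun u v h => hinj' _ u v rfl h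
  have hsurj : Function.Surjective f := fun w => by
    have := (level_finite S root hS.connected hl (S.dist root w)).to_subtype
    let g : {v | S.dist root v = S.dist root w} → {v | S.dist root v = S.dist root w} :=
      fun v => ⟨f v.1, hdist _ v.1 v.2⟩
    have hg : Function.Injective g := fun u v h => Subtype.ext (hi (congrArg Subtype.val h))
    obtain ⟨v, hv⟩ := (Finite.injective_iff_surjective.1 hg) ⟨w, rfl⟩
    exact ⟨v.1, congrArg Subtype.val hv⟩
  have hchild : ∀ u v, f v ∈ children S root (f u) ↔ v ∈ children S root u := by
    refine fun u v => ⟨fun h => ?_, fun h => hf u h⟩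
    have hne : v ≠ root := by
      rintro rfl
      rw [hroot] at h
      exact ne_root_of_mem_children h rfl
    obtain ⟨p, hp⟩ := exists_parent hS.connected hne
    rwa [← hi (parent_unique hS (hf p hp) h)]
  exact ⟨⟨⟨Equiv.ofBijective f ⟨hi, hsurj⟩, fun {u v} => by
    change S.Adj (f u) (f v) ↔ S.Adj u v
    simp only [adj_iff_mem_children (root := root) hS, hchild]⟩, hroot⟩,
    fun _ => rfl⟩

/-- A labelling of the children of each vertex `v` by the natural numbers below `deg n`, where
`n` is the distance of `v` from the root. -/
structure ChildLabelling (S : SimpleGraph V) (root : V) where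
  /-- The number of children of the vertices on a level. -/
  deg : ℕ → ℕ
  /-- The child of a vertex with a given label. -/
  child : V → ℕ → V
  bijOn : ∀ v, BijOn (child v) (Iio (deg (S.dist root v))) (children S root v)

theorem exists_childLabelling (hl : IsLocallyFinite S root)
    (hsph : IsSphericallyHomogeneous S root) :
    ∃ c : ChildLabelling S root, ∀ v, c.deg (S.dist root v) = (children S root v).ncard := by
  classical
  let deg : ℕ → ℕ := fun n =>
    if h : ∃ v, S.dist root v = n then (children S root h.choose).ncard else 0
  have hdeg : ∀ v, deg (S.dist root v) = (children S root v).ncard := by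
    intro v
    have h : ∃ u, S.dist root u = S.dist root v := ⟨v, rfl⟩
    simp only [deg, dif_pos h]
    exact hsph _ _ h.choose_spec
  have hb : ∀ v, ∃ f : ℕ → V, BijOn f (Iio (deg (S.dist root v))) (children S root v) := by
    intro v
    have : Nonempty V := ⟨v⟩
    refine (Set.finite_Iio _).exists_bijOn_of_encard_eq ?_
    rw [hdeg, ← (hl v).cast_ncard_eq, ← (Set.finite_Iio _).cast_ncard_eq, Set.ncard_Iio_nat]
  choose child hchild using hb
  exact ⟨⟨deg, child, hchild⟩, hdeg⟩

namespace ChildLabelling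

variable (c : ChildLabelling S root)

theorem dist_child {v : V} {k : ℕ} (hk : k < c.deg (S.dist root v)) :
    S.dist root (c.child v k) = S.dist root v + 1 :=
  ((c.bijOn v).mapsTo hk).2

theorem exists_eq_child (hS : S.Connected) {w : V} (hw : w ≠ root) :
    ∃ v k, k < c.deg (S.dist root v) ∧ c.child v k = w := by
  obtain ⟨v, hv⟩ := exists_parent hS hw
  obtain ⟨k, hk, h⟩ := (c.bijOn v).surjOn hv
  exact ⟨v, k, hk, h⟩

/-- Any choice of label permutations at all vertices is the portrait of an automorphism. -/
theorem exists_rootedAut_of_portrait (hS : S.IsTree) (hl : IsLocallyFinite S root)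
    (τ : V → ℕ → ℕ)
    (hτ : ∀ v, MapsTo (τ v) (Iio (c.deg (S.dist root v))) (Iio (c.deg (S.dist root v))))
    (hτi : ∀ v, InjOn (τ v) (Iio (c.deg (S.dist root v)))) :
    ∃ a : rootedAut S root, ∀ v k, k < c.deg (S.dist root v) →
      (a : S ≃g S) (c.child v k) = c.child ((a : S ≃g S) v) (τ v k) := by
  classical
  have hpar : ∀ w, ∃ p : V × ℕ, w ≠ root →
      p.2 < c.deg (S.dist root p.1) ∧ c.child p.1 p.2 = w := by
    intro w
    by_cases hw : w = root
    · exact ⟨(root, 0), fun h => absurd hw h⟩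
    · obtain ⟨v, k, h⟩ := c.exists_eq_child hS.connected hw
      exact ⟨(v, k), fun _ => h⟩
  choose p hp using hpar
  have hlt : ∀ w, w ≠ root → S.dist root (p w).1 < S.dist root w := by
    intro w hw
    have h := c.dist_child (hp w hw).1
    rw [(hp w hw).2] at h
    omega
  let wf : WellFounded fun u v : V => S.dist root u < S.dist root v :=
    (measure fun v => S.dist root v).wf
  let f : V → V := wf.fix fun w ih =>
    if hw : w = root then root else c.child (ih (p w).1 (hlt w hw)) (τ (p w).1 (p w).2)
  have hroot : f root = root := by
    simp only [f]
    rw [WellFounded.fix_eq, dif_pos rfl]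
  have hne : ∀ w, w ≠ root → f w = c.child (f (p w).1) (τ (p w).1 (p w).2) := by
    intro w hw
    simp only [f]
    rw [WellFounded.fix_eq, dif_neg hw]
  have hf : ∀ v k, k < c.deg (S.dist root v) → f (c.child v k) = c.child (f v) (τ v k) := by
    intro v k hk
    have hmem := (c.bijOn v).mapsTo hk
    have hw := ne_root_of_mem_children hmem
    obtain ⟨h1, h2⟩ := hp _ hw
    have h3 := (c.bijOn _).mapsTo h1
    rw [h2] at h3
    have hv : (p (c.child v k)).1 = v := parent_unique hS h3 hmem
    rw [hne _ hw]
    rw [hv] at h1 h2 ⊢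
    rw [(c.bijOn v).injOn h1 hk h2]
  have hdist : ∀ n v, S.dist root v = n → S.dist root (f v) = n := by
    intro n
    induction n with
    | zero =>
      intro v hv
      obtain rfl := hS.connected.dist_eq_zero_iff.1 hv
      rw [hroot, SimpleGraph.dist_self]
    | succ n ih =>
      intro v hv
      obtain ⟨u, k, hk, rfl⟩ := c.exists_eq_child hS.connected (w := v) (by rintro rfl; simp at hv)
      rw [c.dist_child hk] at hv
      have hu := ih u (by omega)
      have hk' := hτ u hk
      have hu' : S.dist root (f u) = S.dist root u := by omega
      rw [← hu'] at hk'
      rw [hf u k hk, c.dist_child hk', hu]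
  have hτ' : ∀ v k, k < c.deg (S.dist root v) → τ v k < c.deg (S.dist root (f v)) := by
    intro v k hk
    rw [hdist _ v rfl]
    exact hτ v hk
  obtain ⟨a, ha⟩ := exists_rootedAut_of_map hS hl f hroot
    (fun v w hw => by
      obtain ⟨k, hk, rfl⟩ := (c.bijOn v).surjOn hw
      rw [hf v k hk]
      exact (c.bijOn _).mapsTo (hτ' v k hk))
    (fun v w hw w' hw' h => by
      obtain ⟨k, hk, rfl⟩ := (c.bijOn v).surjOn hw
      obtain ⟨k', hk', rfl⟩ := (c.bijOn v).surjOn hw'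
      rw [hf v k hk, hf v k' hk'] at h
      rw [hτi v hk hk' ((c.bijOn _).injOn (hτ' v k hk) (hτ' v k' hk') h)])
  exact ⟨a, fun v k hk => by rw [ha, ha, hf v k hk]⟩

/-- Permutations of the labels below the vertices of level `n` are realised by an automorphism
that fixes all vertices up to level `n`. -/
theorem exists_rootedAut_of_perm (hS : S.IsTree) (hl : IsLocallyFinite S root) (n : ℕ)
    (h : {v | S.dist root v = n} → Equiv.Perm (Fin (c.deg n))) :
    ∃ a : rootedAut S root, (∀ v, S.dist root v ≤ n → (a : S ≃g S) v = v) ∧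
      ∀ (v : {v | S.dist root v = n}) (k : Fin (c.deg n)),
        (a : S ≃g S) (c.child v k) = c.child v (h v k) := by
  classical
  let τ : V → ℕ → ℕ := fun v k =>
    if hv : S.dist root v = n then if hk : k < c.deg n then h ⟨v, hv⟩ ⟨k, hk⟩ else k else k
  have hτ1 : ∀ (v : {v | S.dist root v = n}) (k : Fin (c.deg n)), τ v k = h v k := by
    intro v k
    have hv : S.dist root v.1 = n := v.2
    simp only [τ, dif_pos hv, dif_pos k.2]
  have hτ2 : ∀ v, S.dist root v ≠ n → ∀ k, τ v k = k := by
    intro v hv k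
    simp only [τ, dif_neg hv]
  obtain ⟨a, ha⟩ := c.exists_rootedAut_of_portrait hS hl τ
    (fun v k hk => by
      by_cases hv : S.dist root v = n
      · rw [hv] at hk ⊢
        rw [hτ1 ⟨v, hv⟩ ⟨k, hk⟩]
        exact (h ⟨v, hv⟩ ⟨k, hk⟩).2
      · rwa [hτ2 v hv])
    (fun v k hk k' hk' e => by
      by_cases hv : S.dist root v = n
      · rw [hv] at hk hk'
        rw [hτ1 ⟨v, hv⟩ ⟨k, hk⟩, hτ1 ⟨v, hv⟩ ⟨k', hk'⟩] at e
        exact congrArg Fin.val ((h ⟨v, hv⟩).injective (Fin.ext e))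
      · rwa [hτ2 v hv, hτ2 v hv] at e)
  have hfix : ∀ m ≤ n, ∀ v, S.dist root v = m → (a : S ≃g S) v = v := by
    intro m
    induction m with
    | zero =>
      intro _ v hv
      obtain rfl := hS.connected.dist_eq_zero_iff.1 hv
      exact a.2
    | succ m ih =>
      intro hm v hv
      obtain ⟨u, k, hk, rfl⟩ := c.exists_eq_child hS.connected (w := v) (by rintro rfl; simp at hv)
      rw [c.dist_child hk] at hv
      rw [ha u k hk, ih (by omega) u (by omega), hτ2 u (by omega)]
  refine ⟨a, fun v hv => hfix _ hv v rfl, fun v k => ?_⟩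
  have hv : S.dist root v.1 = n := v.2
  rw [ha v k (by rw [hv]; exact k.2), hfix n le_rfl v hv, hτ1]

/-- The group of rooted automorphisms is transitive on each level. -/
theorem exists_rootedAut_apply_eq (c : ChildLabelling S root) (hS : S.IsTree) (hl : IsLocallyFinite S root)
    (n : ℕ) : ∀ v w, S.dist root v = n → S.dist root w = n →
      ∃ a : rootedAut S root, (a : S ≃g S) v = w := by
  classical
  induction n with
  | zero =>
    intro v w hv hw
    refine ⟨1, ?_⟩
    rw [← hS.connected.dist_eq_zero_iff.1 hv, ← hS.connected.dist_eq_zero_iff.1 hw]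
    rfl
  | succ n ih =>
    intro v w hv hw
    obtain ⟨v', hv'⟩ := exists_parent hS.connected (w := v) (root := root)
      (by rintro rfl; simp at hv)
    obtain ⟨w', k, hk, rfl⟩ := c.exists_eq_child hS.connected (w := w) (by rintro rfl; simp at hw)
    have h1 := hv'.2
    rw [c.dist_child hk] at hw
    have hw' : S.dist root w' = n := by omega
    obtain ⟨a, ha⟩ := ih v' w' (by omega) hw'
    have h2 := apply_mem_children hS.connected a hv'
    rw [ha] at h2
    obtain ⟨j, hj, hjv⟩ := (c.bijOn w').surjOn h2
    rw [mem_Iio, hw'] at hj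
    rw [hw'] at hk
    obtain ⟨b, -, hb⟩ := c.exists_rootedAut_of_perm hS hl n
      fun _ => Equiv.swap ⟨j, hj⟩ ⟨k, hk⟩
    refine ⟨b * a, ?_⟩
    change (b : S ≃g S) ((a : S ≃g S) v) = _
    have := hb ⟨w', hw'⟩ ⟨j, hj⟩
    rw [Equiv.swap_apply_left] at this
    rw [← hjv]
    exact this

/-- An automorphism that fixes a vertex permutes the labels of its children. -/
theorem exists_perm_of_fixed (hS : S.IsTree) (a : rootedAut S root) {n : ℕ} {v : V}
    (hv : S.dist root v = n) (hav : (a : S ≃g S) v = v) :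
    ∃ σ : Equiv.Perm (Fin (c.deg n)), ∀ k : Fin (c.deg n),
      (a : S ≃g S) (c.child v k) = c.child v (σ k) := by
  have hb := c.bijOn v
  rw [hv] at hb
  have h : ∀ k : Fin (c.deg n), ∃ j : Fin (c.deg n),
      (a : S ≃g S) (c.child v k) = c.child v j := by
    intro k
    have := apply_mem_children hS.connected a (hb.mapsTo k.2)
    rw [hav] at this
    obtain ⟨j, hj, e⟩ := hb.surjOn this
    exact ⟨⟨j, hj⟩, e.symm⟩
  choose σ hσ using h
  have hi : Function.Injective σ := fun k j e => by
    have h1 := hσ k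
    rw [e, ← hσ j] at h1
    exact Fin.ext (hb.injOn k.2 j.2 ((a : S ≃g S).injective h1))
  exact ⟨Equiv.ofBijective σ (Finite.injective_iff_bijective.1 hi), hσ⟩

end ChildLabelling

end RootedTree

/-- For `n ≥ 2` at least a third of the permutations of `n` points are derangements. -/
theorem factorial_le_three_mul_numDerangements (n : ℕ) :
    (n + 2).factorial ≤ 3 * numDerangements (n + 2) := by
  induction n using Nat.twoStepInduction with
  | zero => decide
  | one => decide
  | more n h1 h2 =>
    rw [numDerangements_add_two (n + 2)]
    have e1 : (n + 2 + 2).factorial = (n + 3) * ((n + 2).factorial + (n + 3).factorial) := by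
      simp only [Nat.factorial_succ]
      ring
    rw [e1]
    have := Nat.mul_le_mul_left (n + 3) (Nat.add_le_add h1 h2)
    calc _ ≤ _ := this
      _ = _ := by ring

/-- Right multiplication by `σ` maps the permutations `τ` with `τ * σ` a derangement bijectively
onto the derangements. -/
theorem card_filter_mul_mem_derangements {n : ℕ} (σ : Equiv.Perm (Fin n)) :
    (Finset.univ.filter fun τ : Equiv.Perm (Fin n) => ∀ k, τ (σ k) ≠ k).card =
      numDerangements n := by
  classical
  rw [← card_derangements_fin_eq_numDerangements, ← Fintype.card_subtype]
  exact Fintype.card_congr ((Equiv.mulRight σ).subtypeEquiv fun _ => Iff.rfl)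

/-- If every `a ∈ B` is moved into `D` by at least the fraction `1 / C` of a finite family of left
translations, then `μ B ≤ C * μ D` for every left-invariant measure `μ`. -/
theorem measure_le_mul_of_card_translates {G ι : Type*} [Group G] [MeasurableSpace G]
    [MeasurableMul G] (μ : Measure G) [μ.IsMulLeftInvariant] [Fintype ι] [Nonempty ι]
    (g : ι → G) {B D : Set G} (hB : MeasurableSet B) (hD : MeasurableSet D) (C : ℕ)
    (h : ∀ a ∈ B, ∃ s : Finset ι, (∀ i ∈ s, g i * a ∈ D) ∧ Fintype.card ι ≤ C * s.card) :
    μ B ≤ C * μ D := by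
  classical
  have hm : ∀ i, MeasurableSet ((fun a => g i * a) ⁻¹' D) := fun i => measurable_const_mul _ hD
  have key : (Fintype.card ι : ℝ≥0∞) * μ B ≤ Fintype.card ι * (C * μ D) := by
    calc (Fintype.card ι : ℝ≥0∞) * μ B
        = ∫⁻ a, B.indicator (fun _ => (Fintype.card ι : ℝ≥0∞)) a ∂μ :=
          (lintegral_indicator_const hB _).symm
      _ ≤ ∫⁻ a, C * ∑ i, ((fun a => g i * a) ⁻¹' D).indicator (fun _ => (1 : ℝ≥0∞)) a ∂μ := by
          refine lintegral_mono fun a => ?_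
          refine indicator_le' (s := B) (f := fun _ => (Fintype.card ι : ℝ≥0∞))
            (g := fun a => C * ∑ i, ((fun a => g i * a) ⁻¹' D).indicator (fun _ => (1 : ℝ≥0∞)) a)
            (fun a ha => ?_) (fun _ _ => zero_le) a
          obtain ⟨s, hs, hc⟩ := h a ha
          calc (Fintype.card ι : ℝ≥0∞) ≤ C * s.card := by exact_mod_cast hc
            _ = C * ∑ i ∈ s, ((fun a => g i * a) ⁻¹' D).indicator (fun _ => (1 : ℝ≥0∞)) a := by
                have hone : ∀ i ∈ s,
                    ((fun a => g i * a) ⁻¹' D).indicator (fun _ => (1 : ℝ≥0∞)) a = 1 :=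
                  fun i hi => indicator_of_mem (s := (fun a => g i * a) ⁻¹' D) (hs i hi) _
                rw [Finset.sum_congr rfl hone]
                simp
            _ ≤ _ := by
                gcongr
                exact Finset.subset_univ s
      _ = C * ∑ i, μ ((fun a => g i * a) ⁻¹' D) := by
          rw [lintegral_const_mul' _ _ (ENNReal.natCast_ne_top C), lintegral_finsetSum]
          · simp only [lintegral_indicator_const (hm _), one_mul]
          · exact fun i _ => measurable_const.indicator (hm i)
      _ = Fintype.card ι * (C * μ D) := by
          simp only [measure_preimage_mul, Finset.sum_const, Finset.card_univ, nsmul_eq_mul]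
          ring
  exact (ENNReal.mul_le_mul_iff_right (by simp) (ENNReal.natCast_ne_top _)).1 key

namespace RootedTree

variable {V : Type*} {S : SimpleGraph V} {root : V}

/-- The number of vertices on level `n` that are fixed by an automorphism. -/
noncomputable def numFixed (n : ℕ) (a : rootedAut S root) : ℕ :=
  {v | S.dist root v = n ∧ (a : S ≃g S) v = v}.ncard

theorem measurableSet_eval (v w : V) :
    MeasurableSet {a : rootedAut S root | (a : S ≃g S) v = w} :=
  measurable_subtype_coe (isOpen_eval S v w).measurableSet

theorem numFixed_eq_sum (hS : S.Connected) (hl : IsLocallyFinite S root) (n : ℕ)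
    (a : rootedAut S root) :
    numFixed n a = ∑ v ∈ (level_finite S root hS hl n).toFinset,
      {a : rootedAut S root | (a : S ≃g S) v = v}.indicator (fun _ => 1) a := by
  classical
  simp only [indicator_apply, mem_ofPred_eq, Finset.sum_boole, Nat.cast_id]
  rw [numFixed, ← Set.ncard_coe_finset]
  congr 1
  ext v
  simp

theorem measurable_numFixed (hS : S.Connected) (hl : IsLocallyFinite S root) (n : ℕ) :
    Measurable (numFixed n : rootedAut S root → ℕ) := by
  rw [funext (numFixed_eq_sum hS hl n)]
  exact Finset.measurable_sum _ fun v _ => measurable_const.indicator (measurableSet_eval v v)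

theorem numFixed_eq_zero_iff (hS : S.Connected) (hl : IsLocallyFinite S root) (n : ℕ)
    (a : rootedAut S root) :
    numFixed n a = 0 ↔ ∀ v, S.dist root v = n → (a : S ≃g S) v ≠ v := by
  rw [numFixed, Set.ncard_eq_zero ((level_finite S root hS hl n).subset fun v hv => hv.1),
    Set.eq_empty_iff_forall_notMem]
  simp

theorem numFixed_succ_eq_zero (hS : S.IsTree) (hl : IsLocallyFinite S root) {n : ℕ}
    {a : rootedAut S root} (h : numFixed n a = 0) : numFixed (n + 1) a = 0 := by
  rw [numFixed_eq_zero_iff hS.connected hl] at h ⊢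
  intro v hv hav
  obtain ⟨u, hu⟩ := exists_parent hS.connected (w := v) (root := root)
    (by rintro rfl; simp at hv)
  have := hu.2
  exact h u (by omega) (apply_parent_eq hS a hu hav)

theorem numFixed_eq_zero_of_le (hS : S.IsTree) (hl : IsLocallyFinite S root) {n m : ℕ}
    (hnm : n ≤ m) {a : rootedAut S root} (h : numFixed n a = 0) : numFixed m a = 0 := by
  induction m, hnm using Nat.le_induction with
  | base => exact h
  | succ m _ ih => exact numFixed_succ_eq_zero hS hl ih

theorem finite_fixed_of_numFixed_eq_zero (hS : S.IsTree) (hl : IsLocallyFinite S root) {n : ℕ}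
    {a : rootedAut S root} (h : numFixed n a = 0) : {v : V | (a : S ≃g S) v = v}.Finite := by
  refine ((Set.finite_Iio n).biUnion fun m _ =>
    level_finite S root hS.connected hl m).subset fun v hv => ?_
  simp only [mem_iUnion, mem_Iio]
  refine ⟨S.dist root v, ?_, rfl⟩
  by_contra hlt
  exact (numFixed_eq_zero_iff hS.connected hl _ a).1
    (numFixed_eq_zero_of_le hS hl (not_lt.1 hlt) h) v rfl hv

section Measure

variable (ν : Measure (rootedAut S root)) [ν.IsMulLeftInvariant] [IsProbabilityMeasure ν]

/-- The expected number of fixed vertices on each level is at most one. -/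
theorem lintegral_numFixed_le_one (c : ChildLabelling S root) (hS : S.IsTree)
    (hl : IsLocallyFinite S root) (n : ℕ) :
    ∫⁻ a, (numFixed n a : ℝ≥0∞) ∂ν ≤ 1 := by
  classical
  set L := (level_finite S root hS.connected hl n).toFinset with hL
  have hmem : ∀ v, v ∈ L ↔ S.dist root v = n := fun v => by simp [hL]
  have h1 : ∀ v ∈ L, ν {a | (a : S ≃g S) v = v} ≤ (L.card : ℝ≥0∞)⁻¹ := by
    intro v hv
    rw [ENNReal.le_inv_iff_mul_le, mul_comm]
    have h2 : ∀ w ∈ L, ν {a | (a : S ≃g S) v = w} = ν {a | (a : S ≃g S) v = v} := by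
      intro w hw
      obtain ⟨g, hg⟩ := c.exists_rootedAut_apply_eq hS hl n v w ((hmem v).1 hv) ((hmem w).1 hw)
      rw [← measure_preimage_mul ν g {a | (a : S ≃g S) v = w}]
      congr 1
      ext a
      change (g : S ≃g S) ((a : S ≃g S) v) = w ↔ (a : S ≃g S) v = v
      rw [← hg]
      exact (g : S ≃g S).injective.eq_iff
    calc (L.card : ℝ≥0∞) * ν {a | (a : S ≃g S) v = v}
        = ∑ w ∈ L, ν {a | (a : S ≃g S) v = w} := by
          rw [Finset.sum_congr rfl h2, Finset.sum_const, nsmul_eq_mul]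
      _ = ν (⋃ w ∈ L, {a | (a : S ≃g S) v = w}) := by
          rw [measure_biUnion_finset _ fun w _ => measurableSet_eval v w]
          intro w _ w' _ hne
          rw [Function.onFun, Set.disjoint_left]
          exact fun a (ha : (a : S ≃g S) v = w) (ha' : (a : S ≃g S) v = w') =>
            hne (ha.symm.trans ha')
      _ ≤ 1 := prob_le_one
  calc ∫⁻ a, (numFixed n a : ℝ≥0∞) ∂ν
      = ∫⁻ a, ∑ v ∈ L, {a : rootedAut S root | (a : S ≃g S) v = v}.indicator
          (fun _ => (1 : ℝ≥0∞)) a ∂ν := by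
        refine lintegral_congr fun a => ?_
        rw [numFixed_eq_sum hS.connected hl, Nat.cast_sum]
        refine Finset.sum_congr rfl fun v _ => ?_
        simp only [indicator_apply]
        split_ifs <;> simp
    _ = ∑ v ∈ L, ν {a | (a : S ≃g S) v = v} := by
        rw [lintegral_finsetSum _ fun v _ => measurable_const.indicator (measurableSet_eval v v)]
        simp only [lintegral_indicator_const (measurableSet_eval _ _), one_mul]
    _ ≤ ∑ _v ∈ L, (L.card : ℝ≥0∞)⁻¹ := Finset.sum_le_sum h1
    _ ≤ 1 := by
        rw [Finset.sum_const, nsmul_eq_mul]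
        exact ENNReal.mul_inv_le_one _

/-- Conditionally on having at most `K` fixed vertices on a level whose vertices have at least two
children, no vertex on the next level is fixed with probability at least `3⁻¹ ^ K`. -/
theorem measure_numFixed_le (c : ChildLabelling S root) (hS : S.IsTree)
    (hl : IsLocallyFinite S root) {n : ℕ} (hn : 2 ≤ c.deg n) (K : ℕ) :
    ν {a | numFixed n a ≠ 0 ∧ numFixed n a ≤ K} ≤
      (3 ^ K : ℕ) * ν {a | numFixed n a ≠ 0 ∧ numFixed (n + 1) a = 0} := by
  classical
  have hfin := level_finite S root hS.connected hl n
  have := hfin.fintype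
  choose g hg1 hg2 using c.exists_rootedAut_of_perm hS hl n
  have hX := measurable_numFixed (root := root) hS.connected hl
  refine measure_le_mul_of_card_translates ν g
    (((measurableSet_singleton 0).compl.preimage (hX n)).inter
      (measurableSet_Iic.preimage (hX n)))
    (((measurableSet_singleton 0).compl.preimage (hX n)).inter
      ((measurableSet_singleton 0).preimage (hX (n + 1)))) _ ?_
  rintro a ⟨ha0, haK⟩
  have hσ : ∀ v : {v | S.dist root v = n}, ∃ σ : Equiv.Perm (Fin (c.deg n)),
      (a : S ≃g S) v = v → ∀ k : Fin (c.deg n),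
        (a : S ≃g S) (c.child v k) = c.child v (σ k) := by
    intro v
    by_cases hv : (a : S ≃g S) v = v
    · obtain ⟨σ, h⟩ := c.exists_perm_of_fixed hS a v.2 hv
      exact ⟨σ, fun _ => h⟩
    · exact ⟨1, fun h => absurd h hv⟩
  choose σ hσ using hσ
  let T : {v | S.dist root v = n} → Finset (Equiv.Perm (Fin (c.deg n))) := fun v =>
    if (a : S ≃g S) v = v then Finset.univ.filter fun τ => ∀ k, τ (σ v k) ≠ k else Finset.univ
  refine ⟨Fintype.piFinset T, fun h hh => ⟨?_, ?_⟩, ?_⟩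
  · have : numFixed n (g h * a) = numFixed n a := by
      unfold numFixed
      congr 1
      ext v
      refine and_congr_right fun hv => ?_
      change (g h : S ≃g S) ((a : S ≃g S) v) = v ↔ _
      rw [hg1 h _ (by rw [dist_root_apply hS.connected, hv])]
    change numFixed n (g h * a) ≠ 0
    rw [this]
    exact ha0
  · change numFixed (n + 1) (g h * a) = 0
    rw [numFixed_eq_zero_iff hS.connected hl]
    intro w hw hfix
    obtain ⟨v, k, hk, rfl⟩ := c.exists_eq_child hS.connected (w := w) (by rintro rfl; simp at hw)
    have hv' := apply_parent_eq hS (g h * a) ((c.bijOn v).mapsTo hk) hfix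
    rw [c.dist_child hk] at hw
    have hv : S.dist root v = n := by omega
    have hav : (a : S ≃g S) v = v := by
      change (g h : S ≃g S) ((a : S ≃g S) v) = v at hv'
      rwa [hg1 h _ (by rw [dist_root_apply hS.connected, hv])] at hv'
    have hb := c.bijOn v
    rw [hv] at hk hb
    have hT := Fintype.mem_piFinset.1 hh ⟨v, hv⟩
    simp only [T, if_pos hav, Finset.mem_filter, Finset.mem_univ, true_and] at hT
    refine hT ⟨k, hk⟩ (Fin.ext (hb.injOn (Fin.is_lt _) hk ?_))
    change (g h : S ≃g S) ((a : S ≃g S) (c.child v k)) = c.child v k at hfix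
    have e1 := hσ ⟨v, hv⟩ hav ⟨k, hk⟩
    have e2 := hg2 h ⟨v, hv⟩ (σ ⟨v, hv⟩ ⟨k, hk⟩)
    simp only at e1 e2
    rw [e1, e2] at hfix
    exact hfix
  · have hcard : (Finset.univ.filter fun v : {v | S.dist root v = n} =>
        (a : S ≃g S) v = v).card = numFixed n a := by
      rw [numFixed, ← Set.ncard_coe_finset, ← Set.ncard_image_of_injective _ Subtype.val_injective]
      congr 1
      ext v
      simp only [mem_image, Finset.mem_coe, Finset.mem_filter, Finset.mem_univ, true_and]
      exact ⟨fun ⟨u, hu, e⟩ => e ▸ ⟨u.2, hu⟩, fun h => ⟨⟨v, h.1⟩, h.2, rfl⟩⟩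
    obtain ⟨d, hd⟩ := Nat.exists_eq_add_of_le' hn
    calc Fintype.card ({v | S.dist root v = n} → Equiv.Perm (Fin (c.deg n)))
        = ∏ _v : {v | S.dist root v = n}, (c.deg n).factorial := by
          simp [Fintype.card_perm]
      _ ≤ ∏ v : {v | S.dist root v = n},
            ((if (a : S ≃g S) v = v then 3 else 1) * (T v).card) := by
          refine Finset.prod_le_prod' fun v _ => ?_
          by_cases hv : (a : S ≃g S) v = v
          · simp only [T, if_pos hv, card_filter_mul_mem_derangements]
            rw [hd]
            exact factorial_le_three_mul_numDerangements d
          · simp [T, if_neg hv, Fintype.card_perm]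
      _ = 3 ^ numFixed n a * (Fintype.piFinset T).card := by
          rw [Finset.prod_mul_distrib, Fintype.card_piFinset, Finset.prod_ite, Finset.prod_const,
            Finset.prod_const_one, mul_one, hcard]
      _ ≤ 3 ^ K * (Fintype.piFinset T).card :=
          Nat.mul_le_mul_right _ (Nat.pow_le_pow_right (by norm_num) haK)

/-- Almost surely some level contains no fixed vertex. -/
theorem ae_exists_numFixed_eq_zero (c : ChildLabelling S root) (hS : S.IsTree)
    (hl : IsLocallyFinite S root) (hc : ∀ N, ∃ n, N ≤ n ∧ 2 ≤ c.deg n) :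
    ∀ᵐ a ∂ν, ∃ n, numFixed n a = 0 := by
  have hX := measurable_numFixed (root := root) hS.connected hl
  set D : ℕ → Set (rootedAut S root) := fun n => {a | numFixed n a ≠ 0 ∧ numFixed (n + 1) a = 0}
    with hD
  have hDm : ∀ n, MeasurableSet (D n) := fun n =>
    ((measurableSet_singleton 0).compl.preimage (hX n)).inter
      ((measurableSet_singleton 0).preimage (hX (n + 1)))
  have hlt : ∀ n m, n < m → Disjoint (D n) (D m) := fun n m hnm =>
    Set.disjoint_left.2 fun a ha ha' => ha'.1 (numFixed_eq_zero_of_le hS hl hnm ha.2)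
  have hdisj : Pairwise (Function.onFun Disjoint D) := by
    intro n m hne
    rcases lt_or_gt_of_ne hne with h | h
    · exact hlt n m h
    · exact (hlt m n h).symm
  have hsum : ∑' n, ν (D n) ≠ ∞ := by
    rw [← measure_iUnion hdisj hDm]
    exact measure_ne_top _ _
  have hD0 := ENNReal.tendsto_atTop_zero_of_tsum_ne_top hsum
  rw [ae_iff]
  set A : Set (rootedAut S root) := {a | ¬∃ n, numFixed n a = 0} with hA
  have hbound : ∀ K : ℕ, ν A ≤ ((K + 1 : ℕ) : ℝ≥0∞)⁻¹ := by
    intro K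
    have hlim : Filter.Tendsto (fun n => (3 ^ K : ℕ) * ν (D n) + ((K + 1 : ℕ) : ℝ≥0∞)⁻¹)
        Filter.atTop (nhds ((K + 1 : ℕ) : ℝ≥0∞)⁻¹) := by
      have h := (ENNReal.Tendsto.const_mul hD0
        (Or.inr (ENNReal.natCast_ne_top (3 ^ K)))).add_const ((K + 1 : ℕ) : ℝ≥0∞)⁻¹
      rwa [mul_zero, zero_add] at h
    refine ge_of_tendsto_of_frequently hlim (Filter.frequently_atTop.2 fun N => ?_)
    obtain ⟨n, hNn, hn⟩ := hc N
    refine ⟨n, hNn, ?_⟩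
    have hsub : A ⊆ {a | numFixed n a ≠ 0 ∧ numFixed n a ≤ K} ∪
        {a | ((K + 1 : ℕ) : ℝ≥0∞) ≤ (numFixed n a : ℝ≥0∞)} := by
      intro a ha
      by_cases h : numFixed n a ≤ K
      · exact Or.inl ⟨fun h0 => ha ⟨n, h0⟩, h⟩
      · right
        have : K + 1 ≤ numFixed n a := by omega
        change ((K + 1 : ℕ) : ℝ≥0∞) ≤ (numFixed n a : ℝ≥0∞)
        exact_mod_cast this
    refine (measure_mono hsub).trans ((measure_union_le _ _).trans (add_le_add ?_ ?_))
    · exact measure_numFixed_le ν c hS hl hn K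
    · rw [ENNReal.le_inv_iff_mul_le, mul_comm]
      refine (mul_meas_ge_le_lintegral ?_ _).trans (lintegral_numFixed_le_one ν c hS hl n)
      exact (measurable_from_top (f := fun k : ℕ => (k : ℝ≥0∞))).comp (hX n)
  refine le_antisymm (ge_of_tendsto' (ENNReal.tendsto_inv_nat_nhds_zero.comp
    (Filter.tendsto_add_atTop_nat 1)) hbound) zero_le

end Measure

end RootedTree

theorem haar_random_rooted_automorphism_finitely_many_fixed_points
    {V : Type*} (S : SimpleGraph V) (root : V) (htree : S.IsTree)
    (hlocfin : RootedTree.IsLocallyFinite S root)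
    (hsph : RootedTree.IsSphericallyHomogeneous S root)
    (hbranch : Finite V ∨ RootedTree.BranchesInfinitelyOften S root)
    (ν : MeasureTheory.Measure (RootedTree.rootedAut S root))
    [ν.IsHaarMeasure] [MeasureTheory.IsProbabilityMeasure ν] :
    ∀ᵐ a : RootedTree.rootedAut S root ∂ν, {v : V | (a : S ≃g S) v = v}.Finite := by
  rcases hbranch with hfin | hbranch
  · exact Filter.Eventually.of_forall fun a => Set.toFinite _
  · obtain ⟨c, hc⟩ := RootedTree.exists_childLabelling hlocfin hsph
    filter_upwards [RootedTree.ae_exists_numFixed_eq_zero ν c htree hlocfin fun N => by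
      obtain ⟨v, hv, hv2⟩ := hbranch N
      exact ⟨_, hv, by rwa [hc v]⟩] with a ha
    obtain ⟨n, hn⟩ := ha
    exact RootedTree.finite_fixed_of_numFixed_eq_zero htree hlocfin hn
end

section
/- Let $d\ge 3$, let $T$ be the $d$-regular tree with a base vertex $O$ and graph metric $d(\cdot,\cdot)$, and let $A=\operatorname{Aut}(T)$, acting on $T$ from the right ($y\mapsto y^a$), with the topology of pointwise convergence, its Borel $\sigma$-algebra, and the Haar measure $\mu$ normalized so that vertex stabilizers have measure $1$. A directed edge $e$ is positively oriented if it points away from $O$, that is, if its terminal vertex is farther from $O$ than its origin. Let $\Gamma\le A$ be a countable subgroup acting almost freely, i.e. every nontrivial element of $\Gamma$ fixes only finitely many vertices. Let $t$ be the generator of $\mathbb Z$, and for $a\in A$ and $w\in\Gamma*\mathbb Z$ let $w(a)\in A$ be the image of $w$ under the homomorphism $\Gamma*\mathbb Z\to A$ that is the identity on $\Gamma$ and sends $t$ to $a$. Let $w=w_0w_1\cdots w_n\in\Gamma*\mathbb Z$, $n\ge 0$, be a nontrivial word in canonical form: each $w_i$ is $t$, $t^{-1}$ or a nontrivial element of $\Gamma$;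 no two consecutive $w_i$ are both in $\Gamma$; and no $w_iw_{i+1}$ is $tt^{-1}$ or $t^{-1}t$. Assume that $w$ is cyclically reduced, i.e. not conjugate in $\Gamma*\mathbb Z$ to an element whose canonical form is shorter (equivalently, if $n\ge1$, the last two conditions also hold for the pair $w_n,w_0$). Let $\Omega=\{a\in A: w(a)\text{ fixes }O\}$. The trace under $w(a)$ of a vertex $y$ is the sequence $(y_0,\dots,y_{n+1})$ with $y_0=y$ and $y_{i+1}=y_i^{w_i(a)}$ for $0\le i\le n$, and the trace of a directed edge is defined in the same way; a trace is simple if its entries are distinct, except that the first and the last may be equal. Assume that for almost every $a\in\Omega$, every proper cyclic subword $w_iw_{i+1}\cdots w_{i+k}$ (indices modulo $n+1$, $0\le i\le n$, $0\le k<n$), evaluated at $a$, fixes only finitely many vertices of $T$. Then there exists a measurable function $M:\Omega\to\mathbb N\cup\{\infty\}$, finite almost everywhere, such that for every $a\in\Omega$: 1. every vertex $y$ with $d(y,O)\ge M(a)$ has a simple trace under $w(a)$; 2. for every positively oriented edge $e$ with $d(O,e)\ge M(a)$, all edges $e_0=e,e_1,\dots,e_{n+1}$ in the trace of $e$ under $w(a)$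 are positively oriented. Here $d(O,e)$ is the distance from $O$ to the nearer endpoint of $e$. -/
namespace TreePaper

universe u

variable {V : Type u}

/-- The automorphism group `A = Aut(T)` of a graph, acting on the right: the product `a * b`
means "first `a`, then `b`", so that `y^(ab) = (y^a)^b`. -/
def Aut (G : SimpleGraph V) : Type u := (G ≃g G)ᵐᵒᵖ

instance (G : SimpleGraph V) : Group (Aut G) := inferInstanceAs (Group (G ≃g G)ᵐᵒᵖ)

variable {G : SimpleGraph V}

/-- The underlying graph automorphism of an element of `Aut G`. -/
def Aut.toIso (a : Aut G) : G ≃g G := MulOpposite.unop a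

/-- The image `y^a` of a vertex. -/
def Aut.onVertex (y : V) (a : Aut G) : V := a.toIso y

/-- The image `e^a` of a directed edge. -/
def Aut.onEdge (e : G.Dart) (a : Aut G) : G.Dart := a.toIso.toHom.mapDart e

/-- The topology of pointwise convergence on the (discrete) vertex set. -/
instance : TopologicalSpace (Aut G) :=
  TopologicalSpace.induced (fun a v => Aut.onVertex v a)
    (@Pi.topologicalSpace V (fun _ => V) (fun _ => ⊥))

instance : MeasurableSpace (Aut G) := borel (Aut G)

instance : BorelSpace (Aut G) := ⟨rfl⟩

/-- The set of vertices fixed by `a`. -/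
def fixedVertices (a : Aut G) : Set V := {v | Aut.onVertex v a = v}

/-- `Γ` acts almost freely: every nontrivial element fixes only finitely many vertices. -/
def ActsAlmostFreely (Γ : Subgroup (Aut G)) : Prop :=
  ∀ γ ∈ Γ, γ ≠ 1 → (fixedVertices γ).Finite

/-- The directed edge `e` is positively oriented: it points away from `O`. -/
def IsPositive (O : V) (e : G.Dart) : Prop :=
  G.dist O e.fst < G.dist O e.snd

/-- The distance `d(O, e)` from the vertex `O` to the edge `e`. -/
noncomputable def edgeDist (O : V) (e : G.Dart) : ℕ :=
  min (G.dist O e.fst) (G.dist O e.snd)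

/-- The free product `Γ * ℤ`. -/
abbrev FreeProd (Γ : Subgroup (Aut G)) : Type u := Monoid.Coprod Γ (Multiplicative ℤ)

/-- The letters out of which words are written: an element of `Γ`, `t`, or `t⁻¹`. -/
inductive Letter (Γ : Subgroup (Aut G)) : Type u
  | elem (g : Γ) : Letter Γ
  | t : Letter Γ
  | tInv : Letter Γ

variable {Γ : Subgroup (Aut G)}

/-- The element of `Γ * ℤ` given by a letter. -/
def Letter.toFreeProd : Letter Γ → FreeProd Γ
  | .elem g => Monoid.Coprod.inl g
  | .t => Monoid.Coprod.inr (Multiplicative.ofAdd 1)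
  | .tInv => (Monoid.Coprod.inr (Multiplicative.ofAdd 1))⁻¹

/-- The element of `Γ * ℤ` spelled by a list of letters. -/
def spell (l : List (Letter Γ)) : FreeProd Γ := (l.map Letter.toFreeProd).prod

/-- Two letters may follow each other in a canonical form: they are not both in `Γ`, and
they are not `t t⁻¹` or `t⁻¹ t`. -/
def Letter.CanPrecede : Letter Γ → Letter Γ → Prop
  | .elem _, .elem _ => False
  | .t, .tInv => False
  | .tInv, .t => False
  | _, _ => True

/-- A list of letters is a canonical form (the identity of `Γ` is not used as a letter; the
empty list is the canonical form of `1`). -/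
def IsCanonicalForm (l : List (Letter Γ)) : Prop :=
  (∀ g : Γ, Letter.elem g ∈ l → g ≠ 1) ∧ l.IsChain Letter.CanPrecede

/-- The word `l` is cyclically reduced: the element it spells is not conjugate in `Γ * ℤ` to
an element with a shorter canonical form. -/
def IsCyclicallyReduced (l : List (Letter Γ)) : Prop :=
  ∀ l' : List (Letter Γ), IsCanonicalForm l' → IsConj (spell l') (spell l) →
    l.length ≤ l'.length

/-- The evaluation homomorphism `Γ * ℤ → A` that is the identity on `Γ` and sends `t` to
`a`. -/
def evalHom (a : Aut G) : FreeProd Γ →* Aut G :=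
  Monoid.Coprod.lift Γ.subtype (zpowersHom (Aut G) a)

/-- The value `w(a)` of the word `w = w₀ w₁ ⋯ wₙ`. -/
def wordEval {n : ℕ} (w : Fin (n + 1) → Letter Γ) (a : Aut G) : Aut G :=
  evalHom a (spell (List.ofFn w))

/-- The set `Ω` of all `a` such that `w(a)` fixes `O`. -/
def Omega (O : V) {n : ℕ} (w : Fin (n + 1) → Letter Γ) : Set (Aut G) :=
  {a | Aut.onVertex O (wordEval w a) = O}

/-- The cyclic subword `wᵢ w_{i+1} ⋯ w_{i+k}`, of length `k + 1`, with indices taken modulo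
`n + 1`. -/
def cyclicSubword {n : ℕ} (w : Fin (n + 1) → Letter Γ) (i : Fin (n + 1)) (k : ℕ) :
    List (Letter Γ) :=
  List.ofFn fun j : Fin (k + 1) => w (Fin.ofNat (n + 1) (i.val + j.val))

/-- The trace `(y₀, …, y_{n+1})` of a vertex: `y₀ = y` and `y_{i+1} = yᵢ^{wᵢ(a)}`. -/
def vertexTrace {n : ℕ} (w : Fin (n + 1) → Letter Γ) (a : Aut G) (y : V) : Fin (n + 2) → V :=
  Fin.induction (motive := fun _ => V) y
    (fun i yi => Aut.onVertex yi (evalHom a (w i).toFreeProd))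

/-- The trace `(e₀, …, e_{n+1})` of an edge: `e₀ = e` and `e_{i+1} = eᵢ^{wᵢ(a)}`. -/
def edgeTrace {n : ℕ} (w : Fin (n + 1) → Letter Γ) (a : Aut G) (e : G.Dart) :
    Fin (n + 2) → G.Dart :=
  Fin.induction (motive := fun _ => G.Dart) e
    (fun i ei => Aut.onEdge ei (evalHom a (w i).toFreeProd))

/-- A trace `(l₀, …, l_{n+1})` is simple: its entries are distinct, except possibly
`l₀ = l_{n+1}`. -/
def IsSimpleTrace {α : Type*} {n : ℕ} (l : Fin (n + 2) → α) : Prop :=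
  ∀ i j : Fin (n + 2), i < j → l i = l j → i = 0 ∧ j = Fin.last (n + 1)

end TreePaper

namespace TreePaper

universe u

variable {V : Type u} {G : SimpleGraph V} {Γ : Subgroup (Aut G)} {n : ℕ}

theorem Aut.onVertex_mul (y : V) (a b : Aut G) :
    Aut.onVertex y (a * b) = Aut.onVertex (Aut.onVertex y a) b := rfl

theorem Aut.onVertex_one (y : V) : Aut.onVertex y (1 : Aut G) = y := rfl

theorem Aut.onVertex_inv_eq_iff {x y : V} {a : Aut G} :
    Aut.onVertex y a⁻¹ = x ↔ Aut.onVertex x a = y := by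
  constructor
  · rintro rfl
    rw [← Aut.onVertex_mul, inv_mul_cancel, Aut.onVertex_one]
  · rintro rfl
    rw [← Aut.onVertex_mul, mul_inv_cancel, Aut.onVertex_one]

theorem Aut.dist_onVertex (hG : G.Connected) (x y : V) (a : Aut G) :
    G.dist (Aut.onVertex x a) (Aut.onVertex y a) = G.dist x y := by
  have key : ∀ (b : Aut G) (u v : V),
      G.dist (Aut.onVertex u b) (Aut.onVertex v b) ≤ G.dist u v := by
    intro b u v
    obtain ⟨p, hp⟩ := hG.exists_walk_length_eq_dist u v
    have h := SimpleGraph.dist_le (p.map b.toIso.toHom)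
    rw [SimpleGraph.Walk.length_map, hp] at h
    exact h
  refine le_antisymm (key a x y) ?_
  have h := key a⁻¹ (Aut.onVertex x a) (Aut.onVertex y a)
  rwa [← Aut.onVertex_mul, ← Aut.onVertex_mul, mul_inv_cancel, Aut.onVertex_one,
    Aut.onVertex_one] at h

/-- In a tree, an edge pointing away from `O` also points away from every vertex `x` that is at
most as far from `O` as the origin of the edge. -/
theorem dist_lt_dist_of_isTree (hT : G.IsTree) {O x u v : V} (huv : G.Adj u v)
    (hO : G.dist O u < G.dist O v) (hx : G.dist O x ≤ G.dist O u) :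
    G.dist x u < G.dist x v := by
  by_contra hcon
  have hlt : G.dist x v < G.dist x u :=
    lt_of_le_of_ne (not_lt.1 hcon) (hT.dist_ne_of_adj x huv).symm
  have avoid : ∀ {a b c : V} (p : G.Walk a b), p.length = G.dist a b →
      G.dist a b < G.dist a c → c ∉ p.support := by
    classical
    intro a b c p hp hlt hc
    have h₁ := SimpleGraph.dist_le (p.takeUntil c hc)
    have h₂ := p.length_takeUntil_le_length hc
    omega
  obtain ⟨p, hp⟩ := hT.connected.exists_walk_length_eq_dist O u
  obtain ⟨r, hr⟩ := hT.connected.exists_walk_length_eq_dist O x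
  obtain ⟨q, hq⟩ := hT.connected.exists_walk_length_eq_dist x v
  have hbr := SimpleGraph.isBridge_iff_forall_walk_mem_edges.1
    (SimpleGraph.isAcyclic_iff_forall_adj_isBridge.1 hT.isAcyclic huv)
    ((p.reverse.append r).append q)
  simp only [SimpleGraph.Walk.edges_append, SimpleGraph.Walk.edges_reverse, List.mem_append,
    List.mem_reverse] at hbr
  rcases hbr with (h | h) | h
  · exact avoid p hp hO (p.snd_mem_support_of_mem_edges h)
  · exact avoid r hr (hx.trans_lt hO) (r.snd_mem_support_of_mem_edges h)
  · exact avoid q hq hlt (q.fst_mem_support_of_mem_edges h)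

theorem isLocallyConstant_onVertex (v : V) :
    IsLocallyConstant fun a : Aut G => Aut.onVertex v a := by
  let _ : TopologicalSpace V := ⊥
  have : DiscreteTopology V := ⟨rfl⟩
  exact (IsLocallyConstant.iff_continuous _).2
    ((continuous_apply v).comp continuous_induced_dom)

theorem evalHom_elem (a : Aut G) (g : Γ) :
    evalHom a (Letter.elem g).toFreeProd = (g : Aut G) := by
  simp [evalHom, Letter.toFreeProd]

theorem evalHom_t (a : Aut G) : evalHom a (Letter.t : Letter Γ).toFreeProd = a := by
  simp [evalHom, Letter.toFreeProd]

theorem evalHom_tInv (a : Aut G) : evalHom a (Letter.tInv : Letter Γ).toFreeProd = a⁻¹ := by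
  simp [evalHom, Letter.toFreeProd]

theorem isLocallyConstant_onVertex_evalHom (x : Letter Γ) (v : V) :
    IsLocallyConstant fun a : Aut G => Aut.onVertex v (evalHom a x.toFreeProd) := by
  cases x with
  | elem g =>
    simp only [evalHom_elem]
    exact IsLocallyConstant.const _
  | t =>
    simp only [evalHom_t]
    exact isLocallyConstant_onVertex v
  | tInv =>
    simp only [evalHom_tInv]
    refine (IsLocallyConstant.iff_isOpen_fiber).2 fun y => ?_
    have h : (fun a : Aut G => Aut.onVertex v a⁻¹) ⁻¹' {y} = {a | Aut.onVertex y a = v} := by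
      ext a
      exact Aut.onVertex_inv_eq_iff
    rw [h]
    exact (isLocallyConstant_onVertex y).isOpen_fiber v

theorem vertexTrace_succ (w : Fin (n + 1) → Letter Γ) (a : Aut G) (y : V) (i : Fin (n + 1)) :
    vertexTrace w a y i.succ =
      Aut.onVertex (vertexTrace w a y i.castSucc) (evalHom a (w i).toFreeProd) := rfl

theorem isLocallyConstant_vertexTrace (w : Fin (n + 1) → Letter Γ) (y : V) (i : Fin (n + 2)) :
    IsLocallyConstant fun a : Aut G => vertexTrace w a y i := by
  induction i using Fin.induction with
  | zero => exact IsLocallyConstant.const _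
  | succ i ih =>
    refine (IsLocallyConstant.iff_eventually_eq _).2 fun a => ?_
    filter_upwards [ih.eventually_eq a,
      (isLocallyConstant_onVertex_evalHom (w i) (vertexTrace w a y i.castSucc)).eventually_eq a]
      with b hb₁ hb₂
    rw [vertexTrace_succ, vertexTrace_succ, hb₁, hb₂]

theorem exists_vertexTrace_eq_onVertex (w : Fin (n + 1) → Letter Γ) (a : Aut G)
    (i : Fin (n + 2)) : ∃ g : Aut G, ∀ y, vertexTrace w a y i = Aut.onVertex y g := by
  induction i using Fin.induction with
  | zero => exact ⟨1, fun _ => rfl⟩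
  | succ i ih =>
    obtain ⟨g, hg⟩ := ih
    exact ⟨g * evalHom a (w i).toFreeProd, fun y => by
      rw [vertexTrace_succ, hg, Aut.onVertex_mul]⟩

theorem edgeTrace_fst_snd (w : Fin (n + 1) → Letter Γ) (a : Aut G) (e : G.Dart)
    (i : Fin (n + 2)) :
    (edgeTrace w a e i).fst = vertexTrace w a e.fst i ∧
      (edgeTrace w a e i).snd = vertexTrace w a e.snd i := by
  induction i using Fin.induction with
  | zero => exact ⟨rfl, rfl⟩
  | succ i ih =>
    rw [vertexTrace_succ, vertexTrace_succ, ← ih.1, ← ih.2]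
    exact ⟨rfl, rfl⟩

theorem isPositive_edgeTrace_iff (w : Fin (n + 1) → Letter Γ) (a : Aut G) (O : V) (e : G.Dart)
    (i : Fin (n + 2)) : IsPositive O (edgeTrace w a e i) ↔
      G.dist O (vertexTrace w a e.fst i) < G.dist O (vertexTrace w a e.snd i) := by
  rw [IsPositive, (edgeTrace_fst_snd w a e i).1, (edgeTrace_fst_snd w a e i).2]

theorem exists_forall_isPositive_edgeTrace (hT : G.IsTree) (O : V)
    (w : Fin (n + 1) → Letter Γ) (a : Aut G) :
    ∃ K : ℕ, ∀ e : G.Dart, IsPositive O e → K ≤ edgeDist O e →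
      ∀ i, IsPositive O (edgeTrace w a e i) := by
  choose g hg using exists_vertexTrace_eq_onVertex w a
  obtain ⟨K, hK⟩ := (Set.finite_range fun i => G.dist O (Aut.onVertex O (g i)⁻¹)).bddAbove
  refine ⟨K, fun e he hKe i => ?_⟩
  have hi : G.dist O (Aut.onVertex O (g i)⁻¹) ≤ K := hK ⟨i, rfl⟩
  have hinv : Aut.onVertex (Aut.onVertex O (g i)⁻¹) (g i) = O :=
    Aut.onVertex_inv_eq_iff.1 rfl
  rw [isPositive_edgeTrace_iff, hg, hg]
  have h := dist_lt_dist_of_isTree hT e.adj he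
    ((hi.trans hKe).trans (min_le_left _ _))
  rwa [← Aut.dist_onVertex hT.connected _ _ (g i), ← Aut.dist_onVertex hT.connected _ e.snd (g i),
    hinv] at h

theorem spell_cyclicSubword_succ (w : Fin (n + 1) → Letter Γ) (i : Fin (n + 1)) (k : ℕ) :
    spell (cyclicSubword w i (k + 1)) = spell (cyclicSubword w i k) *
      (w (Fin.ofNat (n + 1) (i.val + (k + 1)))).toFreeProd := by
  rw [cyclicSubword, List.ofFn_succ_last]
  simp [spell, cyclicSubword, mul_assoc]

theorem vertexTrace_eq_onVertex_cyclicSubword (w : Fin (n + 1) → Letter Γ) (a : Aut G) (y : V)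
    (i : Fin (n + 1)) (k : ℕ) (h : i.val + k + 1 < n + 2) :
    vertexTrace w a y ⟨i.val + k + 1, h⟩ =
      Aut.onVertex (vertexTrace w a y i.castSucc)
        (evalHom a (spell (cyclicSubword w i k))) := by
  induction k with
  | zero =>
    have h₀ : spell (cyclicSubword w i 0) = (w i).toFreeProd := by
      simp [spell, cyclicSubword]
    rw [h₀]
    exact vertexTrace_succ w a y i
  | succ k ih =>
    have hlt : i.val + (k + 1) < n + 1 := by omega
    have hof : Fin.ofNat (n + 1) (i.val + (k + 1)) = ⟨i.val + (k + 1), hlt⟩ :=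
      Fin.ext (Nat.mod_eq_of_lt hlt)
    rw [spell_cyclicSubword_succ, hof, map_mul, Aut.onVertex_mul, ← ih (by omega)]
    exact vertexTrace_succ w a y ⟨i.val + (k + 1), hlt⟩

theorem finite_setOf_not_isSimpleTrace (w : Fin (n + 1) → Letter Γ) (a : Aut G)
    (hfin : ∀ (i : Fin (n + 1)) (k : ℕ), k < n →
      (fixedVertices (evalHom a (spell (cyclicSubword w i k)))).Finite) :
    {y : V | ¬ IsSimpleTrace (vertexTrace w a y)}.Finite := by
  have hinj : ∀ i : Fin (n + 2), Function.Injective fun y => vertexTrace w a y i := by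
    intro i
    obtain ⟨g, hg⟩ := exists_vertexTrace_eq_onVertex w a i
    intro y z hyz
    simp only [hg] at hyz
    exact g.toIso.injective hyz
  refine (Set.finite_iUnion fun p : Fin (n + 1) × Fin n =>
    (hfin p.1 p.2 p.2.isLt).preimage (hinj p.1.castSucc).injOn).subset fun y hy => ?_
  simp only [Set.mem_ofPred_eq, IsSimpleTrace, not_forall] at hy
  obtain ⟨i, j, hij, heq, hne⟩ := hy
  have hij' : i.val < j.val := hij
  have hj := j.isLt
  have hk : j.val - i.val - 1 < n := by
    by_contra hk
    exact hne ⟨Fin.ext (by rw [Fin.val_zero]; omega), Fin.ext (by rw [Fin.val_last]; omega)⟩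
  refine Set.mem_iUnion.2 ⟨(⟨i.val, by omega⟩, ⟨j.val - i.val - 1, hk⟩), ?_⟩
  have h := vertexTrace_eq_onVertex_cyclicSubword w a y ⟨i.val, by omega⟩ (j.val - i.val - 1)
    (by simp only; omega)
  have hjj : (⟨i.val + (j.val - i.val - 1) + 1, by omega⟩ : Fin (n + 2)) = j :=
    Fin.ext (by simp only; omega)
  simp only [hjj] at h
  exact h.symm.trans heq.symm

/-- `TracesGoodBeyond O w k a` says that, at distance at least `k` from `O`, vertices have simple
traces under `w(a)` and traces of positive edges consist of positive edges. -/
def TracesGoodBeyond (O : V) (w : Fin (n + 1) → Letter Γ) (k : ℕ) (a : Aut G) : Prop :=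
  (∀ y : V, k ≤ G.dist y O → IsSimpleTrace (vertexTrace w a y)) ∧
    ∀ e : G.Dart, IsPositive O e → k ≤ edgeDist O e →
      ∀ i : Fin (n + 2), IsPositive O (edgeTrace w a e i)

theorem isClosed_setOf_tracesGoodBeyond (O : V) (w : Fin (n + 1) → Letter Γ) (k : ℕ) :
    IsClosed {a : Aut G | TracesGoodBeyond O w k a} := by
  simp only [TracesGoodBeyond, Set.ofPred_and, Set.ofPred_forall, IsSimpleTrace]
  refine IsClosed.inter ?_ ?_
  · refine isClosed_iInter fun y => isClosed_iInter fun _ => isClosed_iInter fun i =>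
      isClosed_iInter fun j => isClosed_iInter fun _ => ?_
    have h := (isLocallyConstant_vertexTrace (Γ := Γ) w y i).prodMk
      (isLocallyConstant_vertexTrace w y j)
    exact ⟨h {p | p.1 = p.2 → i = 0 ∧ j = Fin.last (n + 1)}ᶜ⟩
  · refine isClosed_iInter fun e => isClosed_iInter fun _ => isClosed_iInter fun _ =>
      isClosed_iInter fun i => ?_
    simp only [isPositive_edgeTrace_iff]
    have h := (isLocallyConstant_vertexTrace (Γ := Γ) w e.fst i).prodMk
      (isLocallyConstant_vertexTrace w e.snd i)
    exact ⟨h {p | G.dist O p.1 < G.dist O p.2}ᶜ⟩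

theorem exists_tracesGoodBeyond (hT : G.IsTree) (O : V) (w : Fin (n + 1) → Letter Γ) (a : Aut G)
    (hfin : ∀ (i : Fin (n + 1)) (k : ℕ), k < n →
      (fixedVertices (evalHom a (spell (cyclicSubword w i k)))).Finite) :
    ∃ k, TracesGoodBeyond O w k a := by
  obtain ⟨K, hK⟩ := exists_forall_isPositive_edgeTrace hT O w a
  obtain ⟨L, hL⟩ :=
    ((finite_setOf_not_isSimpleTrace w a hfin).image fun y => G.dist y O).bddAbove
  refine ⟨max K (L + 1), fun y hy => ?_, fun e he hke => hK e he ((le_max_left _ _).trans hke)⟩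
  by_contra hns
  have h₁ : G.dist y O ≤ L := hL ⟨y, hns, rfl⟩
  have h₂ : L + 1 ≤ G.dist y O := (le_max_right _ _).trans hy
  omega

open Classical in
/-- The first index at which a sequence of measurable predicates holds, as a measurable
function. -/
theorem exists_measurable_enat_eq_first {X : Type*} [MeasurableSpace X] (P : ℕ → X → Prop)
    (hP : ∀ k, MeasurableSet {x | P k x}) :
    ∃ M : X → ℕ∞, Measurable M ∧ (∀ x, (∃ k, P k x) → M x ≠ ⊤) ∧
      ∀ x (k : ℕ), M x = k → P k x := by
  refine ⟨fun x => if h : ∃ k, P k x then (Nat.find h : ℕ∞) else ⊤, ?_, ?_, ?_⟩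
  · refine ENat.measurable_iff.2 fun k => ?_
    have h : (fun x => if h : ∃ k, P k x then (Nat.find h : ℕ∞) else ⊤) ⁻¹' {(k : ℕ∞)} =
        {x | P k x} ∩ ⋂ j ∈ Set.Iio k, {x | P j x}ᶜ := by
      ext x
      by_cases hx : ∃ k, P k x
      · simp [hx, Nat.find_eq_iff]
      · have hx' : ∀ k, ¬ P k x := not_exists.1 hx
        simp [hx']
    rw [h]
    exact (hP k).inter (MeasurableSet.biInter (Set.to_countable _) fun j _ => (hP j).compl)
  · intro x hx
    simp [hx]
  · intro x k hk
    by_cases hx : ∃ k, P k x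
    · simp only [hx, dite_true, Nat.cast_inj] at hk
      exact hk ▸ Nat.find_spec hx
    · simp [hx] at hk

end TreePaper

open MeasureTheory TreePaper in
theorem sphere_of_radius_M {V : Type*} (G : SimpleGraph V) [G.LocallyFinite]
    (d : ℕ) (hd : 3 ≤ d) (hT : G.IsTree) (hreg : G.IsRegularOfDegree d) (O : V)
    (μ : Measure (Aut G)) [μ.IsHaarMeasure]
    (hμ : ∀ v : V, μ {a : Aut G | Aut.onVertex v a = v} = 1)
    (Γ : Subgroup (Aut G)) [Countable Γ] (hΓ : ActsAlmostFreely Γ)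
    {n : ℕ} (w : Fin (n + 1) → Letter Γ)
    (hw_ne : spell (List.ofFn w) ≠ 1)
    (hw_can : IsCanonicalForm (List.ofFn w))
    (hw_red : IsCyclicallyReduced (List.ofFn w))
    (hsub : ∀ᵐ a ∂μ, a ∈ Omega O w → ∀ (i : Fin (n + 1)) (k : ℕ), k < n →
      (fixedVertices (evalHom a (spell (cyclicSubword w i k)))).Finite) :
    ∃ M : Omega O w → ℕ∞,
      Measurable M ∧
      (∀ᵐ a ∂μ, ∀ ha : a ∈ Omega O w, M ⟨a, ha⟩ ≠ ⊤) ∧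
      ∀ a : Omega O w,
        (∀ y : V, M a ≤ (G.dist y O : ℕ∞) → IsSimpleTrace (vertexTrace w (a : Aut G) y)) ∧
        (∀ e : G.Dart, IsPositive O e → M a ≤ (edgeDist O e : ℕ∞) →
          ∀ i : Fin (n + 2), IsPositive O (edgeTrace w (a : Aut G) e i)) := by
  obtain ⟨M, hM, hfin, hgood⟩ := exists_measurable_enat_eq_first
    (fun k (a : Omega O w) => TracesGoodBeyond O w k (a : Aut G))
    (fun k => measurable_subtype_coe (isClosed_setOf_tracesGoodBeyond O w k).measurableSet)
  have key : ∀ (a : Omega O w) (m : ℕ), M a ≤ m →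
      ∃ k ≤ m, TracesGoodBeyond O w k (a : Aut G) := by
    intro a m hm
    obtain ⟨k, hk⟩ := ENat.ne_top_iff_exists.1 (ne_top_of_le_ne_top (ENat.natCast_ne_top m) hm)
    rw [← hk] at hm
    exact ⟨k, by exact_mod_cast hm, hgood a k hk.symm⟩
  refine ⟨M, hM, ?_, fun a => ⟨fun y hy => ?_, fun e he hMe => ?_⟩⟩
  · filter_upwards [hsub] with a h ha
    exact hfin ⟨a, ha⟩ (exists_tracesGoodBeyond hT O w a (h ha))
  · obtain ⟨k, hk, h⟩ := key a _ hy
    exact h.1 y hk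
  · obtain ⟨k, hk, h⟩ := key a _ hMe
    exact h.2 e he hk
end
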